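/- Main convex integration proposition for the Navier–Stokes equations: let d ≥ 3, let γ₀ : [0,T] → ℝ be smooth and strictly positive, let δ > 0, and let r < 2d/(d+2). If (v,p,R̊) is a smooth solution of the Navier–Stokes–Reynolds system ∂_t v + v·∇v + ∇p = Δv + div R̊, div v = 0 on [0,T] × 𝕋^d (with R̊ traceless and symmetric), then there exists another smooth solution (v₁,p₁,R̊₁) of the same system such that for all t ∈ [0,T]: (a) ‖(v₁−v)(t)‖_{W^{1,r}} + ‖R̊₁(t)‖_{L¹} < δ, and (b) | ‖(v₁−v)(t)‖_{L²}² − 2d‖R̊(t)‖_{L¹} − (2π)^d d γ₀(t) | < δ. -/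

import Mathlib

open MeasureTheory ENNReal Set Filter Topology

noncomputable section

abbrev Spc (d : ℕ) := EuclideanSpace ℝ (Fin d)
abbrev Mat (d : ℕ) := EuclideanSpace ℝ (Fin d × Fin d)
def cube (d : ℕ) : Set (Spc d) := {x | ∀ i, x i ∈ Ico (0:ℝ) (2*Real.pi)}
def μT (d : ℕ) : Measure (Spc d) := volume.restrict (cube d)
def SpacePeriodic {d : ℕ} {F : Type*} (f : Spc d → F) : Prop :=
  ∀ (x : Spc d) (i : Fin d), f (x + (2*Real.pi) • EuclideanSpace.single i 1) = f x
def SmoothField {d : ℕ} {F : Type*} [NormedAddCommGroup F] [NormedSpace ℝ F]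
    (f : ℝ → Spc d → F) : Prop :=
  ContDiff ℝ (⊤ : ℕ∞) (fun q : ℝ × Spc d => f q.1 q.2) ∧ ∀ t, SpacePeriodic (f t)
def divg {d : ℕ} (w : Spc d → Spc d) (x : Spc d) : ℝ :=
  ∑ i, fderiv ℝ w x (EuclideanSpace.single i 1) i

/-- traceless symmetric tensor field -/
def TracelessSym {d : ℕ} (R : ℝ → Spc d → Mat d) : Prop :=
  ∀ t x, (∀ i j, R t x (i, j) = R t x (j, i)) ∧ (∑ i, R t x (i, i)) = 0

/-- the Navier-Stokes-Reynolds system on [0,T] -/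
def NSR (d : ℕ) (T : ℝ) (v : ℝ → Spc d → Spc d) (pr : ℝ → Spc d → ℝ)
    (R : ℝ → Spc d → Mat d) : Prop :=
  (∀ t ∈ Icc (0:ℝ) T, ∀ x, ∀ i : Fin d,
      deriv (fun s => v s x i) t
      + fderiv ℝ (fun y => v t y i) x (v t x)
      + fderiv ℝ (pr t) x (EuclideanSpace.single i 1)
      = (∑ j, fderiv ℝ (fun y => fderiv ℝ (fun w => v t w i) y (EuclideanSpace.single j 1)) x
            (EuclideanSpace.single j 1))
        + ∑ j, fderiv ℝ (fun y => R t y (i, j)) x (EuclideanSpace.single j 1))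
  ∧ (∀ t ∈ Icc (0:ℝ) T, ∀ x, divg (v t) x = 0)

/-! ### Integration over one period -/

section TorusMeasure

open scoped Pointwise

variable {d : ℕ}

/-- The lattice basis `2π eᵢ`. -/
def latBasis (d : ℕ) : Module.Basis (Fin d) ℝ (Spc d) :=
  (EuclideanSpace.basisFun (Fin d) ℝ).toBasis.isUnitSMul (w := fun _ => 2 * Real.pi)
    (fun _ => (by positivity : (2 * Real.pi : ℝ) ≠ 0).isUnit)

lemma latBasis_apply (i : Fin d) :
    latBasis d i = (2 * Real.pi) • EuclideanSpace.single i (1 : ℝ) := by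
  simp [latBasis, Module.Basis.isUnitSMul_apply]

lemma latBasis_repr (x : Spc d) (i : Fin d) :
    (latBasis d).repr x i = x i / (2 * Real.pi) := by
  have h := congrArg (fun y : Spc d => y i) ((latBasis d).sum_repr x)
  simp only [latBasis_apply] at h
  have h2 : (latBasis d).repr x i * (2 * Real.pi) = x i := by
    rw [← h]
    simp [Finset.sum_apply, Pi.single_apply]
  rw [← h2]; field_simp

lemma cube_eq : cube d = ZSpan.fundamentalDomain (latBasis d) := by
  have hp : (0 : ℝ) < 2 * Real.pi := by positivity
  ext x
  simp only [cube, ZSpan.mem_fundamentalDomain, latBasis_repr, mem_ofPred_eq, mem_Ico,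
    div_lt_one hp]
  refine forall_congr' fun i => and_congr_left fun _ => ?_
  constructor
  · intro h; positivity
  · intro h
    by_contra h'
    exact absurd h (not_le.2 (div_neg_of_neg_of_pos (not_le.1 h') hp))

lemma measurableSet_cube : MeasurableSet (cube d) := by
  rw [cube_eq]; exact ZSpan.fundamentalDomain_measurableSet _

lemma SpacePeriodic.lattice {F : Type*} {f : Spc d → F} (hf : SpacePeriodic f)
    (g : Submodule.span ℤ (Set.range (latBasis d))) (x : Spc d) : f (x + g) = f x := by
  obtain ⟨g, hg⟩ := g
  simp only
  induction hg using Submodule.span_induction generalizing x with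
  | mem y hy =>
    obtain ⟨i, rfl⟩ := hy
    rw [latBasis_apply]; exact hf x i
  | zero => simp
  | add y z _ _ h1 h2 => rw [← add_assoc, h2, h1]
  | smul n y _ h =>
    induction n using Int.induction_on generalizing x with
    | zero => simp
    | succ n ih => rw [add_smul, one_smul, ← add_assoc, h, ih]
    | pred n ih =>
      have := h (x + (-(n : ℤ) - 1) • y)
      rw [← this, ← ih x, add_assoc]
      congr 2
      module

instance : VAddInvariantMeasure (Submodule.span ℤ (Set.range (latBasis d))) (Spc d) volume :=
  inferInstanceAs <| VAddInvariantMeasure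
    (Submodule.span ℤ (Set.range (latBasis d))).toAddSubgroup (Spc d) volume

lemma isAddFD : IsAddFundamentalDomain (Submodule.span ℤ (Set.range (latBasis d))) (cube d)
    (volume : Measure (Spc d)) := by
  rw [cube_eq]; exact ZSpan.isAddFundamentalDomain _ _

lemma isAddFD_vadd (z : Spc d) :
    IsAddFundamentalDomain (Submodule.span ℤ (Set.range (latBasis d))) (z +ᵥ cube d)
    (volume : Measure (Spc d)) := by
  have : VAddCommClass (Spc d) (Submodule.span ℤ (Set.range (latBasis d))) (Spc d) :=
    ⟨fun a b c => by simp only [vadd_eq_add, Submodule.vadd_def]; abel⟩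
  exact isAddFD.vadd_of_comm z

lemma lintegral_vadd_cube {f : Spc d → ℝ≥0∞} (hf : SpacePeriodic f) (z : Spc d) :
    ∫⁻ x in z +ᵥ cube d, f x = ∫⁻ x, f x ∂(μT d) := by
  refine (isAddFD_vadd z).setLIntegral_eq isAddFD f ?_
  intro g x
  rw [Submodule.vadd_def, vadd_eq_add, add_comm]
  exact hf.lattice g x

/-- Translation invariance of the integral of a periodic function. -/
lemma lintegral_comp_add {f : Spc d → ℝ≥0∞} (hf : SpacePeriodic f) (z : Spc d) :
    ∫⁻ x, f (x + z) ∂(μT d) = ∫⁻ x, f x ∂(μT d) := by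
  rw [← lintegral_vadd_cube hf z]
  have h := (measurePreserving_add_left (volume : Measure (Spc d)) z).setLIntegral_comp_emb
    (MeasurableEquiv.addLeft z).measurableEmbedding f (cube d)
  rw [μT, show (z +ᵥ cube d) = (fun x => z + x) '' cube d from rfl, ← h]
  simp_rw [add_comm z]

lemma volume_cube : (volume : Measure (Spc d)) (cube d) = ENNReal.ofReal ((2 * Real.pi) ^ d) := by
  have h := (EuclideanSpace.volume_preserving_symm_measurableEquiv_toLp (Fin d)).measure_preimage
    (s := Set.pi univ fun _ => Ico (0 : ℝ) (2 * Real.pi))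
    (MeasurableSet.pi countable_univ fun _ _ => measurableSet_Ico).nullMeasurableSet
  rw [Real.volume_pi_Ico] at h
  convert h using 1
  · congr 1; ext x; simp [cube]
  · simp [ENNReal.ofReal_pow (by positivity : 0 ≤ 2 * Real.pi)]

instance : IsFiniteMeasure (μT d) := by
  refine ⟨?_⟩
  rw [μT, Measure.restrict_apply_univ, volume_cube]
  exact ofReal_lt_top

lemma μT_univ : μT d univ = ENNReal.ofReal ((2 * Real.pi) ^ d) := by
  rw [μT, Measure.restrict_apply_univ, volume_cube]

lemma μT_real_univ : (μT d).real univ = (2 * Real.pi) ^ d := by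
  rw [Measure.real, μT_univ, ENNReal.toReal_ofReal (by positivity)]

/-- Integrals of periodic functions are invariant under integer dilations. -/
lemma lintegral_comp_dilation {f : Spc d → ℝ≥0∞} (hf : SpacePeriodic f) (hm : Measurable f)
    {n : ℕ} (hn : n ≠ 0) (c : Spc d) :
    ∫⁻ x, f ((n : ℝ) • x + c) ∂(μT d) = ∫⁻ x, f x ∂(μT d) := by
  have hn' : (n : ℝ) ≠ 0 := by exact_mod_cast hn
  have per (w : Spc d) : SpacePeriodic fun x => f ((n : ℝ) • x + w) := by
    intro x i
    obtain ⟨g, hg⟩ : ∃ g : Submodule.span ℤ (Set.range (latBasis d)),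
        (g : Spc d) = (n : ℝ) • (2 * Real.pi) • EuclideanSpace.single i (1 : ℝ) := by
      refine ⟨⟨n • latBasis d i, Submodule.smul_of_tower_mem _ n
        (Submodule.subset_span ⟨i, rfl⟩)⟩, ?_⟩
      simp only [latBasis_apply]
      rw [Nat.cast_smul_eq_nsmul ℝ]
    have : (n : ℝ) • (x + (2 * Real.pi) • EuclideanSpace.single i (1 : ℝ)) + w =
        (n : ℝ) • x + w + g := by
      rw [hg]; module
    simp only
    rw [this, hf.lattice]
  have key (z : Spc d) : ∫⁻ x, f ((n : ℝ) • x + c) ∂(μT d) =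
      ∫⁻ x, f (z + ((n : ℝ) • x + c)) ∂(μT d) := by
    rw [← lintegral_comp_add (per c) ((n : ℝ)⁻¹ • z)]
    refine lintegral_congr fun x => ?_
    rw [smul_add, smul_inv_smul₀ hn']
    congr 1; abel
  have h1 : ∫⁻ _ : Spc d, (∫⁻ x, f ((n : ℝ) • x + c) ∂(μT d)) ∂(μT d) =
      ∫⁻ z, ∫⁻ x, f (z + ((n : ℝ) • x + c)) ∂(μT d) ∂(μT d) :=
    lintegral_congr key
  have h3 := lintegral_lintegral_swap (μ := μT d) (ν := μT d)
    (f := fun z x => f (z + ((n : ℝ) • x + c))) (by fun_prop)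
  rw [h3] at h1
  have h2 (y : Spc d) := lintegral_comp_add hf y
  simp_rw [h2] at h1
  rw [lintegral_const, lintegral_const, ENNReal.mul_left_inj] at h1
  · exact h1
  · rw [μT_univ]; simp only [ne_eq, ofReal_eq_zero, not_le]; positivity
  · exact measure_ne_top _ _

end TorusMeasure

/-! ### The ring of smooth periodic functions, its derivations, and jets -/

section SmoothPeriodic

open scoped ContDiff

variable {V W : Type*} [NormedAddCommGroup V] [NormedSpace ℝ V]
  [NormedAddCommGroup W] [NormedSpace ℝ W] {ι κ : Type*} {per : ι → V} {per' : κ → W}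

/-- Smooth real functions with the prescribed periods. -/
def periodicSubalgebra (per : ι → V) : Subalgebra ℝ (V → ℝ) where
  carrier := {f | ContDiff ℝ ∞ f ∧ ∀ x i, f (x + per i) = f x}
  mul_mem' := fun ha hb => ⟨ha.1.mul hb.1, fun x i => by
    simp only [Pi.mul_apply, ha.2 x i, hb.2 x i]⟩
  add_mem' := fun ha hb => ⟨ha.1.add hb.1, fun x i => by
    simp only [Pi.add_apply, ha.2 x i, hb.2 x i]⟩
  algebraMap_mem' := fun _ => ⟨contDiff_const, fun _ _ => rfl⟩

/-- The algebra of smooth real functions with the prescribed periods. -/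
def PS (per : ι → V) : Type _ := periodicSubalgebra per

instance : CommRing (PS per) := inferInstanceAs (CommRing (periodicSubalgebra per))

instance : Algebra ℝ (PS per) := inferInstanceAs (Algebra ℝ (periodicSubalgebra per))

instance : CoeFun (PS per) fun _ => V → ℝ := ⟨fun u => u.1⟩

namespace PS

lemma contDiff (u : PS per) : ContDiff ℝ ∞ u := u.2.1

lemma periodic (u : PS per) (x : V) (i : ι) : u (x + per i) = u x := u.2.2 x i

@[fun_prop]
lemma continuous (u : PS per) : Continuous u := u.contDiff.continuous

lemma differentiable (u : PS per) : Differentiable ℝ u := u.contDiff.differentiable (by simp)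

@[simp] lemma add_apply (u v : PS per) (x : V) : (u + v) x = u x + v x := rfl
@[simp] lemma sub_apply (u v : PS per) (x : V) : (u - v) x = u x - v x := rfl
@[simp] lemma neg_apply (u : PS per) (x : V) : (-u) x = -u x := rfl
@[simp] lemma mul_apply (u v : PS per) (x : V) : (u * v) x = u x * v x := rfl
@[simp] lemma one_apply (x : V) : (1 : PS per) x = 1 := rfl
@[simp] lemma zero_apply (x : V) : (0 : PS per) x = 0 := rfl
@[simp] lemma smul_apply (c : ℝ) (u : PS per) (x : V) : (c • u) x = c * u x := rfl
@[simp] lemma pow_apply (u : PS per) (n : ℕ) (x : V) : (u ^ n) x = u x ^ n := rfl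
@[simp] lemma sum_apply {α : Type*} (s : Finset α) (u : α → PS per) (x : V) :
    (∑ i ∈ s, u i) x = ∑ i ∈ s, u i x := by
  induction s using Finset.cons_induction with
  | empty => rfl
  | cons a s ha ih => rw [Finset.sum_cons, Finset.sum_cons, ← ih]; rfl

lemma ext {u v : PS per} (h : ∀ x, u x = v x) : u = v := Subtype.ext (funext h)

/-- The directional derivative along `e`. -/
def D (e : V) : Derivation ℝ (PS per) (PS per) :=
  Derivation.mk'
    { toFun := fun u => ⟨fun x => fderiv ℝ u x e,
        (u.contDiff.fderiv_right (m := ∞) (by simp)).clm_apply contDiff_const, fun x i => by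
          have h : (u : V → ℝ) = fun y => u (y + per i) := funext fun y => (u.periodic y i).symm
          conv_rhs => rw [h]
          change _ = fderiv ℝ (fun y => u (y + per i)) x e
          rw [fderiv_comp_add_right]⟩
      map_add' := fun u v => ext fun x => by
        change fderiv ℝ ((u : V → ℝ) + (v : V → ℝ)) x e = fderiv ℝ u x e + fderiv ℝ v x e
        rw [fderiv_add u.differentiable.differentiableAt v.differentiable.differentiableAt]; rfl
      map_smul' := fun c u => ext fun x => by
        change fderiv ℝ (c • (u : V → ℝ)) x e = c * fderiv ℝ u x e
        rw [fderiv_const_smul u.differentiable.differentiableAt]; rfl }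
    fun u v => ext fun x => by
      change fderiv ℝ ((u : V → ℝ) * (v : V → ℝ)) x e = u x * fderiv ℝ v x e + v x * fderiv ℝ u x e
      rw [fderiv_mul u.differentiable.differentiableAt v.differentiable.differentiableAt]; rfl

lemma D_apply (e : V) (u : PS per) (x : V) : D e u x = fderiv ℝ u x e := rfl

lemma D_add_dir (e f : V) (u : PS per) : D (e + f) u = D e u + D f u :=
  ext fun x => by simp [D_apply]

lemma D_smul_dir (c : ℝ) (e : V) (u : PS per) : D (c • e) u = c • D e u :=
  ext fun x => by simp [D_apply]

lemma D_sum_dir {α : Type*} (s : Finset α) (e : α → V) (u : PS per) :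
    D (∑ i ∈ s, e i) u = ∑ i ∈ s, D (e i) u :=
  ext fun x => by simp [D_apply]

lemma D_comm (e f : V) (u : PS per) : D e (D f u) = D f (D e u) := by
  refine ext fun x => ?_
  have hd : DifferentiableAt ℝ (fderiv ℝ (u : V → ℝ)) x :=
    ((u.contDiff.fderiv_right (m := ∞) (by simp)).differentiable (by simp)).differentiableAt
  have key (a b : V) : D a (D b u) x = fderiv ℝ (fderiv ℝ (u : V → ℝ)) x a b := by
    change fderiv ℝ (fun y => fderiv ℝ (u : V → ℝ) y b) x a = _
    rw [fderiv_clm_apply hd (differentiableAt_const b)]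
    simp
  rw [key, key]
  exact (u.contDiff.contDiffAt.isSymmSndFDerivAt
    (by rw [minSmoothness_of_isRCLikeNormedField]; exact ENat.LEInfty.out)).eq e f

/-- Composition with a smooth map compatible with the periods. -/
def comp (θ : V → W) (hθ : ContDiff ℝ ∞ θ)
    (hp : ∀ (u : PS per') x i, u (θ (x + per i)) = u (θ x)) : PS per' →ₐ[ℝ] PS per where
  toFun u := ⟨fun x => u (θ x), u.contDiff.comp hθ, hp u⟩
  map_one' := rfl
  map_mul' _ _ := rfl
  map_zero' := rfl
  map_add' _ _ := rfl
  commutes' _ := rfl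

section Jet

variable {δ : Type*} [Fintype δ] (e : δ → V)

/-- The sum of the absolute values of the iterated derivatives of order at most `n` along the
directions `e`. -/
def jet : ℕ → PS per → V → ℝ
  | 0, u => fun x => |u x|
  | n + 1, u => fun x => |u x| + ∑ i, jet n (D (e i) u) x

variable {e}

lemma jet_zero (u : PS per) (x : V) : jet e 0 u x = |u x| := rfl

lemma jet_succ (n : ℕ) (u : PS per) (x : V) :
    jet e (n + 1) u x = |u x| + ∑ i, jet e n (D (e i) u) x := rfl

lemma jet_nonneg (n : ℕ) (u : PS per) (x : V) : 0 ≤ jet e n u x := by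
  induction n generalizing u with
  | zero => exact abs_nonneg _
  | succ n ih => exact add_nonneg (abs_nonneg _) (Finset.sum_nonneg fun i _ => ih _)

@[fun_prop]
lemma continuous_jet (n : ℕ) (u : PS per) : Continuous (jet e n u) := by
  induction n generalizing u with
  | zero => exact u.continuous.abs
  | succ n ih => exact u.continuous.abs.add (continuous_finsetSum _ fun i _ => ih _)

lemma abs_le_jet (n : ℕ) (u : PS per) (x : V) : |u x| ≤ jet e n u x := by
  cases n with
  | zero => exact le_rfl
  | succ n => exact le_add_of_nonneg_right (Finset.sum_nonneg fun i _ => jet_nonneg _ _ _)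

lemma jet_D_le (n : ℕ) (u : PS per) (x : V) (i : δ) :
    jet e n (D (e i) u) x ≤ jet e (n + 1) u x := by
  rw [jet_succ]
  have := Finset.single_le_sum (f := fun i => jet e n (D (e i) u) x)
    (fun i _ => jet_nonneg n _ x) (Finset.mem_univ i)
  linarith [abs_nonneg (u x)]

lemma jet_le_succ (n : ℕ) (u : PS per) (x : V) : jet e n u x ≤ jet e (n + 1) u x := by
  induction n generalizing u with
  | zero => exact abs_le_jet _ _ _
  | succ n ih =>
    rw [jet_succ, jet_succ (n + 1)]
    gcongr
    exact ih _

lemma jet_mono {m n : ℕ} (h : m ≤ n) (u : PS per) (x : V) : jet e m u x ≤ jet e n u x :=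
  monotone_nat_of_le_succ (f := fun n => jet e n u x) (fun n => jet_le_succ n u x) h

lemma jet_add_le (n : ℕ) (u v : PS per) (x : V) :
    jet e n (u + v) x ≤ jet e n u x + jet e n v x := by
  induction n generalizing u v with
  | zero => exact abs_add_le _ _
  | succ n ih =>
    simp only [jet_succ, map_add]
    have h : ∑ i, jet e n (D (e i) u + D (e i) v) x ≤
        ∑ i, (jet e n (D (e i) u) x + jet e n (D (e i) v) x) :=
      Finset.sum_le_sum fun i _ => ih _ _
    rw [Finset.sum_add_distrib] at h
    have h2 : |(u + v) x| ≤ |u x| + |v x| := abs_add_le _ _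
    linarith

lemma jet_smul (n : ℕ) (c : ℝ) (u : PS per) (x : V) :
    jet e n (c • u) x = |c| * jet e n u x := by
  induction n generalizing u with
  | zero => simp [jet_zero, abs_mul]
  | succ n ih => simp [jet_succ, ih, abs_mul, mul_add, Finset.mul_sum]

lemma jet_neg (n : ℕ) (u : PS per) (x : V) : jet e n (-u) x = jet e n u x := by
  have := jet_smul (e := e) n (-1) u x
  simpa using this

lemma jet_sub_le (n : ℕ) (u v : PS per) (x : V) :
    jet e n (u - v) x ≤ jet e n u x + jet e n v x := by
  rw [sub_eq_add_neg, ← jet_neg n v]; exact jet_add_le _ _ _ _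

lemma jet_sum_le {α : Type*} (s : Finset α) (n : ℕ) (u : α → PS per) (x : V) :
    jet e n (∑ a ∈ s, u a) x ≤ ∑ a ∈ s, jet e n (u a) x := by
  induction s using Finset.cons_induction with
  | empty =>
    have := jet_smul (e := e) n 0 (0 : PS per) x
    simp at this; simp [this]
  | cons a s ha ih =>
    rw [Finset.sum_cons, Finset.sum_cons]
    exact (jet_add_le _ _ _ _).trans (by gcongr)

lemma jet_mul_le (n : ℕ) (u v : PS per) (x : V) :
    jet e n (u * v) x ≤ 3 ^ n * (jet e n u x * jet e n v x) := by
  induction n generalizing u v with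
  | zero => simp [jet_zero, abs_mul]
  | succ n ih =>
    rw [jet_succ]
    have h1 : ∑ i, jet e n (D (e i) (u * v)) x ≤
        ∑ i, 3 ^ n * (jet e (n + 1) u x * jet e n (D (e i) v) x
          + jet e (n + 1) v x * jet e n (D (e i) u) x) := by
      refine Finset.sum_le_sum fun i _ => ?_
      rw [Derivation.leibniz, smul_eq_mul, smul_eq_mul]
      refine (jet_add_le _ _ _ _).trans ?_
      refine (add_le_add (ih _ _) (ih _ _)).trans ?_
      rw [← mul_add]
      have := jet_nonneg (e := e) n (D (e i) v) x
      have := jet_nonneg (e := e) n (D (e i) u) x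
      gcongr <;> exact jet_le_succ _ _ _
    rw [← Finset.mul_sum, Finset.sum_add_distrib, ← Finset.mul_sum, ← Finset.mul_sum] at h1
    have hu : ∑ i, jet e n (D (e i) u) x ≤ jet e (n + 1) u x := by
      rw [jet_succ]; linarith [abs_nonneg (u x)]
    have hv : ∑ i, jet e n (D (e i) v) x ≤ jet e (n + 1) v x := by
      rw [jet_succ]; linarith [abs_nonneg (v x)]
    have hU := jet_nonneg (e := e) (n + 1) u x
    have hV := jet_nonneg (e := e) (n + 1) v x
    have h0 : |(u * v) x| ≤ jet e (n + 1) u x * jet e (n + 1) v x := by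
      rw [mul_apply, abs_mul]
      exact mul_le_mul (abs_le_jet _ _ _) (abs_le_jet _ _ _) (abs_nonneg _) hU
    have h3 : (1 : ℝ) ≤ 3 ^ n := one_le_pow₀ (by norm_num)
    calc _ ≤ jet e (n + 1) u x * jet e (n + 1) v x + 3 ^ n *
          (jet e (n + 1) u x * jet e (n + 1) v x + jet e (n + 1) v x * jet e (n + 1) u x) := by
          refine add_le_add h0 (h1.trans ?_); gcongr
      _ ≤ _ := by
          rw [pow_succ]; nlinarith [mul_nonneg hU hV]

end Jet

end PS

/-- The periods of the torus. -/
def perE (d : ℕ) (i : Fin d) : Spc d := (2 * Real.pi) • EuclideanSpace.single i (1 : ℝ)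

/-- The spatial periods of functions of time and space. -/
def perX (d : ℕ) (i : Fin d) : ℝ × Spc d := (0, perE d i)

/-- Smooth functions on the torus. -/
abbrev PE (d : ℕ) := PS (perE d)

/-- Smooth functions on time-space, periodic in space. -/
abbrev PX (d : ℕ) := PS (perX d)

/-- The coordinate vectors. -/
def dirE (d : ℕ) (i : Fin d) : Spc d := EuclideanSpace.single i (1 : ℝ)

/-- The spatial coordinate vectors. -/
def dirX (d : ℕ) (i : Fin d) : ℝ × Spc d := (0, dirE d i)

end SmoothPeriodic

/-! ### The algebraic identity behind one perturbation step -/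

section Identity

variable {𝓡 ι : Type*} [CommRing 𝓡] [Algebra ℝ 𝓡] [Fintype ι]

/-- The flat Laplacian associated with a family of derivations. -/
def lapl (D : ι → Derivation ℝ 𝓡 𝓡) (u : 𝓡) : 𝓡 := ∑ k, D k (D k u)

/-- The derivation along `ξ`. -/
def dirD (D : ι → Derivation ℝ 𝓡 𝓡) (ξ : ι → ℝ) : Derivation ℝ 𝓡 𝓡 := ∑ j, ξ j • D j

variable {D : ι → Derivation ℝ 𝓡 𝓡} (ξ : ι → ℝ)

lemma dirD_apply (u : 𝓡) : dirD D ξ u = ∑ j, ξ j • D j u := by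
  have h : (⇑(dirD D ξ) : 𝓡 → 𝓡) = ∑ j, ⇑(ξ j • D j) :=
    map_sum Derivation.coeFnAddMonoidHom _ _
  simp [h]

lemma lapl_add (u v : 𝓡) : lapl D (u + v) = lapl D u + lapl D v := by
  simp [lapl, Finset.sum_add_distrib]

lemma lapl_sub (u v : 𝓡) : lapl D (u - v) = lapl D u - lapl D v := by
  simp [lapl, Finset.sum_sub_distrib]

lemma lapl_smul (c : ℝ) (u : 𝓡) : lapl D (c • u) = c • lapl D u := by
  simp [lapl, Finset.smul_sum]

lemma lapl_mul (u v : 𝓡) :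
    lapl D (u * v) = u * lapl D v + 2 * (∑ k, D k u * D k v) + v * lapl D u := by
  simp only [lapl, Finset.mul_sum, ← Finset.sum_add_distrib]
  refine Finset.sum_congr rfl fun k _ => ?_
  simp only [Derivation.leibniz, smul_eq_mul, map_add]
  ring

lemma lapl_comm (Y : Derivation ℝ 𝓡 𝓡) (hY : ∀ k u, Y (D k u) = D k (Y u)) (u : 𝓡) :
    Y (lapl D u) = lapl D (Y u) := by
  simp [lapl, hY]

lemma dirD_comm (Y : Derivation ℝ 𝓡 𝓡) (hY : ∀ k u, Y (D k u) = D k (Y u)) (u : 𝓡) :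
    Y (dirD D ξ u) = dirD D ξ (Y u) := by
  simp [dirD_apply, hY]

/-- The divergence-free perturbation `Δφ ξ - ∇∂_ξφ`. -/
def wpert (D : ι → Derivation ℝ 𝓡 𝓡) (φ : 𝓡) (i : ι) : 𝓡 :=
  ξ i • lapl D φ - D i (dirD D ξ φ)

lemma div_wpert (hD : ∀ i j u, D i (D j u) = D j (D i u)) (φ : 𝓡) :
    ∑ i, D i (wpert ξ D φ i) = 0 := by
  simp only [wpert, map_sub, Derivation.map_smul, Finset.sum_sub_distrib]
  rw [← dirD_apply, ← lapl]
  rw [lapl_comm _ (fun k u => (dirD_comm ξ (D k) (hD k) u).symm), sub_self]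

/-- The new stress created by the perturbation `wpert` with potential `φ`. -/
def stressErr (D : ι → Derivation ℝ 𝓡 𝓡) (v : ι → 𝓡) (A f g h φ ψ : 𝓡) (i j : ι) : 𝓡 :=
  (ξ j • D i ψ + ξ i • D j ψ)
    + (v i * wpert ξ D φ j + wpert ξ D φ i * v j)
    - (D i (wpert ξ D φ j) + D j (wpert ξ D φ i))
    + (wpert ξ D φ i * wpert ξ D φ j - (ξ i * ξ j) • (A * f))
    + (ξ i * ξ j) • (A * g)
    + (ξ j • D i (h * dirD D ξ A) + ξ i • D j (h * dirD D ξ A))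
    + (ξ i * ξ j) • (h * lapl D A - 2 * ∑ k, D k (h * D k A))

lemma sum_smul_D (ξ : ι → ℝ) (c : ℝ) (u : 𝓡) :
    ∑ j, D j ((c * ξ j) • u) = c • dirD D ξ u := by
  simp [dirD_apply, Finset.smul_sum, mul_smul]

lemma stress_identity (Dt : Derivation ℝ 𝓡 𝓡) (hD : ∀ i j u, D i (D j u) = D j (D i u))
    (hDt : ∀ i u, Dt (D i u) = D i (Dt u)) (v : ι → 𝓡) (A f g h φ ψ : 𝓡)
    (hf : f = 1 + lapl D h + g) (hφ : Dt φ = ψ - A * dirD D ξ h) (i : ι) :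
    Dt (wpert ξ D φ i)
      + ∑ j, D j (v i * wpert ξ D φ j + wpert ξ D φ i * v j + wpert ξ D φ i * wpert ξ D φ j)
      + D i (dirD D ξ (Dt φ + ψ + h * dirD D ξ A))
    = ∑ j, D j (D j (wpert ξ D φ i))
      + ∑ j, D j (stressErr ξ D v A f g h φ ψ i j + (ξ i * ξ j) • A) := by
  set Y := dirD D ξ with hYdef
  have hY : ∀ k u, Y (D k u) = D k (Y u) := fun k u => (dirD_comm ξ (D k) (hD k) u).symm
  have hYl := lapl_comm Y hY
  have hDl (k) := lapl_comm (D k) (hD k)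
  have htl := lapl_comm Dt hDt
  have htY : ∀ u, Dt (Y u) = Y (Dt u) := dirD_comm ξ Dt hDt
  set b := h * Y A with hb
  have hsplit (j : ι) : stressErr ξ D v A f g h φ ψ i j + (ξ i * ξ j) • A =
      (ξ j • D i ψ + ξ i • D j ψ)
      + (v i * wpert ξ D φ j + wpert ξ D φ i * v j + wpert ξ D φ i * wpert ξ D φ j)
      - (D i (wpert ξ D φ j) + D j (wpert ξ D φ i))
      + (ξ j • D i b + ξ i • D j b)
      + (ξ i * ξ j) • (h * lapl D A - 2 * (∑ k, D k (h * D k A)) - A * lapl D h) := by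
    rw [stressErr, hf]
    simp only [mul_add, mul_one, smul_add, smul_sub, ← hYdef, ← hb]
    abel
  have hsum (u : 𝓡) : ∑ j, D j (ξ j • D i u + ξ i • D j u) = D i (Y u) + ξ i • lapl D u := by
    simp only [map_add, Derivation.map_smul, Finset.sum_add_distrib, ← Finset.smul_sum]
    rw [← dirD_apply, ← lapl, ← hYdef, hY]
  have hdivw : ∑ j, D j (D i (wpert ξ D φ j)) = 0 := by
    simp_rw [hD _ i]
    rw [← map_sum, div_wpert ξ hD, map_zero]
  simp only [hsplit]
  simp only [map_add (D _) (_ + _ - _ + _) _, map_add (D _) (_ + _ - _) _, map_sub (D _) (_ + _) _,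
    map_add (D _) (_ • _ + _) (_ + _ + _), Finset.sum_add_distrib, Finset.sum_sub_distrib]
  have hsum' : ∑ j, D j (D i (wpert ξ D φ j) + D j (wpert ξ D φ i)) =
      ∑ j, D j (D j (wpert ξ D φ i)) := by
    simp only [map_add, Finset.sum_add_distrib, hdivw, zero_add]
  have hw : Dt (wpert ξ D φ i) = ξ i • lapl D (Dt φ) - D i (Y (Dt φ)) := by
    rw [wpert, map_sub, Derivation.map_smul, htl, hDt, ← htY]
  have key : lapl D b + lapl D (A * Y h) +
      Y (h * lapl D A - 2 * (∑ k, D k (h * D k A)) - A * lapl D h) = 0 := by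
    have e1 : lapl D b + lapl D (A * Y h) = Y (lapl D (A * h)) := by
      rw [hYl, Derivation.leibniz, smul_eq_mul, smul_eq_mul, lapl_add, hb, add_comm]
    have e2 : ∑ k, D k (h * D k A) = h * lapl D A + ∑ k, D k A * D k h := by
      simp only [Derivation.leibniz, smul_eq_mul, Finset.sum_add_distrib, lapl, Finset.mul_sum]
    rw [e1, ← map_add, e2, lapl_mul]
    convert map_zero Y using 2
    ring
  rw [sum_smul_D, hsum, hsum, hsum', hw, hφ, lapl_sub]
  simp only [map_add, map_sub, smul_sub]
  have key' := congrArg (fun u => ξ i • u) key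
  simp only [smul_add, smul_zero, map_sub, smul_sub] at key'
  linear_combination (exp := 1) -key'

end Identity

/-! ### Bounds in `L^p` of the torus -/

section TorusBounds

open scoped Pointwise ContDiff

variable {d : ℕ}

lemma integral_comp_add {f : Spc d → ℝ} (hf : SpacePeriodic f) (z : Spc d) :
    ∫ x, f (x + z) ∂(μT d) = ∫ x, f x ∂(μT d) := by
  have h1 : ∫ x in z +ᵥ cube d, f x = ∫ x, f x ∂(μT d) := by
    refine (isAddFD_vadd z).setIntegral_eq isAddFD (f := f) ?_
    intro g x
    rw [Submodule.vadd_def, vadd_eq_add, add_comm]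
    exact hf.lattice g x
  rw [← h1]
  have h := (measurePreserving_add_left (volume : Measure (Spc d)) z).setIntegral_image_emb
    (MeasurableEquiv.addLeft z).measurableEmbedding f (cube d)
  rw [μT, show (z +ᵥ cube d) = (fun x => z + x) '' cube d from rfl, h]
  simp_rw [add_comm z]

lemma exists_mem_cube (x : Spc d) :
    ∃ g : Submodule.span ℤ (Set.range (latBasis d)), x + g ∈ cube d := by
  obtain ⟨g, hg, -⟩ := ZSpan.exist_unique_vadd_mem_fundamentalDomain (latBasis d) x
  refine ⟨g, ?_⟩
  rw [cube_eq, add_comm]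
  exact hg

lemma PS.spacePeriodic (u : PE d) : SpacePeriodic u := fun x i => u.periodic x i

lemma PS.spacePeriodic_slice (u : PX d) (t : ℝ) : SpacePeriodic fun x => u (t, x) :=
  fun x i => by simpa [perX, perE] using u.periodic (t, x) i

/-- Restriction to a fixed time. -/
def slice (t : ℝ) : PX d →ₐ[ℝ] PE d :=
  PS.comp (fun x => (t, x)) (contDiff_const.prodMk contDiff_id)
    fun u x i => u.spacePeriodic_slice t x i

lemma slice_apply (t : ℝ) (u : PX d) (x : Spc d) : slice t u x = u (t, x) := rfl

lemma D_slice (t : ℝ) (e : Spc d) (u : PX d) :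
    PS.D e (slice t u) = slice t (PS.D ((0, e) : ℝ × Spc d) u) := by
  refine PS.ext fun x => ?_
  have h : HasFDerivAt (fun x => u (t, x))
      ((fderiv ℝ (u : ℝ × Spc d → ℝ) (t, x)).comp (ContinuousLinearMap.inr ℝ ℝ (Spc d))) x :=
    HasFDerivAt.comp x u.differentiable.differentiableAt.hasFDerivAt (hasFDerivAt_prodMk_right t x)
  change fderiv ℝ (fun x => u (t, x)) x e = _
  rw [h.fderiv]
  rfl

lemma exists_bound_of_continuous {f : ℝ × Spc d → ℝ} (hf : Continuous f)
    (hp : ∀ t, SpacePeriodic fun x => f (t, x)) (T : ℝ) :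
    ∃ K, ∀ t ∈ Icc 0 T, ∀ x, |f (t, x)| ≤ K := by
  have hc : IsCompact (Icc (0 : ℝ) T ×ˢ closure (cube d)) := by
    refine isCompact_Icc.prod ?_
    rw [cube_eq]
    exact (ZSpan.fundamentalDomain_isBounded (latBasis d)).isCompact_closure
  obtain ⟨K, hK⟩ := hc.exists_bound_of_continuousOn hf.continuousOn
  refine ⟨K, fun t ht x => ?_⟩
  obtain ⟨g, hg⟩ := exists_mem_cube x
  rw [← (hp t).lattice g x]
  exact hK (t, x + g) ⟨ht, subset_closure hg⟩

lemma exists_jet_bound (n : ℕ) (u : PX d) (T : ℝ) :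
    ∃ K, ∀ t ∈ Icc 0 T, ∀ x, PS.jet (dirX d) n u (t, x) ≤ K := by
  induction n generalizing u with
  | zero => exact exists_bound_of_continuous u.continuous u.spacePeriodic_slice T
  | succ n ih =>
    choose K hK using fun i => ih (PS.D (dirX d i) u)
    obtain ⟨K0, hK0⟩ := exists_bound_of_continuous u.continuous u.spacePeriodic_slice T
    exact ⟨K0 + ∑ i, K i, fun t ht x =>
      add_le_add (hK0 t ht x) (Finset.sum_le_sum fun i _ => hK i t ht x)⟩

lemma PS.exists_abs_le (u : PE d) : ∃ K, ∀ x, |u x| ≤ K := by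
  obtain ⟨K, hK⟩ := exists_bound_of_continuous (f := fun q => u q.2)
    (u.continuous.comp continuous_snd) (fun _ => u.spacePeriodic) 0
  exact ⟨K, fun x => hK 0 (by simp) x⟩

lemma PS.integrable (u : PE d) : Integrable u (μT d) := by
  obtain ⟨K, hK⟩ := u.exists_abs_le
  exact Integrable.of_bound u.continuous.aestronglyMeasurable K (Eventually.of_forall hK)

lemma PS.integral_D (u : PE d) (e : Spc d) : ∫ x, PS.D e u x ∂(μT d) = 0 := by
  obtain ⟨K, hK⟩ := (PS.D e u).exists_abs_le
  have h := (hasDerivAt_integral_of_dominated_loc_of_deriv_le (μ := μT d) (𝕜 := ℝ)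
    (F := fun s x => u (x + s • e)) (F' := fun s x => PS.D e u (x + s • e)) (x₀ := 0)
    (bound := fun _ => K) (s := univ) univ_mem
    (Eventually.of_forall fun s =>
      (u.continuous.comp (continuous_id.add continuous_const)).aestronglyMeasurable)
    (by simpa using u.integrable)
    ((PS.D e u).continuous.comp (continuous_id.add continuous_const)).aestronglyMeasurable
    (Eventually.of_forall fun x s _ => hK _) (integrable_const K)
    (Eventually.of_forall fun x s _ => by
      have h1 : HasDerivAt (fun s : ℝ => x + s • e) e s := by
        simpa using ((hasDerivAt_id s).smul_const e).const_add x
      exact (u.differentiable.differentiableAt.hasFDerivAt (x := x + s • e)).comp_hasDerivAt s h1)).2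
  have h2 (s : ℝ) : ∫ x, u (x + s • e) ∂(μT d) = ∫ x, u x ∂(μT d) :=
    integral_comp_add u.spacePeriodic _
  simp only [h2, zero_smul, add_zero] at h
  exact h.unique (hasDerivAt_const _ _)

/-- `u` is continuous with `L^p` norm on the torus at most `c`. -/
structure LB (p : ℝ≥0∞) (u : Spc d → ℝ) (c : ℝ) : Prop where
  cont : Continuous u
  nonneg : 0 ≤ c
  le : eLpNorm u p (μT d) ≤ ENNReal.ofReal c

namespace LB

variable {p q : ℝ≥0∞} {u v : Spc d → ℝ} {a b c : ℝ}

lemma weaken (h : LB p u a) (hab : a ≤ b) : LB p u b :=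
  ⟨h.cont, h.nonneg.trans hab, h.le.trans (ENNReal.ofReal_le_ofReal hab)⟩

lemma mono (h : LB p v a) (hu : Continuous u) (huv : ∀ x, |u x| ≤ v x) : LB p u a :=
  ⟨hu, h.nonneg, (eLpNorm_mono_real huv).trans h.le⟩

lemma add (hp : 1 ≤ p) (hu : LB p u a) (hv : LB p v b) : LB p (fun x => u x + v x) (a + b) :=
  ⟨hu.cont.add hv.cont, add_nonneg hu.nonneg hv.nonneg, by
    rw [ENNReal.ofReal_add hu.nonneg hv.nonneg]
    exact (eLpNorm_add_le hu.cont.aestronglyMeasurable hv.cont.aestronglyMeasurable hp).trans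
      (add_le_add hu.le hv.le)⟩

lemma const_mul (k : ℝ) (hu : LB p u a) : LB p (fun x => k * u x) (|k| * a) :=
  ⟨continuous_const.mul hu.cont, mul_nonneg (abs_nonneg _) hu.nonneg, by
    have h := eLpNorm_const_smul k u p (μT d)
    rw [show (fun x => k * u x) = k • u from rfl, h, ENNReal.ofReal_mul (abs_nonneg _)]
    gcongr
    · rw [Real.enorm_eq_ofReal_abs]
    · exact hu.le⟩

lemma zero (p : ℝ≥0∞) : LB p (fun _ : Spc d => (0 : ℝ)) 0 :=
  ⟨continuous_const, le_rfl, by simp⟩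

lemma sum (hp : 1 ≤ p) {α : Type*} (s : Finset α) {u : α → Spc d → ℝ} {c : α → ℝ}
    (h : ∀ i ∈ s, LB p (u i) (c i)) : LB p (fun x => ∑ i ∈ s, u i x) (∑ i ∈ s, c i) := by
  induction s using Finset.cons_induction with
  | empty => simpa using zero p
  | cons a s ha ih =>
    simp only [Finset.sum_cons]
    exact (h a (Finset.mem_cons_self _ _)).add hp
      (ih fun i hi => h i (Finset.mem_cons_of_mem hi))

lemma mul (hu : LB 2 u a) (hv : LB 2 v b) : LB 1 (fun x => u x * v x) (a * b) :=
  ⟨hu.cont.mul hv.cont, mul_nonneg hu.nonneg hv.nonneg, by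
    rw [ENNReal.ofReal_mul hu.nonneg]
    have h := eLpNorm_smul_le_mul_eLpNorm (p := 2) (q := 2) (r := 1) (μ := μT d)
      hv.cont.aestronglyMeasurable hu.cont.aestronglyMeasurable
    exact h.trans (mul_le_mul' hu.le hv.le)⟩

lemma comp_dilation (h : LB p u a) (hu : SpacePeriodic u) (hp : p ≠ 0) (hp' : p ≠ ⊤)
    {n : ℕ} (hn : n ≠ 0) (z : Spc d) : LB p (fun x => u ((n : ℝ) • x + z)) a := by
  have hc : Continuous fun x => u ((n : ℝ) • x + z) :=
    h.cont.comp (by fun_prop)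
  refine ⟨hc, h.nonneg, le_trans (le_of_eq ?_) h.le⟩
  rw [eLpNorm_eq_lintegral_rpow_enorm_toReal hp hp', eLpNorm_eq_lintegral_rpow_enorm_toReal hp hp']
  congr 1
  have hm : Measurable u := h.cont.measurable
  exact lintegral_comp_dilation (f := fun x => ‖u x‖ₑ ^ p.toReal)
    (fun x i => by simp only [hu x i]) (by fun_prop) hn z

/-- The constant in the inclusion of Lebesgue spaces of the torus. -/
def incl (d : ℕ) (q p : ℝ≥0∞) : ℝ := ((2 * Real.pi) ^ d) ^ (1 / q.toReal - 1 / p.toReal)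

lemma incl_pos (d : ℕ) (q p : ℝ≥0∞) : 0 < incl d q p := by unfold incl; positivity

lemma of_le (h : LB p u a) (hqp : q ≤ p) : LB q u (a * incl d q p) := by
  refine ⟨h.cont, mul_nonneg h.nonneg (incl_pos _ _ _).le, ?_⟩
  refine (eLpNorm_le_eLpNorm_mul_rpow_measure_univ hqp h.cont.aestronglyMeasurable).trans ?_
  rw [ENNReal.ofReal_mul h.nonneg, μT_univ, ENNReal.ofReal_rpow_of_pos (by positivity)]
  exact mul_le_mul' h.le le_rfl

lemma abs_integral_le (h : LB 1 u a) : |∫ x, u x ∂(μT d)| ≤ a := by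
  have h1 : ∫⁻ x, ‖u x‖ₑ ∂(μT d) ≤ ENNReal.ofReal a := by
    rw [← eLpNorm_one_eq_lintegral_enorm]; exact h.le
  have h2 := (enorm_integral_le_lintegral_enorm u).trans h1
  rw [Real.enorm_eq_ofReal_abs] at h2
  exact (ENNReal.ofReal_le_ofReal_iff h.nonneg).1 h2

lemma of_bound (hu : Continuous u) {K : ℝ} (hK : ∀ x, |u x| ≤ K) (p : ℝ≥0∞) :
    LB p u (K * ((2 * Real.pi) ^ d) ^ (p.toReal⁻¹)) := by
  have hK0 : 0 ≤ K := (abs_nonneg _).trans (hK 0)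
  refine ⟨hu, by positivity, ?_⟩
  refine (eLpNorm_le_of_ae_bound (Eventually.of_forall hK)).trans ?_
  rw [μT_univ, ENNReal.ofReal_rpow_of_pos (by positivity), mul_comm, ENNReal.ofReal_mul hK0]

end LB

end TorusBounds

/-! ### Pointwise estimates for the perturbation -/

section Pointwise

variable {d : ℕ}

/-- The spatial derivations on functions of time and space. -/
abbrev DX (d : ℕ) (i : Fin d) : Derivation ℝ (PX d) (PX d) := PS.D (dirX d i)

/-- The derivations on functions on the torus. -/
abbrev DE (d : ℕ) (i : Fin d) : Derivation ℝ (PE d) (PE d) := PS.D (dirE d i)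

/-- The time derivation. -/
abbrev Dt (d : ℕ) : Derivation ℝ (PX d) (PX d) := PS.D ((1, 0) : ℝ × Spc d)

lemma sum_dirE (ξ : Spc d) : ∑ j, ξ j • dirE d j = ξ := by
  ext i
  simp [dirE, Pi.single_apply]

lemma dirD_DE (ξ : Spc d) (u : PE d) : dirD (DE d) ξ u = PS.D ξ u := by
  rw [dirD_apply]
  conv_rhs => rw [← sum_dirE ξ, PS.D_sum_dir]
  simp only [PS.D_smul_dir]

lemma dirD_DX (ξ : Spc d) (u : PX d) : dirD (DX d) ξ u = PS.D ((0, ξ) : ℝ × Spc d) u := by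
  have h : ((0, ξ) : ℝ × Spc d) = ∑ j, ξ j • dirX d j := by
    have : ∑ j, ξ j • dirX d j = ContinuousLinearMap.inr ℝ ℝ (Spc d) (∑ j, ξ j • dirE d j) := by
      simp [dirX]
    rw [this, sum_dirE]; rfl
  rw [dirD_apply, h, PS.D_sum_dir]
  simp only [PS.D_smul_dir]

/-- The travelling and oscillating change of variables `(t, x) ↦ n (x - ω t ξ)`. -/
def pull (n : ℕ) (ω : ℝ) (ξ : Spc d) : PE d →ₐ[ℝ] PX d :=
  PS.comp (fun q : ℝ × Spc d => (n : ℝ) • q.2 + (-(n * ω * q.1)) • ξ) (by fun_prop)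
    fun u q i => by
      have h := u.spacePeriodic.lattice ⟨n • latBasis d i, Submodule.smul_of_tower_mem _ n
        (Submodule.subset_span ⟨i, rfl⟩)⟩ ((n : ℝ) • q.2 + (-(n * ω * q.1)) • ξ)
      rw [← h]
      refine congrArg u.1 ?_
      simp only [perX, perE, Prod.fst_add, Prod.snd_add, add_zero, smul_add,
        ← Nat.cast_smul_eq_nsmul ℝ, latBasis_apply]
      abel

lemma pull_apply (n : ℕ) (ω : ℝ) (ξ : Spc d) (u : PE d) (t : ℝ) (x : Spc d) :
    pull n ω ξ u (t, x) = u ((n : ℝ) • x + (-(n * ω * t)) • ξ) := rfl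

lemma D_pull (n : ℕ) (ω : ℝ) (ξ : Spc d) (u : PE d) (s : ℝ) (e : Spc d) :
    PS.D ((s, e) : ℝ × Spc d) (pull n ω ξ u) =
      pull n ω ξ (PS.D ((n : ℝ) • e + (-(n * ω * s)) • ξ) u) := by
  refine PS.ext fun q => ?_
  have h1 : HasFDerivAt (fun q : ℝ × Spc d => (n : ℝ) • q.2 + (-(n * ω * q.1)) • ξ)
      ((n : ℝ) • ContinuousLinearMap.snd ℝ ℝ (Spc d) +
        (-((n * ω) • ContinuousLinearMap.fst ℝ ℝ (Spc d))).smulRight ξ) q :=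
    (hasFDerivAt_snd.const_smul (n : ℝ)).add
      (((hasFDerivAt_fst (p := q)).const_smul (n * ω : ℝ)).neg.smul_const ξ)
  have h2 := (u.differentiable.differentiableAt.hasFDerivAt
    (x := (n : ℝ) • q.2 + (-(n * ω * q.1)) • ξ)).comp q h1
  change fderiv ℝ (fun q : ℝ × Spc d => u ((n : ℝ) • q.2 + (-(n * ω * q.1)) • ξ)) q (s, e) = _
  rw [show (fun q : ℝ × Spc d => u ((n : ℝ) • q.2 + (-(n * ω * q.1)) • ξ)) =
    (u : Spc d → ℝ) ∘ fun q : ℝ × Spc d => (n : ℝ) • q.2 + (-(n * ω * q.1)) • ξ from rfl, h2.fderiv]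
  change _ = fderiv ℝ (u : Spc d → ℝ) ((n : ℝ) • q.2 + (-(n * ω * q.1)) • ξ)
    ((n : ℝ) • e + (-(n * ω * s)) • ξ)
  simp

lemma DX_pull (n : ℕ) (ω : ℝ) (ξ : Spc d) (u : PE d) (e : Spc d) :
    PS.D ((0, e) : ℝ × Spc d) (pull n ω ξ u) = (n : ℝ) • pull n ω ξ (PS.D e u) := by
  rw [D_pull]
  simp [PS.D_smul_dir]

lemma Dt_pull (n : ℕ) (ω : ℝ) (ξ : Spc d) (u : PE d) :
    Dt d (pull n ω ξ u) = (-(n * ω)) • pull n ω ξ (PS.D ξ u) := by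
  rw [D_pull]
  simp only [smul_zero, zero_add, mul_one, PS.D_smul_dir, map_smul]

lemma jet_pull_le {n : ℕ} (hn : 1 ≤ n) (ω : ℝ) (ξ : Spc d) (k : ℕ) (u : PE d) (t : ℝ)
    (x : Spc d) : PS.jet (dirX d) k (pull n ω ξ u) (t, x) ≤
      (n : ℝ) ^ k * PS.jet (dirE d) k u ((n : ℝ) • x + (-(n * ω * t)) • ξ) := by
  have hn' : (1 : ℝ) ≤ n := by exact_mod_cast hn
  induction k generalizing u with
  | zero => simp [PS.jet_zero, pull_apply]
  | succ k ih =>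
    simp only [PS.jet_succ]
    rw [mul_add, Finset.mul_sum]
    refine add_le_add ?_ (Finset.sum_le_sum fun i _ => ?_)
    · rw [pull_apply]
      exact le_mul_of_one_le_left (abs_nonneg _) (one_le_pow₀ hn')
    · rw [dirX, DX_pull, PS.jet_smul, abs_of_nonneg (by positivity), pow_succ', mul_assoc]
      exact mul_le_mul_of_nonneg_left (ih _) (by positivity)

section Generic

variable {V : Type*} [NormedAddCommGroup V] [NormedSpace ℝ V] {ι : Type*} {per : ι → V}
  {e : Fin d → V} {ξ : Fin d → ℝ}

lemma PS.jet_smul_le {c : ℝ} (hc : |c| ≤ 1) (n : ℕ) (u : PS per) (x : V) :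
    PS.jet e n (c • u) x ≤ PS.jet e n u x := by
  rw [PS.jet_smul]
  exact mul_le_of_le_one_left (PS.jet_nonneg _ _ _) hc

lemma PS.jet_sum_le_card (n : ℕ) (u : Fin d → PS per) (x : V) {K : ℝ}
    (h : ∀ i, PS.jet e n (u i) x ≤ K) : PS.jet e n (∑ i, u i) x ≤ d * K := by
  refine (PS.jet_sum_le _ _ _ _).trans ?_
  refine (Finset.sum_le_sum fun i _ => h i).trans ?_
  simp

lemma PS.jet_dirD_le (hξ : ∀ i, |ξ i| ≤ 1) (n : ℕ) (u : PS per) (x : V) :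
    PS.jet e n (dirD (fun i => PS.D (e i)) ξ u) x ≤ d * PS.jet e (n + 1) u x := by
  rw [dirD_apply]
  exact PS.jet_sum_le_card _ _ _ fun i =>
    (PS.jet_smul_le (hξ i) _ _ _).trans (PS.jet_D_le _ _ _ _)

lemma PS.jet_lapl_le (n : ℕ) (u : PS per) (x : V) :
    PS.jet e n (lapl (fun i => PS.D (e i)) u) x ≤ d * PS.jet e (n + 2) u x :=
  PS.jet_sum_le_card _ _ _ fun _ =>
    (PS.jet_D_le _ _ _ _).trans (PS.jet_D_le _ _ _ _)

lemma PS.jet_wpert_le (hξ : ∀ i, |ξ i| ≤ 1) (n : ℕ) (u : PS per) (x : V) (i : Fin d) :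
    PS.jet e n (wpert ξ (fun i => PS.D (e i)) u i) x ≤ 2 * d * PS.jet e (n + 2) u x := by
  refine (PS.jet_sub_le _ _ _ _).trans ?_
  have h1 := (PS.jet_smul_le (e := e) (hξ i) n (lapl (fun i => PS.D (e i)) u) x).trans
    (PS.jet_lapl_le _ _ _)
  have h2 := (PS.jet_D_le (e := e) n (dirD (fun i => PS.D (e i)) ξ u) x i).trans
    (PS.jet_dirD_le hξ _ _ _)
  linarith

lemma PS.abs_sum_le_card (u : Fin d → ℝ) {K : ℝ} (h : ∀ i, |u i| ≤ K) : |∑ i, u i| ≤ d * K := by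
  refine (Finset.abs_sum_le_sum_abs _ _).trans ?_
  refine (Finset.sum_le_sum fun i _ => h i).trans ?_
  simp

/-- The perturbation is `a ξ (ΔF - ∂_ξ∂_ξF)` up to small terms. -/
lemma PS.abs_wpert_sub_le (hξ : ∀ i, |ξ i| ≤ 1) (a F χ : PS per) (x : V) {K : ℝ}
    (ha : PS.jet e 2 a x ≤ K) (i : Fin d) :
    |wpert ξ (fun i => PS.D (e i)) (a * F + χ) i x - ξ i * (a x *
        (lapl (fun i => PS.D (e i)) F - dirD (fun i => PS.D (e i)) ξ
          (dirD (fun i => PS.D (e i)) ξ F)) x)| ≤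
      K * (|dirD (fun i => PS.D (e i)) ξ (dirD (fun i => PS.D (e i)) ξ F) x| +
        |PS.D (e i) (dirD (fun i => PS.D (e i)) ξ F) x|)
      + 6 * d * K * PS.jet e 1 F x + 2 * d * PS.jet e 2 χ x := by
  set Y := dirD (fun i => PS.D (e i)) ξ with hY
  set L := lapl (fun i => PS.D (e i) : Fin d → Derivation ℝ (PS per) (PS per)) with hL
  set w := wpert ξ (fun i => PS.D (e i) : Fin d → Derivation ℝ (PS per) (PS per)) with hw
  have hd : (1 : ℝ) ≤ d := by
    have : 0 < d := i.pos
    exact_mod_cast this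
  have id1 : w (a * F + χ) i = ξ i • (a * (L F - Y (Y F))) + ξ i • (a * Y (Y F))
      - a * PS.D (e i) (Y F)
      + (ξ i • (2 * (∑ k, PS.D (e k) a * PS.D (e k) F) + F * L a)
      - (Y F * PS.D (e i) a + F * PS.D (e i) (Y a) + Y a * PS.D (e i) F)) + w χ i := by
    simp only [hw, wpert, lapl_add, hL, lapl_mul, map_add, ← hY, Derivation.leibniz, smul_eq_mul,
      smul_add, mul_sub, smul_sub]
    abel
  have id2 : w (a * F + χ) i x - ξ i * (a x * (L F - Y (Y F)) x) = ξ i * (a x * Y (Y F) x)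
      - a x * PS.D (e i) (Y F) x
      + (ξ i * (2 * (∑ k, PS.D (e k) a x * PS.D (e k) F x) + F x * L a x)
      - (Y F x * PS.D (e i) a x + F x * PS.D (e i) (Y a) x + Y a x * PS.D (e i) F x))
      + w χ i x := by
    rw [id1]
    simp only [PS.add_apply, PS.sub_apply, PS.mul_apply, PS.smul_apply, PS.sum_apply, two_mul]
    ring
  rw [id2]
  set J := PS.jet e 1 F x with hJ
  have hJ0 : 0 ≤ J := PS.jet_nonneg _ _ _
  have hK0 : 0 ≤ K := (PS.jet_nonneg _ _ _).trans ha
  have a0 : |a x| ≤ K := (PS.abs_le_jet _ _ _).trans ha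
  have a1 (k) : |PS.D (e k) a x| ≤ K :=
    ((PS.jet_D_le (e := e) 0 a x k).trans (PS.jet_mono (by norm_num) _ _)).trans ha
  have a2 : |L a x| ≤ d * K := (PS.jet_lapl_le (e := e) 0 a x).trans (by gcongr)
  have a3 : |Y a x| ≤ d * K := (PS.jet_dirD_le (e := e) hξ 0 a x).trans
    (by gcongr; exact (PS.jet_mono (by norm_num) _ _).trans ha)
  have a4 : |PS.D (e i) (Y a) x| ≤ d * K := ((PS.jet_D_le (e := e) 0 (Y a) x i).trans
    (PS.jet_dirD_le (e := e) hξ 1 a x)).trans (by gcongr)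
  have f0 : |F x| ≤ J := PS.abs_le_jet _ _ _
  have f1 (k) : |PS.D (e k) F x| ≤ J := PS.jet_D_le (e := e) 0 F x k
  have f2 : |Y F x| ≤ d * J := PS.jet_dirD_le (e := e) hξ 0 F x
  have hχ : |w χ i x| ≤ 2 * d * PS.jet e 2 χ x := PS.jet_wpert_le (e := e) hξ 0 χ x i
  have t1 : |ξ i * (a x * Y (Y F) x)| ≤ K * |Y (Y F) x| := by
    rw [abs_mul, abs_mul]
    calc _ ≤ 1 * (K * |Y (Y F) x|) := by gcongr; exact hξ i
      _ = _ := one_mul _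
  have t2 : |a x * PS.D (e i) (Y F) x| ≤ K * |PS.D (e i) (Y F) x| := by
    rw [abs_mul]; gcongr
  have s1 : |∑ k, PS.D (e k) a x * PS.D (e k) F x| ≤ d * (K * J) :=
    PS.abs_sum_le_card _ fun k => by rw [abs_mul]; exact mul_le_mul (a1 k) (f1 k) (abs_nonneg _) hK0
  have s2 : |F x * L a x| ≤ J * (d * K) := by
    rw [abs_mul]; gcongr
  have s3 : |Y F x * PS.D (e i) a x| ≤ d * J * K := by
    rw [abs_mul]; gcongr; exact a1 i
  have s4 : |F x * PS.D (e i) (Y a) x| ≤ J * (d * K) := by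
    rw [abs_mul]; gcongr
  have s5 : |Y a x * PS.D (e i) F x| ≤ d * K * J := by
    rw [abs_mul]; gcongr; exact f1 i
  have t3 : |ξ i * (2 * (∑ k, PS.D (e k) a x * PS.D (e k) F x) + F x * L a x)| ≤
      3 * (d * K * J) := by
    rw [abs_mul]
    refine (mul_le_of_le_one_left (abs_nonneg _) (hξ i)).trans ((abs_add_le _ _).trans ?_)
    rw [abs_mul, abs_two]; nlinarith
  have t4 : |Y F x * PS.D (e i) a x + F x * PS.D (e i) (Y a) x + Y a x * PS.D (e i) F x| ≤
      3 * (d * K * J) := by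
    refine (abs_add_le _ _).trans ?_
    have := abs_add_le (Y F x * PS.D (e i) a x) (F x * PS.D (e i) (Y a) x)
    linarith
  rw [mul_add]
  simp only [abs_le] at t1 t2 t3 t4 hχ ⊢
  constructor <;> linarith [t1.1, t1.2, t2.1, t2.2, t3.1, t3.2, t4.1, t4.2, hχ.1, hχ.2]

/-- Pointwise bound of the new stress. -/
lemma PS.abs_stressErr_le (hξ : ∀ i, |ξ i| ≤ 1) (v : Fin d → PS per) (A f g h φ ψ : PS per)
    (x : V) {K : ℝ} (hA : PS.jet e 2 A x ≤ K) (hv : ∀ i, |v i x| ≤ K) (i j : Fin d) :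
    |stressErr ξ (fun i => PS.D (e i)) v A f g h φ ψ i j x| ≤
      2 * PS.jet e 1 ψ x + (4 * d * K + 4 * d) * PS.jet e 3 φ x
      + |wpert ξ (fun i => PS.D (e i)) φ i x * wpert ξ (fun i => PS.D (e i)) φ j x
          - ξ i * ξ j * (A x * f x)|
      + K * |g x| + 13 * d * K * PS.jet e 1 h x := by
  have hd : (1 : ℝ) ≤ d := by
    have : 0 < d := i.pos
    exact_mod_cast this
  set w := wpert ξ (fun i => PS.D (e i) : Fin d → Derivation ℝ (PS per) (PS per)) with hw
  set Y := dirD (fun i => PS.D (e i)) ξ with hY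
  set L := lapl (fun i => PS.D (e i) : Fin d → Derivation ℝ (PS per) (PS per)) with hL
  have hK0 : 0 ≤ K := (PS.jet_nonneg _ _ _).trans hA
  have red {c : ℝ} (hc : |c| ≤ 1) {y B : ℝ} (hy : |y| ≤ B) : |c * y| ≤ B := by
    rw [abs_mul]; exact (mul_le_of_le_one_left (abs_nonneg _) hc).trans hy
  have hξξ : |ξ i * ξ j| ≤ 1 := by
    rw [abs_mul]; exact mul_le_one₀ (hξ i) (abs_nonneg _) (hξ j)
  have p1 (k l) : |ξ k * PS.D (e l) ψ x| ≤ PS.jet e 1 ψ x := red (hξ k) (PS.jet_D_le 0 ψ x l)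
  have w0 (k) : |w φ k x| ≤ 2 * d * PS.jet e 3 φ x :=
    (PS.jet_wpert_le (e := e) hξ 0 φ x k).trans (by gcongr; exact PS.jet_mono (by norm_num) _ _)
  have w1 (k l) : |PS.D (e l) (w φ k) x| ≤ 2 * d * PS.jet e 3 φ x :=
    (PS.jet_D_le (e := e) 0 (w φ k) x l).trans (PS.jet_wpert_le (e := e) hξ 1 φ x k)
  have vw (k l) : |v k x * w φ l x| ≤ K * (2 * d * PS.jet e 3 φ x) := by
    rw [abs_mul]; gcongr; exacts [hv k, w0 l]
  have wv (k l) : |w φ l x * v k x| ≤ K * (2 * d * PS.jet e 3 φ x) := by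
    rw [mul_comm]; exact vw k l
  have g1 : |ξ i * ξ j * (A x * g x)| ≤ K * |g x| := by
    refine red hξξ ?_
    rw [abs_mul]; gcongr; exact (PS.abs_le_jet _ _ _).trans hA
  set J := PS.jet e 1 h x with hJ
  have hJ0 : 0 ≤ J := PS.jet_nonneg _ _ _
  have hprod (u : PS per) {B : ℝ} (hB : PS.jet e 1 u x ≤ B) (k) :
      |PS.D (e k) (h * u) x| ≤ 3 * (J * B) :=
    (PS.jet_D_le (e := e) 0 (h * u) x k).trans ((PS.jet_mul_le (e := e) 1 h u x).trans
      (by rw [pow_one]; gcongr))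
  have b1 (k l) : |ξ k * PS.D (e l) (h * Y A) x| ≤ 3 * (J * (d * K)) :=
    red (hξ k) (hprod _ ((PS.jet_dirD_le (e := e) hξ 1 A x).trans (by gcongr)) l)
  have c1 : |∑ k, PS.D (e k) (h * PS.D (e k) A) x| ≤ d * (3 * (J * K)) :=
    PS.abs_sum_le_card _ fun k => hprod _ ((PS.jet_D_le (e := e) 1 A x k).trans hA) k
  have c2 : |h x * L A x| ≤ J * (d * K) := by
    rw [abs_mul]; gcongr
    · exact PS.abs_le_jet _ _ _
    · exact (PS.jet_lapl_le (e := e) 0 A x).trans (by gcongr)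
  have c3 : |ξ i * ξ j * (h x * L A x - 2 * ∑ k, PS.D (e k) (h * PS.D (e k) A) x)| ≤
      7 * (d * K * J) := by
    refine red hξξ ((abs_sub _ _).trans ?_)
    have c4 : |2 * ∑ k, PS.D (e k) (h * PS.D (e k) A) x| ≤ 2 * (d * (3 * (J * K))) := by
      rw [abs_mul, abs_two]; gcongr
    linarith
  have expand : stressErr ξ (fun i => PS.D (e i)) v A f g h φ ψ i j x =
      (ξ j * PS.D (e i) ψ x + ξ i * PS.D (e j) ψ x) + (v i x * w φ j x + w φ i x * v j x)
      - (PS.D (e i) (w φ j) x + PS.D (e j) (w φ i) x)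
      + (w φ i x * w φ j x - ξ i * ξ j * (A x * f x)) + ξ i * ξ j * (A x * g x)
      + (ξ j * PS.D (e i) (h * Y A) x + ξ i * PS.D (e j) (h * Y A) x)
      + ξ i * ξ j * (h x * L A x - 2 * ∑ k, PS.D (e k) (h * PS.D (e k) A) x) := by
    simp only [stressErr, two_mul, PS.add_apply, PS.sub_apply, PS.mul_apply, PS.smul_apply,
      PS.sum_apply, ← hY, ← hL, ← hw]
  rw [expand]
  have q := le_abs_self (w φ i x * w φ j x - ξ i * ξ j * (A x * f x))
  have q' := neg_abs_le (w φ i x * w φ j x - ξ i * ξ j * (A x * f x))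
  have h1 := abs_le.1 (p1 j i)
  have h2 := abs_le.1 (p1 i j)
  have h3 := abs_le.1 (vw i j)
  have h4 := abs_le.1 (wv j i)
  have h5 := abs_le.1 (w1 j i)
  have h6 := abs_le.1 (w1 i j)
  have h7 := abs_le.1 g1
  have h8 := abs_le.1 (b1 j i)
  have h9 := abs_le.1 (b1 i j)
  have h10 := abs_le.1 c3
  rw [abs_le]
  constructor <;> linarith

end Generic

end Pointwise

/-! ### One perturbation step -/

section Step

variable {d : ℕ}

/-- Concentrated profiles for perturbations in direction `ξ`. -/
def HasProfile (ξ : Spc d) (r : ℝ≥0∞) (ε C η : ℝ) : Prop :=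
  ∃ (ω : ℝ) (F H G g : PE d), 0 < ω ∧ G = lapl (DE d) F - PS.D ξ (PS.D ξ F) ∧
    G * G = 1 + lapl (DE d) H + g ∧ LB 1 g ε ∧ LB 1 (PS.jet (dirE d) 1 H) C ∧ LB 2 G C ∧
    LB r (fun x => PS.jet (dirE d) 3 F x + ω⁻¹ * PS.jet (dirE d) 3 H x) η ∧
    LB 2 (fun x => (∑ j, |PS.D (dirE d j) (PS.D ξ F) x|) + PS.jet (dirE d) 1 F x +
      ω⁻¹ * PS.jet (dirE d) 2 H x) η ∧
    LB 1 (fun x => ω * PS.jet (dirE d) 1 (PS.D ξ F) x) η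

lemma PS.spacePeriodic_jet (k : ℕ) (u : PE d) : SpacePeriodic (PS.jet (dirE d) k u) := by
  induction k generalizing u with
  | zero => intro x i; simp only [PS.jet_zero]; rw [u.spacePeriodic x i]
  | succ k ih =>
    intro x i
    simp only [PS.jet_succ]
    rw [u.spacePeriodic x i]
    congr 1
    exact Finset.sum_congr rfl fun j _ => ih _ x i

lemma LB.abs {p : ℝ≥0∞} {u : Spc d → ℝ} {c : ℝ} (h : LB p u c) : LB p (fun x => |u x|) c :=
  ⟨h.cont.abs, h.nonneg, (eLpNorm_norm u).trans_le h.le⟩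

lemma LB.const_mul' {p : ℝ≥0∞} {u : Spc d → ℝ} {c k : ℝ} (hk : 0 ≤ k) (h : LB p u c) :
    LB p (fun x => k * u x) (k * c) := by
  have := h.const_mul k
  rwa [abs_of_nonneg hk] at this

lemma abs_coord_le {ξ : Spc d} (hξ : ‖ξ‖ = 1) (i : Fin d) : |ξ i| ≤ 1 :=
  (PiLp.norm_apply_le ξ i).trans hξ.le

lemma sum_coord_sq {ξ : Spc d} (hξ : ‖ξ‖ = 1) : ∑ i, ξ i * ξ i = 1 := by
  have h := EuclideanSpace.real_norm_sq_eq ξ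
  rw [hξ] at h
  simp only [← sq]; linarith

lemma integral_slice_D (u : PX d) (t : ℝ) (i : Fin d) :
    ∫ x, PS.D (dirX d i) u (t, x) ∂(μT d) = 0 := by
  have := (slice t u).integral_D (dirE d i)
  rwa [D_slice] at this

lemma integrable_slice (u : PX d) (t : ℝ) : Integrable (fun x => u (t, x)) (μT d) :=
  (slice t u).integrable

/-- The quantitative form of one perturbation step at a given time. -/
lemma step_estimate {ξ : Spc d} (hξ : ‖ξ‖ = 1) {r : ℝ≥0∞} (hr : 1 ≤ r) (hr' : r ≠ ⊤)
    {ε C η ω : ℝ} {F H G g : PE d} (hω : 0 < ω)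
    (hG : G = lapl (DE d) F - PS.D ξ (PS.D ξ F)) (hGG : G * G = 1 + lapl (DE d) H + g)
    (hg : LB 1 g ε) (hH : LB 1 (PS.jet (dirE d) 1 H) C) (hG2 : LB 2 G C)
    (hr3 : LB r (fun x => PS.jet (dirE d) 3 F x + ω⁻¹ * PS.jet (dirE d) 3 H x) η)
    (h22 : LB 2 (fun x => (∑ j, |PS.D (dirE d j) (PS.D ξ F) x|) + PS.jet (dirE d) 1 F x +
      ω⁻¹ * PS.jet (dirE d) 2 H x) η)
    (h11 : LB 1 (fun x => ω * PS.jet (dirE d) 1 (PS.D ξ F) x) η)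
    {n : ℕ} (hn : 1 ≤ n) (v : Fin d → PX d) (a : PX d) {K : ℝ} (hK : 1 ≤ K) (t : ℝ)
    (ha : ∀ x, PS.jet (dirX d) 3 a (t, x) ≤ K) (haa : ∀ x, PS.jet (dirX d) 3 (a * a) (t, x) ≤ K)
    (hat : ∀ x, PS.jet (dirX d) 3 (Dt d a) (t, x) ≤ K)
    (haat : ∀ x, PS.jet (dirX d) 3 (Dt d (a * a)) (t, x) ≤ K)
    (hv : ∀ i x, |v i (t, x)| ≤ K)
    {P : PE d →ₐ[ℝ] PX d} (hP : P = pull n ω ξ) {b h φ ψ : PX d}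
    (hb : b = ((n : ℝ) ^ 2)⁻¹ • P F) (hh : h = ((n : ℝ) ^ 2)⁻¹ • P H)
    (hφ : φ = a * b + ω⁻¹ • (a * a * h))
    (hψ : ψ = Dt d a * b - ((n : ℝ)⁻¹ * ω) • (a * P (PS.D ξ F)) + ω⁻¹ • (Dt d (a * a) * h)) :
    (∀ i, LB r (fun x => wpert ξ (DX d) φ i (t, x)) (54 * d * K * n * η)) ∧
    (∀ i j, LB r (fun x => PS.D (dirX d j) (wpert ξ (DX d) φ i) (t, x)) (54 * d * K * n * η)) ∧
    (∀ i j, LB 1 (fun x => stressErr ξ (DX d) v (a * a) (P (G * G)) (P g) h φ ψ i j (t, x))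
      (6 * K * (η * LB.incl d 1 r + η) + (4 * d * K + 4 * d) * (27 * K * n) * (η * LB.incl d 1 r)
        + (2 * (K * C) * (26 * d * K * η) + (26 * d * K * η) ^ 2) + K * ε
        + 13 * d * K * C * (n : ℝ)⁻¹)) ∧
    |∫ x, ((∑ i, wpert ξ (DX d) φ i * wpert ξ (DX d) φ i) - a * a : PX d) (t, x) ∂(μT d)| ≤
      d * (2 * (K * C) * (26 * d * K * η) + (26 * d * K * η) ^ 2) + K * ε
        + d * K * C * (n : ℝ)⁻¹ := by
  obtain ⟨θ, hθ⟩ : ∃ θ : Spc d → Spc d, θ = fun x => (n : ℝ) • x + (-(n * ω * t)) • ξ := ⟨_, rfl⟩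
  have hn1 : (1 : ℝ) ≤ n := by exact_mod_cast hn
  have hn0 : (0 : ℝ) < n := by linarith
  have hK0 : 0 < K := by linarith
  have hωi : 0 < ω⁻¹ := by positivity
  have hr0 : r ≠ 0 := (zero_lt_one.trans_le hr).ne'
  have hξ1 (i : Fin d) : |ξ i| ≤ 1 := abs_coord_le hξ i
  have hPa (u : PE d) (x : Spc d) : P u (t, x) = u (θ x) := by rw [hP, hθ]; rfl
  have hdil {p : ℝ≥0∞} {u : Spc d → ℝ} {c : ℝ} (h : LB p u c) (hu : SpacePeriodic u) (hp : p ≠ 0)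
      (hp' : p ≠ ⊤) : LB p (fun x => u (θ x)) c := by
    rw [hθ]; exact h.comp_dilation hu hp hp' (by omega) _
  have hcs (u : PX d) : Continuous fun x : Spc d => u (t, x) :=
    u.continuous.comp (by fun_prop)
  have hcj (k : ℕ) (u : PX d) : Continuous fun x : Spc d => PS.jet (dirX d) k u (t, x) :=
    (PS.continuous_jet k u).comp (by fun_prop)
  have hsp (k : ℕ) (u : PE d) (x : Spc d) (i : Fin d) : PS.jet (dirE d) k u
      (x + (2 * Real.pi) • EuclideanSpace.single i 1) = PS.jet (dirE d) k u x :=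
    PS.spacePeriodic_jet k u x i
  have jP (k : ℕ) (u : PE d) (x : Spc d) :
      PS.jet (dirX d) k (P u) (t, x) ≤ (n : ℝ) ^ k * PS.jet (dirE d) k u (θ x) := by
    rw [hP, hθ]; exact jet_pull_le hn ω ξ k u t x
  have jS (k : ℕ) (u : PE d) (x : Spc d) : PS.jet (dirX d) k (((n : ℝ) ^ 2)⁻¹ • P u) (t, x) ≤
      ((n : ℝ) ^ 2)⁻¹ * ((n : ℝ) ^ k * PS.jet (dirE d) k u (θ x)) := by
    rw [PS.jet_smul, abs_of_pos (by positivity)]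
    exact mul_le_mul_of_nonneg_left (jP k u x) (by positivity)
  have j3 (u : PE d) (x : Spc d) : PS.jet (dirX d) 3 (((n : ℝ) ^ 2)⁻¹ • P u) (t, x) ≤
      n * PS.jet (dirE d) 3 u (θ x) := (jS 3 u x).trans_eq (by field_simp)
  have j2 (u : PE d) (x : Spc d) : PS.jet (dirX d) 2 (((n : ℝ) ^ 2)⁻¹ • P u) (t, x) ≤
      PS.jet (dirE d) 2 u (θ x) := (jS 2 u x).trans_eq (by field_simp)
  have j1' (u : PE d) (x : Spc d) : PS.jet (dirX d) 1 (((n : ℝ) ^ 2)⁻¹ • P u) (t, x) ≤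
      (n : ℝ)⁻¹ * PS.jet (dirE d) 1 u (θ x) := (jS 1 u x).trans_eq (by field_simp)
  have j1 (u : PE d) (x : Spc d) : PS.jet (dirX d) 1 (((n : ℝ) ^ 2)⁻¹ • P u) (t, x) ≤
      PS.jet (dirE d) 1 u (θ x) := (j1' u x).trans
        (mul_le_of_le_one_left (PS.jet_nonneg _ _ _) (inv_le_one_of_one_le₀ hn1))
  have hDX (k : Fin d) (u : PE d) : PS.D (dirX d k) (P u) = (n : ℝ) • P (PS.D (dirE d k) u) := by
    rw [hP]; exact DX_pull n ω ξ u (dirE d k)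
  have hDξ (u : PE d) : dirD (DX d) ξ (P u) = (n : ℝ) • P (PS.D ξ u) := by
    rw [dirD_DX, hP]; exact DX_pull n ω ξ u ξ
  have jmul (k : ℕ) {u w : PX d} {B : ℝ} (x : Spc d) (hu : PS.jet (dirX d) k u (t, x) ≤ K)
      (hw : PS.jet (dirX d) k w (t, x) ≤ B) : PS.jet (dirX d) k (u * w) (t, x) ≤
      3 ^ k * (K * B) :=
    (PS.jet_mul_le _ _ _ _).trans (by
      gcongr
      exact PS.jet_nonneg _ _ _)
  obtain ⟨Φ, hΦ⟩ : ∃ Φ, Φ = fun x => PS.jet (dirE d) 3 F x + ω⁻¹ * PS.jet (dirE d) 3 H x :=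
    ⟨_, rfl⟩
  rw [← hΦ] at hr3
  have hΦp : SpacePeriodic Φ := fun x i => by simp only [hΦ, hsp]
  have hΦr : LB r (fun x => Φ (θ x)) η := hdil hr3 hΦp hr0 hr'
  have hΦ1 : LB 1 (fun x => Φ (θ x)) (η * LB.incl d 1 r) := hΦr.of_le hr
  have jφ (x : Spc d) : PS.jet (dirX d) 3 φ (t, x) ≤ 27 * K * n * Φ (θ x) := by
    have h1 := jmul 3 x (ha x) (hb ▸ j3 F x)
    have h2 := jmul 3 x (haa x) (hh ▸ j3 H x)
    rw [hφ]
    refine (PS.jet_add_le _ _ _ _).trans ?_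
    rw [PS.jet_smul, abs_of_pos hωi, hΦ]
    have := mul_le_mul_of_nonneg_left h2 hωi.le
    linarith
  have jφ2 (x : Spc d) : PS.jet (dirX d) 2 φ (t, x) ≤ 27 * K * n * Φ (θ x) :=
    (PS.jet_mono (by norm_num) _ _).trans (jφ x)
  have w0 (i : Fin d) (x : Spc d) : |wpert ξ (DX d) φ i (t, x)| ≤
      54 * d * K * n * Φ (θ x) := by
    refine (PS.jet_wpert_le (e := dirX d) hξ1 0 φ (t, x) i).trans ?_
    have := mul_le_mul_of_nonneg_left (jφ2 x) (show (0 : ℝ) ≤ 2 * d by positivity)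
    linarith
  have w1 (i j : Fin d) (x : Spc d) : |PS.D (dirX d j) (wpert ξ (DX d) φ i) (t, x)| ≤
      54 * d * K * n * Φ (θ x) := by
    refine (PS.jet_D_le (e := dirX d) 0 (wpert ξ (DX d) φ i) (t, x) j).trans ?_
    refine (PS.jet_wpert_le (e := dirX d) hξ1 1 φ (t, x) i).trans ?_
    have := mul_le_mul_of_nonneg_left (jφ x) (show (0 : ℝ) ≤ 2 * d by positivity)
    linarith
  -- the principal part of the perturbation
  obtain ⟨W, hW⟩ : ∃ W : Spc d → ℝ, W = fun x => (∑ j, |PS.D (dirE d j) (PS.D ξ F) x|)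
    + PS.jet (dirE d) 1 F x + ω⁻¹ * PS.jet (dirE d) 2 H x := ⟨_, rfl⟩
  rw [← hW] at h22
  have hWp : SpacePeriodic W := fun x i => by
    simp only [hW, hsp, (PS.D (dirE d _) (PS.D ξ F)).spacePeriodic x i]
  have hW2 : LB 2 (fun x => W (θ x)) η := hdil h22 hWp (by simp) (by simp)
  have hYYb : dirD (DX d) ξ (dirD (DX d) ξ b) = P (PS.D ξ (PS.D ξ F)) := by
    rw [hb, Derivation.map_smul, hDξ, Derivation.map_smul, Derivation.map_smul, hDξ]
    simp only [smul_smul]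
    rw [show ((n : ℝ) ^ 2)⁻¹ * (n * n) = 1 by field_simp, one_smul]
  have hDYb (i : Fin d) : PS.D (dirX d i) (dirD (DX d) ξ b) = P (PS.D (dirE d i) (PS.D ξ F)) := by
    rw [hb, Derivation.map_smul, hDξ, Derivation.map_smul, Derivation.map_smul, hDX]
    simp only [smul_smul]
    rw [show ((n : ℝ) ^ 2)⁻¹ * (n * n) = 1 by field_simp, one_smul]
  have hlapP (u : PE d) : lapl (DX d) (((n : ℝ) ^ 2)⁻¹ • P u) = P (lapl (DE d) u) := by
    simp only [lapl, map_sum, Derivation.map_smul]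
    refine Finset.sum_congr rfl fun k _ => ?_
    rw [hDX, Derivation.map_smul, hDX]
    simp only [smul_smul]
    rw [show ((n : ℝ) ^ 2)⁻¹ * (n * n) = 1 by field_simp, one_smul]
  have hPG : lapl (DX d) b - dirD (DX d) ξ (dirD (DX d) ξ b) = P G := by
    rw [hYYb, hb, hlapP, hG, map_sub]
  obtain ⟨s, hs⟩ : ∃ s : Fin d → Spc d → ℝ, s = fun i x => ξ i * (a (t, x) * G (θ x)) := ⟨_, rfl⟩
  obtain ⟨ρ, hρ⟩ : ∃ ρ : Fin d → Spc d → ℝ, ρ = fun i x => wpert ξ (DX d) φ i (t, x) - s i x :=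
    ⟨_, rfl⟩
  have hθc : Continuous θ := by rw [hθ]; fun_prop
  have hsc (i : Fin d) : Continuous (s i) := by
    rw [hs]
    exact continuous_const.mul ((hcs a).mul (G.continuous.comp hθc))
  have hρc (i : Fin d) : Continuous (ρ i) := by
    have := (hcs (wpert ξ (DX d) φ i)).sub (hsc i)
    rwa [hρ]
  have hs2 (i : Fin d) : LB 2 (s i) (K * C) := by
    refine ((hdil hG2 G.spacePeriodic (by simp) (by simp)).abs.const_mul' hK0.le).mono (hsc i)
      fun x => ?_
    rw [hs]
    simp only [abs_mul]
    calc |ξ i| * (|a (t, x)| * |G (θ x)|) ≤ 1 * (K * |G (θ x)|) := by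
          gcongr
          exacts [hξ1 i, (PS.abs_le_jet _ _ _).trans (ha x)]
      _ = _ := one_mul _
  have hρ2 (i : Fin d) : LB 2 (ρ i) (26 * d * K * η) := by
    have hd : (1 : ℝ) ≤ d := by
      have : 0 < d := i.pos
      exact_mod_cast this
    refine (hW2.const_mul' (k := 26 * d * K) (by positivity)).mono (hρc i) fun x => ?_
    have h1 := PS.abs_wpert_sub_le (e := dirX d) hξ1 a b (ω⁻¹ • (a * a * h)) (t, x)
      ((PS.jet_mono (by norm_num) _ _).trans (ha x)) i
    rw [← hφ, hPG, hYYb, hDYb, hPa, hPa, hPa] at h1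
    have h2 : ρ i x = wpert ξ (DX d) φ i (t, x) - ξ i * (a (t, x) * G (θ x)) := by rw [hρ, hs]
    rw [h2]
    refine h1.trans ?_
    have h3 : |PS.D ξ (PS.D ξ F) (θ x)| ≤ ∑ j, |PS.D (dirE d j) (PS.D ξ F) (θ x)| := by
      rw [← dirD_DE ξ (PS.D ξ F), dirD_apply, PS.sum_apply]
      refine (Finset.abs_sum_le_sum_abs _ _).trans (Finset.sum_le_sum fun j _ => ?_)
      rw [PS.smul_apply, abs_mul]
      exact mul_le_of_le_one_left (abs_nonneg _) (hξ1 j)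
    have h4 := Finset.single_le_sum (f := fun j => |PS.D (dirE d j) (PS.D ξ F) (θ x)|)
      (fun j _ => abs_nonneg _) (Finset.mem_univ i)
    have h5 : PS.jet (dirX d) 1 b (t, x) ≤ PS.jet (dirE d) 1 F (θ x) := hb ▸ j1 F x
    have h6 := jmul 2 x ((PS.jet_mono (by norm_num) _ _).trans (haa x)) (hh ▸ j2 H x)
    have h7 : PS.jet (dirX d) 2 (ω⁻¹ • (a * a * h)) (t, x) ≤
        ω⁻¹ * (9 * (K * PS.jet (dirE d) 2 H (θ x))) := by
      rw [PS.jet_smul, abs_of_pos hωi]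
      exact mul_le_mul_of_nonneg_left (h6.trans_eq (by norm_num)) hωi.le
    have hdK : K ≤ d * K := le_mul_of_one_le_left hK0.le hd
    have e1 : K * (|PS.D ξ (PS.D ξ F) (θ x)| + |PS.D (dirE d i) (PS.D ξ F) (θ x)|) ≤
        d * K * (2 * ∑ j, |PS.D (dirE d j) (PS.D ξ F) (θ x)|) := by
      refine mul_le_mul hdK (by linarith) (by positivity) (by positivity)
    have e2 := mul_le_mul_of_nonneg_left h5 (show 0 ≤ 6 * d * K by positivity)
    have e3 := mul_le_mul_of_nonneg_left h7 (show (0 : ℝ) ≤ 2 * d by positivity)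
    have p1 : 0 ≤ d * K * ∑ j, |PS.D (dirE d j) (PS.D ξ F) (θ x)| := by positivity
    have p2 : 0 ≤ d * K * PS.jet (dirE d) 1 F (θ x) :=
      mul_nonneg (by positivity) (PS.jet_nonneg _ _ _)
    have p3 : 0 ≤ d * K * (ω⁻¹ * PS.jet (dirE d) 2 H (θ x)) :=
      mul_nonneg (by positivity) (mul_nonneg hωi.le (PS.jet_nonneg _ _ _))
    rw [hW]
    simp only
    linarith
  obtain ⟨B, hB⟩ : ∃ B, B = 26 * d * K * η := ⟨_, rfl⟩
  rw [← hB] at hρ2 ⊢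
  have hZ (i j : Fin d) : LB 1 (fun x => wpert ξ (DX d) φ i (t, x) * wpert ξ (DX d) φ j (t, x)
      - ξ i * ξ j * ((a * a) (t, x) * P (G * G) (t, x))) (2 * (K * C) * B + B ^ 2) := by
    have h := (((hs2 i).mul (hρ2 j)).add le_rfl ((hρ2 i).mul (hs2 j))).add le_rfl
      ((hρ2 i).mul (hρ2 j))
    convert h.weaken (le_of_eq ?_) using 1
    · funext x
      rw [hPa, PS.mul_apply, PS.mul_apply, hρ, hs]
      ring
    · ring
  have hcg : LB 1 (fun x => |P g (t, x)|) ε := by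
    simp only [hPa]
    exact (hdil hg g.spacePeriodic (by simp) (by simp)).abs
  have hch : LB 1 (fun x => PS.jet (dirX d) 1 h (t, x)) ((n : ℝ)⁻¹ * C) := by
    refine ((hdil hH (PS.spacePeriodic_jet 1 H) (by simp) (by simp)).const_mul'
      (k := (n : ℝ)⁻¹) (by positivity)).mono (hcj _ _) fun x => ?_
    rw [abs_of_nonneg (PS.jet_nonneg _ _ _)]
    exact hh ▸ j1' H x
  refine ⟨fun i => ?_, fun i j => ?_, fun i j => ?_, ?_⟩
  · exact (hΦr.const_mul' (k := 54 * d * K * n) (by positivity)).mono (hcs _) (w0 i)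
  · exact (hΦr.const_mul' (k := 54 * d * K * n) (by positivity)).mono (hcs _) (w1 i j)
  · have hψ1 : LB 1 (fun x => PS.jet (dirX d) 1 ψ (t, x))
        (3 * K * (η * LB.incl d 1 r + η)) := by
      have h11' := hdil h11 (fun x i => by simp only [hsp]) (by simp) (by simp)
      refine ((hΦ1.add le_rfl h11').const_mul' (k := 3 * K) (by positivity)).mono (hcj _ _)
        fun x => ?_
      rw [abs_of_nonneg (PS.jet_nonneg _ _ _), hΦ, hψ]
      have q1 := jmul 1 x ((PS.jet_mono (by norm_num) _ _).trans (hat x)) (hb ▸ j1 F x)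
      have q2 := jmul 1 x ((PS.jet_mono (by norm_num) _ _).trans (ha x)) (jP 1 (PS.D ξ F) x)
      have q3 := jmul 1 x ((PS.jet_mono (by norm_num) _ _).trans (haat x)) (hh ▸ j1 H x)
      have q4 := PS.jet_mono (e := dirE d) (show 1 ≤ 3 by norm_num) F (θ x)
      have q5 := PS.jet_mono (e := dirE d) (show 1 ≤ 3 by norm_num) H (θ x)
      refine (PS.jet_add_le _ _ _ _).trans
        ((add_le_add_left (PS.jet_sub_le _ _ _ _) _).trans ?_)
      rw [PS.jet_smul, PS.jet_smul, abs_of_pos hωi, abs_of_pos (by positivity)]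
      have q2' := mul_le_mul_of_nonneg_left q2 (show 0 ≤ (n : ℝ)⁻¹ * ω by positivity)
      have q3' := mul_le_mul_of_nonneg_left q3 hωi.le
      have q4' := mul_le_mul_of_nonneg_left q4 hK0.le
      have q5' := mul_le_mul_of_nonneg_left q5 (show 0 ≤ ω⁻¹ * K by positivity)
      have q6 : (n : ℝ)⁻¹ * ω * (3 ^ 1 * (K * ((n : ℝ) ^ 1 * PS.jet (dirE d) 1 (PS.D ξ F) (θ x))))
          = 3 * K * (ω * PS.jet (dirE d) 1 (PS.D ξ F) (θ x)) := by field_simp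
      linarith
    have hsum := ((((hψ1.const_mul' zero_le_two).add le_rfl (hΦ1.const_mul'
      (k := (4 * d * K + 4 * d) * (27 * K * n)) (by positivity))).add le_rfl (hZ i j).abs).add
      le_rfl (hcg.const_mul' hK0.le)).add le_rfl
      (hch.const_mul' (k := 13 * d * K) (by positivity))
    refine (hsum.mono (hcs _) fun x => ?_).weaken (le_of_eq (by ring))
    refine (PS.abs_stressErr_le (e := dirX d) hξ1 v (a * a) (P (G * G)) (P g) h φ ψ (t, x)
      ((PS.jet_mono (by norm_num) _ _).trans (haa x)) (fun k => hv k x) i j).trans ?_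
    have := mul_le_mul_of_nonneg_left (jφ x) (show 0 ≤ 4 * d * K + 4 * d by positivity)
    simp only
    linarith
  · have hf : P (G * G) = 1 + lapl (DX d) h + P g := by
      rw [hGG, map_add, map_add, map_one, hh, hlapP]
    have split : ((∑ i, wpert ξ (DX d) φ i * wpert ξ (DX d) φ i) - a * a : PX d) =
        (∑ i, (wpert ξ (DX d) φ i * wpert ξ (DX d) φ i - (ξ i * ξ i) • (a * a * P (G * G))))
        + a * a * P g + h * lapl (DX d) (a * a)
        + ∑ k, PS.D (dirX d k) (a * a * PS.D (dirX d k) h - h * PS.D (dirX d k) (a * a)) := by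
      rw [Finset.sum_sub_distrib, ← Finset.sum_smul, sum_coord_sq hξ, one_smul, hf]
      simp only [lapl, map_sub, Derivation.leibniz _ (a * a) (PS.D _ h),
        Derivation.leibniz _ h, smul_eq_mul, mul_add, mul_one, Finset.mul_sum,
        Finset.sum_sub_distrib, Finset.sum_add_distrib]
      have : ∑ k, PS.D (dirX d k) h * PS.D (dirX d k) (a * a) =
        ∑ k, PS.D (dirX d k) (a * a) * PS.D (dirX d k) h := by simp only [mul_comm]
      rw [this]
      ring
    have hi (u : PX d) : Integrable (fun x => u (t, x)) (μT d) := integrable_slice u t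
    have hI (u : Fin d → PX d) : ∫ x, (∑ i, u i : PX d) (t, x) ∂(μT d) =
        ∑ i, ∫ x, u i (t, x) ∂(μT d) := by
      simp only [PS.sum_apply]
      exact integral_finsetSum _ fun i _ => hi (u i)
    have hadd (u w : PX d) : ∫ x, (u + w) (t, x) ∂(μT d) =
        ∫ x, u (t, x) ∂(μT d) + ∫ x, w (t, x) ∂(μT d) := integral_add (hi u) (hi w)
    rw [split, hadd, hadd, hadd, hI, hI]
    simp only [integral_slice_D, Finset.sum_const_zero, add_zero]
    have i1 : |∑ i, ∫ x, (wpert ξ (DX d) φ i * wpert ξ (DX d) φ i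
        - (ξ i * ξ i) • (a * a * P (G * G)) : PX d) (t, x) ∂(μT d)| ≤
        d * (2 * (K * C) * B + B ^ 2) :=
      PS.abs_sum_le_card _ fun i => (hZ i i).abs_integral_le
    have i2 : |∫ x, (a * a * P g : PX d) (t, x) ∂(μT d)| ≤ K * ε :=
      ((hcg.const_mul' hK0.le).mono (hcs _) fun x => by
        rw [PS.mul_apply, abs_mul]
        gcongr
        exact (PS.abs_le_jet _ _ _).trans (haa x)).abs_integral_le
    have i3 : |∫ x, (h * lapl (DX d) (a * a) : PX d) (t, x) ∂(μT d)| ≤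
        d * K * ((n : ℝ)⁻¹ * C) :=
      ((hch.const_mul' (k := d * K) (by positivity)).mono (hcs _) fun x => by
        rw [PS.mul_apply, abs_mul, mul_comm]
        gcongr
        · exact (PS.jet_lapl_le (e := dirX d) 0 (a * a) (t, x)).trans
            (by gcongr; exact (PS.jet_mono (by norm_num) _ _).trans (haa x))
        · exact PS.abs_le_jet _ _ _).abs_integral_le
    refine (abs_add_three _ _ _).trans ?_
    linarith

/-- Adding one concentrated oscillating perturbation cancels a stress `a² ξ ⊗ ξ`. -/
lemma exists_step {ξ : Spc d} (hξ : ‖ξ‖ = 1) {r : ℝ≥0∞} (hr : 1 ≤ r) (hr' : r ≠ ⊤)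
    (hprof : ∀ ε > 0, ∃ C, ∀ η > 0, HasProfile ξ r ε C η)
    (v : Fin d → PX d) (a : PX d) (T : ℝ) {ε : ℝ} (hε : 0 < ε) :
    ∃ (w : Fin d → PX d) (q : PX d) (E : Fin d → Fin d → PX d),
      (∀ i j, E i j = E j i) ∧ (∑ i, PS.D (dirX d i) (w i) = 0) ∧
      (∀ i, Dt d (w i) + ∑ j, PS.D (dirX d j) (v i * w j + w i * v j + w i * w j)
        + PS.D (dirX d i) q = ∑ j, PS.D (dirX d j) (PS.D (dirX d j) (w i))
        + ∑ j, PS.D (dirX d j) (E i j + (ξ i * ξ j) • (a * a))) ∧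
      ∀ t ∈ Icc 0 T, (∀ i, LB r (fun x => w i (t, x)) ε) ∧
        (∀ i j, LB r (fun x => PS.D (dirX d j) (w i) (t, x)) ε) ∧
        (∀ i j, LB 1 (fun x => E i j (t, x)) ε) ∧
        |∫ x, ((∑ i, w i * w i) - a * a : PX d) (t, x) ∂(μT d)| ≤ ε := by
  choose K₁ hK₁ using fun u : PX d => exists_jet_bound 3 u T
  set K := max 1 (max (K₁ a) (max (K₁ (a * a)) (max (K₁ (Dt d a)) (max (K₁ (Dt d (a * a)))
    (∑ i, max 0 (K₁ (v i))))))) with hKdef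
  have hK : 1 ≤ K := le_max_left _ _
  have hK0 : 0 < K := by linarith
  obtain ⟨C, hC⟩ := hprof (ε / (8 * K)) (by positivity)
  have hC0 : 0 ≤ C := by
    obtain ⟨_, _, _, _, _, -, -, -, -, h, -⟩ := hC 1 one_pos
    exact h.nonneg
  obtain ⟨n, hn⟩ := exists_nat_gt (max 1 (13 * d * K * C / (ε / 8)))
  have hn1 : (1 : ℝ) < n := (le_max_left _ _).trans_lt hn
  have hn1' : 1 ≤ n := by exact_mod_cast hn1.le
  have hn0 : (0 : ℝ) < n := by linarith
  have hnC : 13 * d * K * C * (n : ℝ)⁻¹ ≤ ε / 8 := by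
    have := ((le_max_right _ _).trans_lt hn).le
    rw [div_le_iff₀ (by positivity)] at this
    rw [← div_eq_mul_inv, div_le_iff₀ hn0]; linarith
  have hnC' : d * K * C * (n : ℝ)⁻¹ ≤ ε / 8 := by
    have : 0 ≤ d * K * C * (n : ℝ)⁻¹ := by positivity
    linarith
  have hKε : K * (ε / (8 * K)) = ε / 8 := by field_simp
  set Q : ℝ → ℝ := fun η => 2 * (K * C) * (26 * d * K * η) + (26 * d * K * η) ^ 2 with hQ
  have hsmall {f : ℝ → ℝ} (hf : Continuous f) (h0 : f 0 < ε) : ∀ᶠ η in 𝓝[>] (0 : ℝ), f η < ε :=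
    ((hf.tendsto 0).eventually (gt_mem_nhds h0)).filter_mono nhdsWithin_le_nhds
  have e1 := hsmall (f := fun η => 54 * d * K * n * η) (by fun_prop) (by simpa using hε)
  have e2 := hsmall (f := fun η => 6 * K * (η * LB.incl d 1 r + η)
      + (4 * d * K + 4 * d) * (27 * K * n) * (η * LB.incl d 1 r) + Q η + K * (ε / (8 * K))
      + 13 * d * K * C * (n : ℝ)⁻¹) (by fun_prop) (by simp only [hQ]; norm_num; linarith)
  have e3 := hsmall (f := fun η => d * Q η + K * (ε / (8 * K)) + d * K * C * (n : ℝ)⁻¹)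
    (by fun_prop) (by simp only [hQ]; norm_num; linarith)
  obtain ⟨η, he1, he2, he3, hη⟩ := (e1.and (e2.and (e3.and self_mem_nhdsWithin))).exists
  obtain ⟨ω, F, H, G, g, hω, hG, hGG, hg, hH, hG2, hr3, h22, h11⟩ := hC η hη
  set P := pull n ω ξ with hP
  obtain ⟨b, hb⟩ : ∃ b, b = ((n : ℝ) ^ 2)⁻¹ • P F := ⟨_, rfl⟩
  obtain ⟨h, hh⟩ : ∃ h, h = ((n : ℝ) ^ 2)⁻¹ • P H := ⟨_, rfl⟩
  obtain ⟨φ, hφ⟩ : ∃ φ, φ = a * b + ω⁻¹ • (a * a * h) := ⟨_, rfl⟩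
  obtain ⟨ψ, hψ⟩ : ∃ ψ, ψ = Dt d a * b - ((n : ℝ)⁻¹ * ω) • (a * P (PS.D ξ F))
    + ω⁻¹ • (Dt d (a * a) * h) := ⟨_, rfl⟩
  have hcomm (i j : Fin d) (u : PX d) : PS.D (dirX d i) (PS.D (dirX d j) u) =
    PS.D (dirX d j) (PS.D (dirX d i) u) := PS.D_comm _ _ _
  have hlap : lapl (DX d) h = P (lapl (DE d) H) := by
    have hDX (k : Fin d) (u : PE d) : PS.D (dirX d k) (P u) = (n : ℝ) • P (PS.D (dirE d k) u) :=
      DX_pull n ω ξ u (dirE d k)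
    simp only [lapl, map_sum, hh, Derivation.map_smul]
    refine Finset.sum_congr rfl fun k _ => ?_
    rw [hDX, Derivation.map_smul, hDX]
    simp only [smul_smul]
    rw [show ((n : ℝ) ^ 2)⁻¹ * (n * n) = 1 by field_simp, one_smul]
  have hbt : Dt d b = (-((n : ℝ)⁻¹ * ω)) • P (PS.D ξ F) := by
    rw [hb, Derivation.map_smul, hP, Dt_pull, smul_smul]
    congr 1
    field_simp
  have hht : Dt d h = (-ω) • dirD (DX d) ξ h := by
    rw [dirD_DX, hh, Derivation.map_smul, Derivation.map_smul, hP, Dt_pull, DX_pull]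
    simp only [smul_smul]
    congr 1
    ring
  have hφt : Dt d φ = ψ - a * a * dirD (DX d) ξ h := by
    rw [hφ, hψ, map_add, Derivation.map_smul, Derivation.leibniz, Derivation.leibniz _ (a * a), hbt,
      hht]
    refine PS.ext fun q => ?_
    simp only [smul_eq_mul, PS.add_apply, PS.sub_apply, PS.mul_apply, PS.smul_apply]
    field_simp
    ring
  have hf : P (G * G) = 1 + lapl (DX d) h + P g := by
    rw [hGG, map_add, map_add, map_one, hlap]
  refine ⟨wpert ξ (DX d) φ, dirD (DX d) ξ (Dt d φ + ψ + h * dirD (DX d) ξ (a * a)),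
    stressErr ξ (DX d) v (a * a) (P (G * G)) (P g) h φ ψ, fun i j => ?_,
    div_wpert ξ hcomm φ, fun i => stress_identity ξ (Dt d) hcomm (fun i u => PS.D_comm _ _ _)
      v _ _ _ _ _ _ hf hφt i, fun t ht => ?_⟩
  · simp only [stressErr, mul_comm (ξ i) (ξ j)]
    ring
  · have hKv (i : Fin d) (x : Spc d) : |v i (t, x)| ≤ K := by
      refine (PS.abs_le_jet 3 (v i) (t, x)).trans ((hK₁ (v i) t ht x).trans ?_)
      refine (le_max_right 0 _).trans ((Finset.single_le_sum (f := fun i => max 0 (K₁ (v i)))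
        (fun i _ => le_max_left _ _) (Finset.mem_univ i)).trans ?_)
      simp [hKdef]
    obtain ⟨r1, r2, r3, r4⟩ := step_estimate hξ hr hr' hω hG hGG hg hH hG2 hr3 h22 h11 hn1' v a hK t
      (fun x => (hK₁ a t ht x).trans (by simp [hKdef]))
      (fun x => (hK₁ _ t ht x).trans (by simp [hKdef]))
      (fun x => (hK₁ _ t ht x).trans (by simp [hKdef]))
      (fun x => (hK₁ _ t ht x).trans (by simp [hKdef])) hKv hP hb hh hφ hψ
    exact ⟨fun i => (r1 i).weaken he1.le, fun i j => (r2 i j).weaken he1.le,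
      fun i j => (r3 i j).weaken he2.le, r4.trans he3.le⟩

end Step

/-! ### Weighted averages of translates -/

section Averages

open scoped ContDiff

variable {d : ℕ} {Ω : Type*} [MeasurableSpace Ω] {m : Measure Ω} {c : Ω → ℝ} {Z : Ω → Spc d}

lemma PS.exists_fderiv_le (u : PE d) : ∃ K, ∀ x, ‖fderiv ℝ (u : Spc d → ℝ) x‖ ≤ K := by
  choose K hK using fun i => (PS.D (dirE d i) u).exists_abs_le
  have hK0 (i) : 0 ≤ K i := (abs_nonneg _).trans (hK i 0)
  refine ⟨∑ i, K i, fun x => ContinuousLinearMap.opNorm_le_bound _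
    (Finset.sum_nonneg fun i _ => hK0 i) fun y => ?_⟩
  have h : fderiv ℝ (u : Spc d → ℝ) x y = ∑ i, y i * PS.D (dirE d i) u x := by
    conv_lhs => rw [← sum_dirE y]
    simp [PS.D_apply]
  rw [h, Finset.sum_mul]
  refine (norm_sum_le _ _).trans (Finset.sum_le_sum fun i _ => ?_)
  rw [norm_mul, mul_comm]
  exact mul_le_mul (hK i x) (PiLp.norm_apply_le y i) (norm_nonneg _) (hK0 i)

lemma integrable_mul_translate (hc : Integrable c m) (hZ : Measurable Z) (u : PE d) (x : Spc d) :
    Integrable (fun o => c o * u (x + Z o)) m := by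
  obtain ⟨K, hK⟩ := u.exists_abs_le
  refine hc.mul_bdd (c := K) ?_ (Eventually.of_forall fun o => hK _)
  exact (u.continuous.measurable.comp (hZ.const_add x)).aestronglyMeasurable

lemma hasFDerivAt_average (hc : Integrable c m) (hZ : Measurable Z) (u : PE d) (x : Spc d) :
    HasFDerivAt (fun x => ∫ o, c o * u (x + Z o) ∂m)
      (∫ o, c o • fderiv ℝ (u : Spc d → ℝ) (x + Z o) ∂m) x := by
  obtain ⟨K, hK⟩ := u.exists_fderiv_le
  have hm (x : Spc d) : Measurable fun o => x + Z o := hZ.const_add x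
  refine hasFDerivAt_integral_of_dominated_of_fderiv_le (s := univ) (bound := fun o => |c o| * K)
    (F' := fun x o => c o • fderiv ℝ (u : Spc d → ℝ) (x + Z o)) univ_mem
    (Eventually.of_forall fun x => (integrable_mul_translate hc hZ u x).aestronglyMeasurable)
    (integrable_mul_translate hc hZ u x) ?_ ?_ (hc.abs.mul_const K) ?_
  · have h1 : Continuous (fderiv ℝ (u : Spc d → ℝ)) := u.contDiff.continuous_fderiv (by simp)
    exact hc.aestronglyMeasurable.smul (h1.comp_aestronglyMeasurable (hm x).aestronglyMeasurable)
  · refine Eventually.of_forall fun o x _ => ?_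
    rw [norm_smul, Real.norm_eq_abs]
    gcongr
    exact hK _
  · refine Eventually.of_forall fun o x _ => ?_
    exact ((u.differentiable.differentiableAt.hasFDerivAt (x := x + Z o)).comp x
      ((hasFDerivAt_id x).add_const (Z o))).const_mul (c o)

lemma fderiv_average (hc : Integrable c m) (hZ : Measurable Z) (u : PE d) (e x : Spc d) :
    fderiv ℝ (fun x => ∫ o, c o * u (x + Z o) ∂m) x e = ∫ o, c o * PS.D e u (x + Z o) ∂m := by
  rw [(hasFDerivAt_average hc hZ u x).fderiv, ContinuousLinearMap.integral_apply]
  · rfl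
  · obtain ⟨K, hK⟩ := u.exists_fderiv_le
    refine hc.smul_bdd K ?_ (Eventually.of_forall fun o => hK _)
    have h1 : Continuous (fderiv ℝ (u : Spc d → ℝ)) := u.contDiff.continuous_fderiv (by simp)
    exact h1.comp_aestronglyMeasurable (hZ.const_add x).aestronglyMeasurable

lemma contDiff_average (hc : Integrable c m) (hZ : Measurable Z) (u : PE d) :
    ContDiff ℝ ∞ (fun x => ∫ o, c o * u (x + Z o) ∂m) := by
  rw [contDiff_infty]
  intro n
  induction n generalizing u with
  | zero =>
    exact contDiff_zero.2 (continuous_iff_continuousAt.2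
      fun x => (hasFDerivAt_average hc hZ u x).continuousAt)
  | succ n ih =>
    push_cast
    rw [contDiff_succ_iff_fderiv_apply]
    refine ⟨fun x => (hasFDerivAt_average hc hZ u x).differentiableAt, by simp, fun e => ?_⟩
    simp only [fderiv_average hc hZ u e]
    exact ih (PS.D e u)

/-- The weighted average `x ↦ ∫ c(o) u(x + Z(o))` of translates of `u`. -/
def PS.av (m : Measure Ω) (c : Ω → ℝ) (Z : Ω → Spc d) (hc : Integrable c m) (hZ : Measurable Z)
    (u : PE d) : PE d :=
  ⟨fun x => ∫ o, c o * u (x + Z o) ∂m, contDiff_average hc hZ u, fun x i => by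
    simp only [add_right_comm x (perE d i), u.periodic]⟩

lemma PS.av_apply (hc : Integrable c m) (hZ : Measurable Z) (u : PE d) (x : Spc d) :
    PS.av m c Z hc hZ u x = ∫ o, c o * u (x + Z o) ∂m := rfl

lemma PS.D_av (hc : Integrable c m) (hZ : Measurable Z) (u : PE d) (e : Spc d) :
    PS.D e (PS.av m c Z hc hZ u) = PS.av m c Z hc hZ (PS.D e u) :=
  PS.ext fun x => fderiv_average hc hZ u e x

lemma LB.av [SFinite m] {p : ℝ} (hp : 1 ≤ p) {u : PE d} {a : ℝ}
    (hu : LB (ENNReal.ofReal p) u a) (hc : Integrable c m) (hcm : Measurable c)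
    (hZ : Measurable Z) :
    LB (ENNReal.ofReal p) (PS.av m c Z hc hZ u) ((∫ o, |c o| ∂m) * a) := by
  have hp0 : 0 < p := by linarith
  refine ⟨(PS.av m c Z hc hZ u).continuous, mul_nonneg (by positivity) hu.nonneg, ?_⟩
  set ν := m.withDensity fun o => ‖c o‖ₑ with hν
  have hνu : ν univ = ENNReal.ofReal (∫ o, |c o| ∂m) := by
    rw [hν, withDensity_apply _ MeasurableSet.univ, Measure.restrict_univ,
      ofReal_integral_eq_lintegral_ofReal hc.abs (Eventually.of_forall fun o => abs_nonneg _)]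
    simp only [Real.enorm_eq_ofReal_abs]
  have hp1 : ENNReal.ofReal p ≠ 0 := by simpa using hp0
  have hpt : (ENNReal.ofReal p).toReal = p := ENNReal.toReal_ofReal hp0.le
  have hum : Measurable u := u.continuous.measurable
  set N := ν univ
  have h1 (x : Spc d) : ‖PS.av m c Z hc hZ u x‖ₑ ^ p ≤
      (∫⁻ o, ‖u (x + Z o)‖ₑ ^ p ∂ν) * N ^ (p - 1) := by
    have hmx : Measurable fun o => u (x + Z o) := hum.comp (hZ.const_add x)
    have h2 : ‖PS.av m c Z hc hZ u x‖ₑ ≤ eLpNorm (fun o => u (x + Z o)) 1 ν := by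
      rw [eLpNorm_one_eq_lintegral_enorm, hν,
        lintegral_withDensity_eq_lintegral_mul _ hcm.enorm hmx.enorm]
      refine (enorm_integral_le_lintegral_enorm _).trans_eq ?_
      simp only [enorm_mul, Pi.mul_apply]
    have h3 := h2.trans (eLpNorm_le_eLpNorm_mul_rpow_measure_univ (p := 1) (q := ENNReal.ofReal p)
      (by simpa using hp) hmx.aestronglyMeasurable)
    rw [eLpNorm_eq_lintegral_rpow_enorm_toReal hp1 ENNReal.ofReal_ne_top, hpt] at h3
    refine (ENNReal.rpow_le_rpow h3 hp0.le).trans_eq ?_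
    rw [ENNReal.mul_rpow_of_nonneg _ _ hp0.le, ← ENNReal.rpow_mul, ← ENNReal.rpow_mul]
    congr 2
    · rw [one_div, inv_mul_cancel₀ hp0.ne', ENNReal.rpow_one]
    · simp only [ENNReal.toReal_one]; field_simp
  have hmeas : Measurable fun q : Spc d × Ω => ‖u (q.1 + Z q.2)‖ₑ ^ p :=
    ((hum.comp (measurable_fst.add (hZ.comp measurable_snd))).enorm).pow_const p
  have h4 : ∫⁻ x, ‖PS.av m c Z hc hZ u x‖ₑ ^ p ∂(μT d) ≤
      (∫⁻ x, ‖u x‖ₑ ^ p ∂(μT d)) * N ^ p := by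
    refine (lintegral_mono h1).trans ?_
    rw [lintegral_mul_const _ hmeas.lintegral_prod_right', lintegral_lintegral_swap hmeas.aemeasurable]
    have h5 (o : Ω) : ∫⁻ x, ‖u (x + Z o)‖ₑ ^ p ∂(μT d) = ∫⁻ x, ‖u x‖ₑ ^ p ∂(μT d) :=
      lintegral_comp_add (f := fun x => ‖u x‖ₑ ^ p)
        (fun x i => by simp only [u.spacePeriodic x i]) (Z o)
    simp only [h5, lintegral_const]
    rw [mul_assoc]
    refine mul_le_mul' le_rfl (le_of_eq ?_)
    change N * N ^ (p - 1) = N ^ p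
    nth_rewrite 1 [← ENNReal.rpow_one N]
    rw [← ENNReal.rpow_add_of_nonneg _ _ zero_le_one (by linarith)]
    congr 1; ring
  rw [eLpNorm_eq_lintegral_rpow_enorm_toReal hp1 ENNReal.ofReal_ne_top, hpt]
  refine (ENNReal.rpow_le_rpow h4 (by positivity)).trans ?_
  rw [ENNReal.mul_rpow_of_nonneg _ _ (by positivity), ← ENNReal.rpow_mul, mul_one_div_cancel hp0.ne',
    ENNReal.rpow_one, mul_comm, ENNReal.ofReal_mul (by positivity), ← hνu]
  refine mul_le_mul' le_rfl ?_
  have := hu.le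
  rwa [eLpNorm_eq_lintegral_rpow_enorm_toReal hp1 ENNReal.ofReal_ne_top, hpt] at this

end Averages

/-! ### The Gaussian kernel -/

section Gaussian

variable {d : ℕ}

lemma integrable_exp_neg_mul_norm_sq {b : ℝ} (hb : 0 < b) :
    Integrable (fun y : Spc d => Real.exp (-b * ‖y‖ ^ 2)) := by
  have h := (GaussianFourier.integrable_cexp_neg_mul_sq_norm_add (V := Spc d) (b := (b : ℂ))
    (by simpa using hb) 0 0).norm
  refine h.congr (Eventually.of_forall fun y => ?_)
  simp only [zero_mul, add_zero, Complex.norm_exp]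
  norm_cast

/-- The standard Gaussian density. -/
def gs (d : ℕ) (y : Spc d) : ℝ :=
  (∫ z : Spc d, Real.exp (-(1 / 2) * ‖z‖ ^ 2))⁻¹ * Real.exp (-(1 / 2) * ‖y‖ ^ 2)

/-- The first derivatives of the Gaussian density. -/
def gs1 (i : Fin d) (y : Spc d) : ℝ := -(y i) * gs d y

/-- The second derivatives of the Gaussian density. -/
def gs2 (i j : Fin d) (y : Spc d) : ℝ := (y i * y j - dirE d j i) * gs d y

lemma integral_gs : ∫ y, gs d y = 1 := by
  unfold gs
  rw [integral_const_mul, inv_mul_cancel₀]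
  exact (integral_exp_pos (integrable_exp_neg_mul_norm_sq (by norm_num))).ne'

lemma gs_nonneg (y : Spc d) : 0 ≤ gs d y :=
  mul_nonneg (inv_nonneg.2 (integral_nonneg fun _ => (Real.exp_pos _).le)) (Real.exp_pos _).le

lemma continuous_gs : Continuous (gs d) := by unfold gs; fun_prop

lemma continuous_gs1 (i : Fin d) : Continuous (gs1 i) := by
  unfold gs1; exact (by fun_prop : Continuous fun y : Spc d => -(y i)).mul continuous_gs

lemma continuous_gs2 (i j : Fin d) : Continuous (gs2 i j) := by
  unfold gs2; exact (by fun_prop : Continuous fun y : Spc d => _).mul continuous_gs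

lemma hasFDerivAt_gs (y : Spc d) : HasFDerivAt (gs d) (-(gs d y • innerSL ℝ y)) y := by
  have h := ((((hasStrictFDerivAt_norm_sq y).hasFDerivAt.const_mul (-(1 / 2) : ℝ)).exp).const_mul
    (∫ z : Spc d, Real.exp (-(1 / 2) * ‖z‖ ^ 2))⁻¹)
  refine h.congr_fderiv ?_
  ext z
  simp [gs]
  ring

lemma fderiv_gs (i : Fin d) (y : Spc d) : fderiv ℝ (gs d) y (dirE d i) = gs1 i y := by
  rw [(hasFDerivAt_gs y).fderiv]
  simp [gs1, dirE, mul_comm, EuclideanSpace.inner_single_right]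

lemma differentiable_gs : Differentiable ℝ (gs d) := fun y => (hasFDerivAt_gs y).differentiableAt

lemma hasFDerivAt_gs1 (i : Fin d) (y : Spc d) : HasFDerivAt (gs1 i)
    ((-(y i)) • (-(gs d y • innerSL ℝ y)) + gs d y • (-(EuclideanSpace.proj i : Spc d →L[ℝ] ℝ))) y :=
  ((EuclideanSpace.proj i : Spc d →L[ℝ] ℝ).hasFDerivAt.neg).mul (hasFDerivAt_gs y)

lemma fderiv_gs1 (i j : Fin d) (y : Spc d) :
    fderiv ℝ (gs1 i) y (dirE d j) = gs2 i j y := by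
  rw [(hasFDerivAt_gs1 i y).fderiv]
  simp only [gs2, dirE, innerSL_apply_apply, add_apply, smul_apply,
    neg_apply, EuclideanSpace.inner_single_right, smul_eq_mul]
  by_cases h : i = j <;> simp [h] <;> ring

lemma integrable_of_le_gs {f : Spc d → ℝ} (hf : Continuous f) (C : ℝ)
    (h : ∀ y, |f y| ≤ C * ((1 + ‖y‖ ^ 2) * gs d y)) : Integrable f := by
  have h1 : Integrable fun y : Spc d => C * ((1 + ‖y‖ ^ 2) * gs d y) := by
    refine Integrable.const_mul ?_ C
    refine ((integrable_exp_neg_mul_norm_sq (d := d) (b := 3 / 8) (by norm_num)).const_mul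
      (8 * (∫ z : Spc d, Real.exp (-(1 / 2) * ‖z‖ ^ 2))⁻¹)).mono'
      (Continuous.aestronglyMeasurable (by have := continuous_gs (d := d); fun_prop))
      (Eventually.of_forall fun y => ?_)
    rw [Real.norm_of_nonneg (mul_nonneg (by positivity) (gs_nonneg y))]
    have h2 : 1 + ‖y‖ ^ 2 ≤ 8 * Real.exp (1 / 8 * ‖y‖ ^ 2) := by
      nlinarith [Real.add_one_le_exp (1 / 8 * ‖y‖ ^ 2), sq_nonneg ‖y‖]
    have h3 : gs d y * Real.exp (1 / 8 * ‖y‖ ^ 2) =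
        (∫ z : Spc d, Real.exp (-(1 / 2) * ‖z‖ ^ 2))⁻¹ * Real.exp (-(3 / 8) * ‖y‖ ^ 2) := by
      rw [gs, mul_assoc, ← Real.exp_add]; ring_nf
    calc _ ≤ (8 * Real.exp (1 / 8 * ‖y‖ ^ 2)) * gs d y :=
          mul_le_mul_of_nonneg_right h2 (gs_nonneg y)
      _ = 8 * (gs d y * Real.exp (1 / 8 * ‖y‖ ^ 2)) := by ring
      _ = _ := by rw [h3]; ring
  exact h1.mono' hf.aestronglyMeasurable (Eventually.of_forall h)

lemma integrable_gs : Integrable (gs d) := integrable_of_le_gs continuous_gs 1 fun y => by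
  rw [abs_of_nonneg (gs_nonneg y)]; nlinarith [gs_nonneg y, sq_nonneg ‖y‖, mul_nonneg (sq_nonneg ‖y‖) (gs_nonneg y)]

lemma integrable_gs1 (i : Fin d) : Integrable (gs1 i) :=
  integrable_of_le_gs (continuous_gs1 i) 1 fun y => by
    rw [gs1, abs_mul, abs_neg, abs_of_nonneg (gs_nonneg y), one_mul]
    have h := PiLp.norm_apply_le y i
    rw [Real.norm_eq_abs] at h
    exact mul_le_mul_of_nonneg_right (by nlinarith [sq_nonneg (‖y‖ - 1)]) (gs_nonneg y)

lemma integrable_norm_gs : Integrable fun y : Spc d => ‖y‖ * gs d y :=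
  integrable_of_le_gs (continuous_norm.mul continuous_gs) 1 fun y => by
    rw [abs_mul, abs_norm, abs_of_nonneg (gs_nonneg y), one_mul]
    exact mul_le_mul_of_nonneg_right (by nlinarith [sq_nonneg (‖y‖ - 1)]) (gs_nonneg y)

lemma integrable_gs2 (i j : Fin d) : Integrable (gs2 i j) :=
  integrable_of_le_gs (continuous_gs2 i j) 1 fun y => by
    rw [gs2, abs_mul, abs_of_nonneg (gs_nonneg y), one_mul]
    refine mul_le_mul_of_nonneg_right ?_ (gs_nonneg y)
    have hi := PiLp.norm_apply_le y i
    have hj := PiLp.norm_apply_le y j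
    have hij := PiLp.norm_apply_le (dirE d j) i
    rw [dirE, PiLp.norm_single, norm_one, ← dirE] at hij
    rw [Real.norm_eq_abs] at hi hj hij
    refine (abs_sub _ _).trans ?_
    rw [abs_mul]
    nlinarith [mul_le_mul hi hj (abs_nonneg _) (norm_nonneg _)]

end Gaussian

/-! ### An approximate inverse of the Laplacian -/

section InverseLaplacian

variable {d : ℕ} {a b : ℝ} {φ φ' : ℝ → ℝ} {ψ ψ' : Spc d → ℝ}

lemma measurable_dil : Measurable fun o : ℝ × Spc d => o.1 • o.2 := by fun_prop

/-- `x ↦ ∫_a^b φ(s) ∫ ψ(y) u(x + s y) dy ds`. -/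
def pav (a b : ℝ) (hφ : IntegrableOn φ (Ioc a b)) (hψ : Integrable ψ) (u : PE d) : PE d :=
  PS.av ((volume.restrict (Ioc a b)).prod volume) (fun o => φ o.1 * ψ o.2) (fun o => o.1 • o.2)
    (hφ.mul_prod hψ) measurable_dil u

lemma pav_apply (hφ : IntegrableOn φ (Ioc a b)) (hψ : Integrable ψ) (u : PE d) (x : Spc d) :
    pav a b hφ hψ u x = ∫ s in Ioc a b, φ s * ∫ y, ψ y * u (x + s • y) := by
  rw [pav, PS.av_apply, integral_prod _
    (integrable_mul_translate (hφ.mul_prod hψ) measurable_dil u x)]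
  simp only [mul_assoc, integral_const_mul]

lemma D_pav (hφ : IntegrableOn φ (Ioc a b)) (hψ : Integrable ψ) (u : PE d) (e : Spc d) :
    PS.D e (pav a b hφ hψ u) = pav a b hφ hψ (PS.D e u) := PS.D_av _ _ u e

lemma integral_translate_ibp (hψ : Integrable ψ) (hψ' : Integrable ψ') (hd : Differentiable ℝ ψ)
    {e : Spc d} (he : ∀ y, fderiv ℝ ψ y e = ψ' y) (u : PE d) (x : Spc d) (s : ℝ) :
    s * ∫ y, ψ y * PS.D e u (x + s • y) = -∫ y, ψ' y * u (x + s • y) := by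
  have hZ : Measurable fun y : Spc d => s • y := by fun_prop
  have hg (y : Spc d) : HasFDerivAt (fun y : Spc d => u (x + s • y))
      (s • fderiv ℝ (u : Spc d → ℝ) (x + s • y)) y := by
    have h1 : HasFDerivAt (fun y : Spc d => x + s • y) (s • ContinuousLinearMap.id ℝ (Spc d)) y :=
      ((hasFDerivAt_id y).const_smul s).const_add x
    refine ((u.differentiable (x + s • y)).hasFDerivAt.comp y h1).congr_fderiv ?_
    ext; simp
  have hg' (y : Spc d) : fderiv ℝ (fun y : Spc d => u (x + s • y)) y e
      = s * PS.D e u (x + s • y) := by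
    rw [(hg y).fderiv]; rfl
  have h1 := integrable_mul_translate hψ hZ u x
  have h2 := (integrable_mul_translate hψ hZ (PS.D e u) x).const_mul s
  have h3 := integrable_mul_translate hψ' hZ u x
  have := integral_mul_fderiv_eq_neg_fderiv_mul_of_integrable (μ := (volume : Measure (Spc d)))
    (f := ψ) (g := fun y => u (x + s • y)) (v := e) (by simpa only [he] using h3)
    (by simpa only [hg', mul_left_comm] using h2) h1 (fun y _ => hd y)
    (fun y _ => (hg y).differentiableAt)
  simp only [hg', he, mul_left_comm _ s, integral_const_mul] at this
  exact this

lemma pav_ibp (hφ : IntegrableOn φ (Ioc a b)) (hφ' : IntegrableOn φ' (Ioc a b))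
    (h : ∀ s ∈ Ioc a b, φ' s = s * φ s) (hψ : Integrable ψ) (hψ' : Integrable ψ')
    (hd : Differentiable ℝ ψ) {e : Spc d} (he : ∀ y, fderiv ℝ ψ y e = ψ' y) (u : PE d) :
    pav a b hφ' hψ (PS.D e u) = -pav a b hφ hψ' u := PS.ext fun x => by
  change _ = -(pav a b hφ hψ' u x)
  rw [pav_apply, pav_apply, ← integral_neg]
  refine setIntegral_congr_fun measurableSet_Ioc fun s hs => ?_
  rw [h s hs, mul_comm s, mul_assoc, integral_translate_ibp hψ hψ' hd he]
  ring

lemma LB.pav {p : ℝ} (hp : 1 ≤ p) {u : PE d} {A : ℝ} (hu : LB (ENNReal.ofReal p) u A)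
    (hφ : IntegrableOn φ (Ioc a b)) (hψ : Integrable ψ) (hφm : Measurable φ) (hψm : Measurable ψ) :
    LB (ENNReal.ofReal p) (pav a b hφ hψ u)
      ((∫ s in Ioc a b, |φ s|) * (∫ y, |ψ y|) * A) := by
  have h := hu.av hp (hφ.mul_prod hψ)
    ((hφm.comp measurable_fst).mul (hψm.comp measurable_snd)) measurable_dil
  refine h.weaken (le_of_eq ?_)
  simp only [abs_mul]
  rw [integral_prod_mul (fun s => |φ s|) (fun y => |ψ y|)]

lemma pav_split {c : ℝ} (hab : a ≤ b) (hbc : b ≤ c) (hac : IntegrableOn φ (Ioc a c))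
    (h1 : IntegrableOn φ (Ioc a b)) (h2 : IntegrableOn φ (Ioc b c)) (hψ : Integrable ψ)
    (u : PE d) : pav a c hac hψ u = pav a b h1 hψ u + pav b c h2 hψ u := PS.ext fun x => by
  change _ = pav a b h1 hψ u x + pav b c h2 hψ u x
  simp only [pav, PS.av_apply]
  rw [← integral_add_measure (integrable_mul_translate (h1.mul_prod hψ) measurable_dil u x)
    (integrable_mul_translate (h2.mul_prod hψ) measurable_dil u x), ← Measure.add_prod,
    ← Measure.restrict_union (Ioc_disjoint_Ioc_of_le le_rfl) measurableSet_Ioc,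
    Ioc_union_Ioc_eq_Ioc hab hbc]

lemma integrableOn_id_Ioc (a b : ℝ) : IntegrableOn (fun s : ℝ => s) (Ioc a b) :=
  (continuous_id.integrableOn_Icc (a := a) (b := b)).mono_set Ioc_subset_Icc_self

lemma integrableOn_one_Ioc (a b : ℝ) : IntegrableOn (fun _ : ℝ => (1 : ℝ)) (Ioc a b) :=
  (continuous_const.integrableOn_Icc (a := a) (b := b)).mono_set Ioc_subset_Icc_self

/-- The truncated heat potential, an approximate inverse of `-Δ`. -/
def pot (S : ℝ) (u : PE d) : PE d := pav 0 S (integrableOn_id_Ioc 0 S) integrable_gs u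

/-- Gaussian average at scale `S`. -/
def gav (S : ℝ) (u : PE d) : PE d :=
  PS.av volume (gs d) (fun y => S • y) integrable_gs (by fun_prop) u

lemma gav_apply (S : ℝ) (u : PE d) (x : Spc d) : gav S u x = ∫ y, gs d y * u (x + S • y) := rfl

lemma hasDerivAt_gav (u : PE d) (x : Spc d) (s : ℝ) :
    HasDerivAt (fun s => gav s u x) (s * gav s (lapl (DE d) u) x) s := by
  obtain ⟨K, hK⟩ := u.exists_fderiv_le
  have hg (s : ℝ) (y : Spc d) : HasDerivAt (fun s : ℝ => gs d y * u (x + s • y))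
      (gs d y * fderiv ℝ (u : Spc d → ℝ) (x + s • y) y) s := by
    refine HasDerivAt.const_mul (gs d y) ?_
    have h1 : HasDerivAt (fun s : ℝ => x + s • y) ((1 : ℝ) • y) s :=
      ((hasDerivAt_id s).smul_const y).const_add x
    have h2 := (u.differentiable (x + s • y)).hasFDerivAt.comp_hasDerivAt s h1
    rw [one_smul] at h2
    exact h2
  have hZ (s : ℝ) : Measurable fun y : Spc d => s • y := by fun_prop
  have hc : Continuous (fderiv ℝ (u : Spc d → ℝ)) := u.contDiff.continuous_fderiv (by simp)
  have h := (hasDerivAt_integral_of_dominated_loc_of_deriv_le (μ := (volume : Measure (Spc d)))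
    (x₀ := s) (s := univ) (bound := fun y => (‖y‖ * gs d y) * K)
    (F := fun s y => gs d y * u (x + s • y))
    (F' := fun s y => gs d y * fderiv ℝ (u : Spc d → ℝ) (x + s • y) y) univ_mem
    (Eventually.of_forall fun s =>
      (integrable_mul_translate integrable_gs (hZ s) u x).aestronglyMeasurable)
    (integrable_mul_translate integrable_gs (hZ s) u x)
    (Continuous.aestronglyMeasurable (continuous_gs.mul
      ((hc.comp (by fun_prop)).clm_apply continuous_id)))
    (Eventually.of_forall fun y s _ => by
      rw [Real.norm_eq_abs, abs_mul, abs_of_nonneg (gs_nonneg y)]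
      calc _ ≤ gs d y * (K * ‖y‖) := mul_le_mul_of_nonneg_left
            ((ContinuousLinearMap.le_opNorm _ _).trans
              (mul_le_mul_of_nonneg_right (hK _) (norm_nonneg _))) (gs_nonneg y)
        _ = _ := by ring)
    (integrable_norm_gs.mul_const K) (Eventually.of_forall fun y s _ => hg s y)).2
  refine h.congr_deriv ?_
  have h2 (i : Fin d) := integral_translate_ibp integrable_gs (integrable_gs1 i) differentiable_gs
    (fderiv_gs i) (PS.D (dirE d i) u) x s
  have h3 : gav s (lapl (DE d) u) x
      = ∑ i, ∫ y, gs d y * PS.D (dirE d i) (PS.D (dirE d i) u) (x + s • y) := by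
    rw [gav_apply, ← integral_finsetSum _ fun i _ =>
      integrable_mul_translate integrable_gs (hZ s) _ x]
    simp only [lapl, PS.sum_apply, Finset.mul_sum]
  rw [h3, Finset.mul_sum]
  simp only [h2]
  rw [Finset.sum_neg_distrib, ← integral_finsetSum _ fun i _ =>
    integrable_mul_translate (integrable_gs1 i) (hZ s) _ x, ← integral_neg]
  refine integral_congr_ae (Eventually.of_forall fun y => ?_)
  have h4 : fderiv ℝ (u : Spc d → ℝ) (x + s • y) y
      = ∑ i, y i * PS.D (dirE d i) u (x + s • y) := by
    conv_lhs => arg 2; rw [← sum_dirE y]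
    simp [PS.D_apply]
  simp only [h4, Finset.mul_sum, gs1]
  rw [← Finset.sum_neg_distrib]
  exact Finset.sum_congr rfl fun i _ => by ring

lemma lapl_pot {S : ℝ} (hS : 0 ≤ S) (u : PE d) : lapl (DE d) (pot S u) = gav S u - u := by
  have h1 : lapl (DE d) (pot S u) = pot S (lapl (DE d) u) := by
    simp only [lapl, pot, D_pav]
    refine PS.ext fun x => ?_
    simp only [PS.sum_apply, pav, PS.av_apply, Finset.mul_sum]
    rw [integral_finsetSum _ fun i _ => integrable_mul_translate
      ((integrableOn_id_Ioc 0 S).mul_prod integrable_gs) measurable_dil _ x]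
  rw [h1]
  refine PS.ext fun x => ?_
  rw [pot, pav_apply, ← intervalIntegral.integral_of_le hS]
  have hd : ∀ s ∈ uIcc 0 S, HasDerivAt (fun s => gav s u x) (s * gav s (lapl (DE d) u) x) s :=
    fun s _ => hasDerivAt_gav u x s
  have hc : Continuous fun s => gav s (lapl (DE d) u) x :=
    continuous_iff_continuousAt.2 fun s => (hasDerivAt_gav _ x s).continuousAt
  have := intervalIntegral.integral_eq_sub_of_hasDerivAt hd
    ((continuous_id.mul hc).intervalIntegrable 0 S)
  simp only [gav_apply] at this
  rw [this]
  change _ = gav S u x - u x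
  rw [gav_apply]
  simp [integral_mul_const, integral_gs]

end InverseLaplacian

section PotentialBounds

variable {d : ℕ}

lemma LB.neg_iff {p : ℝ≥0∞} {u : PE d} {A : ℝ} (h : LB p u A) : LB p (-u : PE d) A :=
  h.abs.mono (-u : PE d).continuous fun x => (abs_neg (u x)).le

lemma integral_abs_gs : ∫ y, |gs d y| = 1 := by
  simp only [abs_of_nonneg (gs_nonneg _), integral_gs]

lemma setIntegral_abs_id_le {a : ℝ} (ha : 0 ≤ a) : ∫ s in Ioc 0 a, |s| ≤ a ^ 2 := by
  rw [setIntegral_congr_fun (g := fun s => s) measurableSet_Ioc fun s hs => abs_of_pos hs.1,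
    ← intervalIntegral.integral_of_le ha, integral_id]
  nlinarith

lemma setIntegral_abs_inv {a b : ℝ} (ha : 0 < a) (hab : a ≤ b) :
    ∫ s in Ioc a b, |s⁻¹| = Real.log (b / a) := by
  rw [setIntegral_congr_fun (g := fun s => s⁻¹) measurableSet_Ioc
    fun s hs => abs_of_pos (inv_pos.2 (ha.trans hs.1)), ← intervalIntegral.integral_of_le hab,
    integral_inv_of_pos ha (ha.trans_le hab)]

lemma integrableOn_inv_Ioc {a b : ℝ} (ha : 0 < a) :
    IntegrableOn (fun s : ℝ => s⁻¹) (Ioc a b) := by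
  refine (ContinuousOn.integrableOn_Icc ?_).mono_set Ioc_subset_Icc_self
  exact continuousOn_inv₀.mono fun s hs => (ha.trans_le hs.1).ne'

lemma D_pot (S : ℝ) (u : PE d) (e : Spc d) : PS.D e (pot S u) = pot S (PS.D e u) := D_pav _ _ u e

lemma pot_D (S : ℝ) (u : PE d) (i : Fin d) : pot S (PS.D (dirE d i) u)
    = -pav 0 S (integrableOn_one_Ioc 0 S) (integrable_gs1 i) u :=
  pav_ibp _ _ (fun s _ => (mul_one s).symm) _ _ differentiable_gs (fderiv_gs i) u

lemma differentiable_gs1 (i : Fin d) : Differentiable ℝ (gs1 i) :=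
  fun y => (hasFDerivAt_gs1 i y).differentiableAt

lemma pot_D_D {S ℓ : ℝ} (hℓ : 0 < ℓ) (hS : ℓ ≤ S) (u : PE d) (i j : Fin d) :
    pot S (PS.D (dirE d j) (PS.D (dirE d i) u))
    = pav 0 ℓ (integrableOn_id_Ioc 0 ℓ) integrable_gs (PS.D (dirE d j) (PS.D (dirE d i) u))
      + pav ℓ S (integrableOn_inv_Ioc hℓ) (integrable_gs2 j i) u := by
  rw [pot, pav_split hℓ.le hS _ (integrableOn_id_Ioc 0 ℓ) (integrableOn_id_Ioc ℓ S)]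
  congr 1
  rw [pav_ibp (integrableOn_one_Ioc ℓ S) _ (fun s _ => (mul_one s).symm) _ (integrable_gs1 j)
    differentiable_gs (fderiv_gs j), pav_ibp (integrableOn_inv_Ioc hℓ) _
    (fun s hs => (mul_inv_cancel₀ (hℓ.trans hs.1).ne').symm) _ (integrable_gs2 j i)
    (differentiable_gs1 j) (fderiv_gs1 j i), neg_neg]

lemma exists_jet_one_pot (d : ℕ) (S : ℝ) : ∃ K, 0 ≤ K ∧ ∀ (p : ℝ), 1 ≤ p → ∀ (u : PE d) (A : ℝ),
    LB (ENNReal.ofReal p) u A → LB (ENNReal.ofReal p) (PS.jet (dirE d) 1 (pot S u)) (K * A) := by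
  refine ⟨(∫ s in Ioc 0 S, |s|) * (∫ y, |gs d y|)
    + ∑ i : Fin d, (∫ s in Ioc 0 S, |(1 : ℝ)|) * ∫ y, |gs1 i y|, by positivity,
    fun p hp u A hu => ?_⟩
  have hp' : 1 ≤ ENNReal.ofReal p := by simpa using hp
  have h0 := hu.pav hp (integrableOn_id_Ioc 0 S) integrable_gs measurable_id
    continuous_gs.measurable
  have h1 (i : Fin d) := hu.pav hp (integrableOn_one_Ioc 0 S) (integrable_gs1 i)
    measurable_const (continuous_gs1 i).measurable
  have h2 (i : Fin d) : LB (ENNReal.ofReal p) (fun x => |PS.D (dirE d i) (pot S u) x|)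
      ((∫ s in Ioc 0 S, |(1 : ℝ)|) * (∫ y, |gs1 i y|) * A) := by
    rw [D_pot, pot_D]; exact (h1 i).neg_iff.abs
  have := h0.abs.add hp' (LB.sum hp' Finset.univ fun i _ => h2 i)
  rw [← Finset.sum_mul, ← add_mul] at this
  exact this

lemma exists_jet_two_pot (d : ℕ) {S : ℝ} (hS : 1 ≤ S) : ∃ K, 0 ≤ K ∧ ∀ (p : ℝ), 1 ≤ p →
    ∀ (u : PE d) (A₀ A₂ ℓ : ℝ), 0 < ℓ → ℓ ≤ 1 → LB (ENNReal.ofReal p) u A₀ →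
    LB (ENNReal.ofReal p) (PS.jet (dirE d) 2 u) A₂ →
    LB (ENNReal.ofReal p) (PS.jet (dirE d) 2 (pot S u))
      (K * (ℓ ^ 2 * A₂ + (1 + Real.log ℓ⁻¹) * A₀)) := by
  obtain ⟨K, hK, h⟩ := exists_jet_one_pot d S
  have hL : 0 ≤ Real.log S := Real.log_nonneg hS
  set K' := K + d * d + ∑ i : Fin d, ∑ j : Fin d, (1 + Real.log S) * ∫ y, |gs2 j i y| with hK'
  have hsum : 0 ≤ ∑ i : Fin d, ∑ j : Fin d, (1 + Real.log S) * ∫ y, |gs2 j i y| := by positivity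
  refine ⟨K', by positivity, fun p hp u A₀ A₂ ℓ hℓ hℓ1 h0 h2 => ?_⟩
  have hp' : 1 ≤ ENNReal.ofReal p := by simpa using hp
  have hl : 0 ≤ Real.log ℓ⁻¹ := Real.log_nonneg ((one_le_inv₀ hℓ).2 hℓ1)
  have hA0 := h0.nonneg
  have hA2 := h2.nonneg
  have h3 (i j : Fin d) : LB (ENNReal.ofReal p)
      (fun x => |PS.D (dirE d j) (PS.D (dirE d i) (pot S u)) x|)
      (ℓ ^ 2 * A₂ + (1 + Real.log S) * (∫ y, |gs2 j i y|) * ((1 + Real.log ℓ⁻¹) * A₀)) := by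
    rw [D_pot, D_pot, pot_D_D hℓ (hℓ1.trans hS)]
    have hDD : LB (ENNReal.ofReal p) (PS.D (dirE d j) (PS.D (dirE d i) u)) A₂ := by
      refine h2.mono (PS.continuous _) fun x => ?_
      exact (PS.jet_D_le 0 (PS.D (dirE d i) u) x j).trans (PS.jet_D_le 1 u x i)
    have h4 := hDD.pav hp (integrableOn_id_Ioc 0 ℓ) integrable_gs measurable_id
      continuous_gs.measurable
    have h5 := h0.pav hp (integrableOn_inv_Ioc (b := S) hℓ) (integrable_gs2 j i) measurable_inv
      (continuous_gs2 j i).measurable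
    refine LB.abs ((h4.add hp' h5).weaken (add_le_add ?_ ?_))
    · rw [integral_abs_gs, mul_one]
      exact mul_le_mul_of_nonneg_right (setIntegral_abs_id_le hℓ.le) hA2
    · rw [setIntegral_abs_inv hℓ (hℓ1.trans hS), div_eq_mul_inv,
        Real.log_mul (by positivity) (by positivity)]
      have h6 : 0 ≤ (∫ y, |gs2 j i y|) * A₀ := mul_nonneg (by positivity) hA0
      calc _ = (Real.log S + Real.log ℓ⁻¹) * ((∫ y, |gs2 j i y|) * A₀) := by ring
        _ ≤ ((1 + Real.log S) * (1 + Real.log ℓ⁻¹)) * ((∫ y, |gs2 j i y|) * A₀) :=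
          mul_le_mul_of_nonneg_right (by nlinarith [mul_nonneg hL hl]) h6
        _ = _ := by ring
  have h4 := (h p hp u A₀ h0).add hp' (LB.sum hp' Finset.univ fun i _ =>
    LB.sum hp' Finset.univ fun j _ => h3 i j)
  refine (h4.weaken ?_).mono (PS.continuous_jet _ _) fun x => ?_
  · simp only [Finset.sum_add_distrib, ← Finset.sum_mul, Finset.sum_const, Finset.card_univ,
      Fintype.card_fin, nsmul_eq_mul]
    set Q := ∑ i : Fin d, ∑ j : Fin d, (1 + Real.log S) * ∫ y, |gs2 j i y|
    rw [hK']
    have e1 : 0 ≤ ℓ ^ 2 * A₂ := by positivity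
    have e2 : A₀ ≤ (1 + Real.log ℓ⁻¹) * A₀ := by nlinarith
    have hd0 : (0 : ℝ) ≤ d := Nat.cast_nonneg d
    nlinarith [mul_nonneg hK e1, mul_nonneg hsum e1, mul_le_mul_of_nonneg_left e2 hK,
      mul_nonneg (mul_nonneg hd0 hd0) (hA0.trans e2)]
  · rw [abs_of_nonneg (PS.jet_nonneg _ _ _)]
    simp only [PS.jet_succ, PS.jet_zero, Finset.sum_add_distrib]
    linarith

end PotentialBounds

section Poincare

variable {d : ℕ}

lemma integrable_coord_cube (i : Fin d) : Integrable (fun z : Spc d => z i) (μT d) := by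
  refine Integrable.of_bound (by fun_prop) (2 * Real.pi) ?_
  filter_upwards [ae_restrict_mem measurableSet_cube] with z hz
  rw [Real.norm_of_nonneg (hz i).1]
  exact (hz i).2.le

lemma sub_eq_integral_segment (v : PE d) (x z : Spc d) :
    v (x + z) - v x = ∫ s in Ioc (0 : ℝ) 1, ∑ i, z i * PS.D (dirE d i) v (x + s • z) := by
  have hg (s : ℝ) : HasDerivAt (fun s : ℝ => v (x + s • z))
      (∑ i, z i * PS.D (dirE d i) v (x + s • z)) s := by
    have h1 : HasDerivAt (fun s : ℝ => x + s • z) ((1 : ℝ) • z) s :=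
      ((hasDerivAt_id s).smul_const z).const_add x
    have h2 := (v.differentiable (x + s • z)).hasFDerivAt.comp_hasDerivAt s h1
    rw [one_smul] at h2
    refine h2.congr_deriv ?_
    conv_lhs => arg 2; rw [← sum_dirE z]
    simp [PS.D_apply]
  have hc : Continuous fun s : ℝ => ∑ i, z i * PS.D (dirE d i) v (x + s • z) :=
    continuous_finsetSum _ fun i _ => continuous_const.mul
      ((PS.D (dirE d i) v).continuous.comp (by fun_prop))
  rw [← intervalIntegral.integral_of_le zero_le_one,
    intervalIntegral.integral_eq_sub_of_hasDerivAt (fun s _ => hg s) (hc.intervalIntegrable 0 1)]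
  simp

/-- The Poincaré inequality in `L¹` of the torus. -/
lemma exists_poincare (d : ℕ) : ∃ K, 0 ≤ K ∧ ∀ (v : PE d) (B : ℝ),
    (∀ i, LB 1 (PS.D (dirE d i) v) B) →
    LB 1 (fun x => v x - ((2 * Real.pi) ^ d)⁻¹ * ∫ y, v y ∂(μT d)) (K * B) := by
  have hone := integrableOn_one_Ioc 0 1
  set m := (volume.restrict (Ioc (0 : ℝ) 1)).prod (μT d) with hm
  have hc (i : Fin d) : Integrable (fun o : ℝ × Spc d => (1 : ℝ) * o.2 i) m :=
    hone.mul_prod (integrable_coord_cube i)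
  have hcm (i : Fin d) : Measurable fun o : ℝ × Spc d => (1 : ℝ) * o.2 i := by fun_prop
  refine ⟨((2 * Real.pi) ^ d)⁻¹ * ∑ i, ∫ o, |(1 : ℝ) * o.2 i| ∂m, by positivity, fun v B hv => ?_⟩
  have h1 (i : Fin d) : LB 1 (PS.av m _ _ (hc i) measurable_dil (PS.D (dirE d i) v))
      ((∫ o, |(1 : ℝ) * o.2 i| ∂m) * B) := by
    have := LB.av (p := 1) le_rfl (by simpa using hv i) (hc i) (hcm i) measurable_dil
    simpa using this
  have h2 := ((LB.sum le_rfl Finset.univ fun i _ => h1 i).const_mul' (k := ((2 * Real.pi) ^ d)⁻¹)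
    (by positivity)).abs
  rw [← Finset.sum_mul, ← mul_assoc] at h2
  refine h2.mono (v.continuous.sub continuous_const) fun x => le_of_eq ?_
  rw [← abs_neg]
  congr 1
  have h3 : ∑ i, PS.av m _ _ (hc i) measurable_dil (PS.D (dirE d i) v) x
      = ∫ z, (v (x + z) - v x) ∂(μT d) := by
    simp only [PS.av_apply]
    have hi := fun i => integrable_mul_translate (hc i) measurable_dil (PS.D (dirE d i) v) x
    rw [← integral_finsetSum _ fun i _ => hi i, integral_prod_symm _
      (integrable_finsetSum _ fun i _ => hi i)]
    simp only [one_mul]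
    simp only [sub_eq_integral_segment]
  have h4 : ∫ z, v (x + z) ∂(μT d) = ∫ z, v z ∂(μT d) := by
    simp only [add_comm x]; exact integral_comp_add v.spacePeriodic x
  have h5 : Integrable (fun z => v (x + z)) (μT d) := by
    obtain ⟨K, hK⟩ := v.exists_abs_le
    exact Integrable.of_bound (v.continuous.comp (by fun_prop)).aestronglyMeasurable K
      (Eventually.of_forall fun z => hK _)
  rw [h3, integral_sub h5 (integrable_const _), h4, integral_const, μT_real_univ, smul_eq_mul]
  have : (2 * Real.pi) ^ d ≠ 0 := by positivity
  field_simp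
  ring

/-- Gaussian averages at a large scale are close to the mean. -/
lemma exists_gav_bound (d : ℕ) : ∃ K, 0 ≤ K ∧ ∀ (S : ℝ), 0 < S → ∀ (u : PE d) (A : ℝ), LB 1 u A →
    LB 1 (fun x => gav S u x - ((2 * Real.pi) ^ d)⁻¹ * ∫ y, u y ∂(μT d)) (K * S⁻¹ * A) := by
  obtain ⟨K, hK, h⟩ := exists_poincare d
  refine ⟨K * ∑ i : Fin d, ∫ y, |gs1 i y|, by positivity, fun S hS u A hu => ?_⟩
  have hZ : Measurable fun y : Spc d => S • y := by fun_prop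
  have h1 (i : Fin d) : PS.D (dirE d i) (gav S u)
      = (-S⁻¹) • PS.av volume (gs1 i) (fun y => S • y) (integrable_gs1 i) hZ u := by
    rw [gav, PS.D_av]
    refine PS.ext fun x => ?_
    rw [PS.smul_apply, PS.av_apply, PS.av_apply]
    have := integral_translate_ibp integrable_gs (integrable_gs1 i) differentiable_gs
      (fderiv_gs i) u x S
    rw [neg_mul, ← mul_neg, ← this, inv_mul_cancel_left₀ hS.ne']
  have h2 (i : Fin d) : LB 1 (PS.D (dirE d i) (gav S u))
      (S⁻¹ * ((∑ i : Fin d, ∫ y, |gs1 i y|) * A)) := by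
    rw [h1]
    have h3 := LB.av (p := 1) le_rfl (by simpa using hu) (integrable_gs1 i)
      (continuous_gs1 i).measurable hZ
    rw [ENNReal.ofReal_one] at h3
    have h4 := h3.const_mul (-S⁻¹)
    rw [abs_neg, abs_of_pos (inv_pos.2 hS)] at h4
    refine h4.weaken ?_
    gcongr
    · exact hu.nonneg
    · exact Finset.single_le_sum (f := fun i : Fin d => ∫ y, |gs1 i y|)
        (fun i _ => by positivity) (Finset.mem_univ i)
  have h3 := h (gav S u) _ h2
  have h4 : ∫ y, gav S u y ∂(μT d) = ∫ y, u y ∂(μT d) := by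
    simp only [gav_apply]
    have hi : Integrable (fun o : Spc d × Spc d => gs d o.2 * u (o.1 + S • o.2))
        ((μT d).prod volume) := by
      obtain ⟨M, hM⟩ := u.exists_abs_le
      have := (integrable_const (1 : ℝ) (μ := μT d)).mul_prod (integrable_gs (d := d))
      simp only [one_mul] at this
      refine this.mul_bdd (c := M) ?_ (Eventually.of_forall fun o => hM _)
      exact (u.continuous.comp (by fun_prop)).aestronglyMeasurable
    rw [integral_integral_swap hi]
    simp only [integral_const_mul, integral_comp_add u.spacePeriodic, integral_mul_const,
      integral_gs, one_mul]
  rw [h4] at h3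
  refine h3.weaken (le_of_eq ?_)
  ring

end Poincare

/-! ### Periodization of bump functions -/

section Periodization

open scoped ContDiff Pointwise

variable {d : ℕ}

/-- Smooth functions on the Euclidean space, without periods. -/
abbrev SF (d : ℕ) := PS (fun i : Empty => (i.elim : Spc d))

/-- Support in the closed unit ball. -/
def IsBump (u : SF d) : Prop := ∀ x : Spc d, 1 < ‖x‖ → u x = 0

/-- The lattice point nearest to `x`. -/
def nearLat (x : Spc d) : Spc d :=
  WithLp.toLp 2 fun i => 2 * Real.pi * round (x i / (2 * Real.pi))

lemma nearLat_apply (x : Spc d) (i : Fin d) :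
    nearLat x i = 2 * Real.pi * round (x i / (2 * Real.pi)) := rfl

/-- `U` is the periodization of `u ∘ Λ`. -/
def IsPer (Λ : Spc d →L[ℝ] Spc d) (u : SF d) (U : PE d) : Prop :=
  ∀ x, U x = u (Λ (x - nearLat x))

lemma abs_sub_nearLat_le (x : Spc d) (i : Fin d) : |x i - nearLat x i| ≤ Real.pi := by
  have h := abs_sub_round (x i / (2 * Real.pi))
  have hp := Real.pi_pos
  have e : x i - nearLat x i = 2 * Real.pi * (x i / (2 * Real.pi) - round (x i / (2 * Real.pi))) := by
    rw [nearLat_apply]; field_simp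
  rw [e, abs_mul, abs_of_pos (by positivity : 0 < 2 * Real.pi)]
  nlinarith

lemma IsBump.D {u : SF d} (hu : IsBump u) (e : Spc d) : IsBump (PS.D e u) := fun x hx => by
  have h : (u : Spc d → ℝ) =ᶠ[𝓝 x] fun _ => 0 := by
    filter_upwards [(isOpen_lt continuous_const continuous_norm).mem_nhds hx] with y hy
    exact hu y hy
  rw [PS.D_apply, h.fderiv_eq]; simp

lemma IsBump.mul {u v : SF d} (hu : IsBump u) : IsBump (u * v) := fun x hx => by
  rw [PS.mul_apply, hu x hx, zero_mul]

lemma nearLat_locally {u : SF d} (hu : IsBump u) {Λ : Spc d →L[ℝ] Spc d}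
    (hΛ : ∀ z, ‖z‖ ≤ ‖Λ z‖) {x y : Spc d} (hxy : ‖y - x‖ < 1) :
    u (Λ (y - nearLat y)) = u (Λ (y - nearLat x)) := by
  by_cases h : nearLat y = nearLat x
  · rw [h]
  obtain ⟨i, hi⟩ : ∃ i, nearLat y i ≠ nearLat x i := by
    by_contra! hc
    exact h (by ext i; exact hc i)
  have key (z : Spc d) (hz : 1 < |z i|) : u (Λ z) = 0 :=
    hu _ (hz.trans_le ((PiLp.norm_apply_le z i).trans (hΛ z)))
  have hp := Real.pi_gt_three
  have h1 := abs_sub_nearLat_le x i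
  have h2 := abs_sub_nearLat_le y i
  have h3 : |y i - x i| < 1 := (PiLp.norm_apply_le (y - x) i).trans_lt hxy
  have h4 : 2 * Real.pi ≤ |nearLat y i - nearLat x i| := by
    rw [nearLat_apply, nearLat_apply] at hi ⊢
    rw [← mul_sub, abs_mul, abs_of_pos (by positivity : 0 < 2 * Real.pi)]
    have : (1 : ℝ) ≤ |(round (y i / (2 * Real.pi)) : ℝ) - round (x i / (2 * Real.pi))| := by
      have h5 : round (y i / (2 * Real.pi)) - round (x i / (2 * Real.pi)) ≠ 0 :=
        fun h => hi (by rw [sub_eq_zero.1 h])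
      exact_mod_cast Int.one_le_abs h5
    nlinarith
  rw [key, key]
  · simp only [PiLp.sub_apply]
    rcases le_total 0 (nearLat y i - nearLat x i) with h | h
    · rw [abs_of_nonneg h] at h4
      rw [lt_abs]; left; linarith [abs_le.1 h2]
    · rw [abs_of_nonpos h] at h4
      rw [lt_abs]; right; linarith [abs_le.1 h2]
  · simp only [PiLp.sub_apply]
    rcases le_total 0 (nearLat y i - nearLat x i) with h | h
    · rw [abs_of_nonneg h] at h4
      rw [lt_abs]; right; linarith [abs_le.1 h1, abs_lt.1 h3]
    · rw [abs_of_nonpos h] at h4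
      rw [lt_abs]; left; linarith [abs_le.1 h1, abs_lt.1 h3]

lemma sub_nearLat_periodic (x : Spc d) (i : Fin d) :
    x + perE d i - nearLat (x + perE d i) = x - nearLat x := by
  ext j
  simp only [PiLp.sub_apply, PiLp.add_apply, nearLat_apply, perE, PiLp.smul_apply, smul_eq_mul]
  have hp : 2 * Real.pi ≠ 0 := by positivity
  by_cases h : j = i
  · subst h
    rw [PiLp.single_apply, if_pos rfl, mul_one, add_div, div_self hp,
      show (1 : ℝ) = ((1 : ℤ) : ℝ) by simp, round_add_intCast]
    push_cast; ring
  · simp [h]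

lemma eventually_nearLat {u : SF d} (hu : IsBump u) {Λ : Spc d →L[ℝ] Spc d}
    (hΛ : ∀ z, ‖z‖ ≤ ‖Λ z‖) (x : Spc d) :
    (fun y => u (Λ (y - nearLat y))) =ᶠ[𝓝 x] fun y => u (Λ (y - nearLat x)) := by
  filter_upwards [Metric.ball_mem_nhds x one_pos] with y hy
  exact nearLat_locally hu hΛ (by rwa [← dist_eq_norm])

lemma exists_isPer {u : SF d} (hu : IsBump u) {Λ : Spc d →L[ℝ] Spc d}
    (hΛ : ∀ z, ‖z‖ ≤ ‖Λ z‖) : ∃ U, IsPer Λ u U := by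
  refine ⟨⟨fun x => u (Λ (x - nearLat x)), ?_, fun x i => congrArg (fun z => u (Λ z)) (sub_nearLat_periodic x i)⟩,
    fun x => rfl⟩
  refine contDiff_iff_contDiffAt.2 fun x => ?_
  refine ContDiffAt.congr_of_eventuallyEq ?_ (eventually_nearLat hu hΛ x)
  exact (u.contDiff.comp (Λ.contDiff.comp (contDiff_id.sub contDiff_const))).contDiffAt

lemma IsPer.D {u : SF d} (hu : IsBump u) {Λ : Spc d →L[ℝ] Spc d} (hΛ : ∀ z, ‖z‖ ≤ ‖Λ z‖)
    {U : PE d} (h : IsPer Λ u U) (e : Spc d) : IsPer Λ (PS.D (Λ e) u) (PS.D e U) := fun x => by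
  have h1 : (U : Spc d → ℝ) = fun y => u (Λ (y - nearLat y)) := funext h
  rw [PS.D_apply, h1, (eventually_nearLat hu hΛ x).fderiv_eq]
  have h2 : HasFDerivAt (fun y => u (Λ (y - nearLat x)))
      ((fderiv ℝ (u : Spc d → ℝ) (Λ (x - nearLat x))).comp Λ) x := by
    have h3 : HasFDerivAt (fun y => Λ (y - nearLat x)) Λ x :=
      Λ.hasFDerivAt.comp x ((hasFDerivAt_id x).sub_const _)
    exact (u.differentiable _).hasFDerivAt.comp x h3
  rw [h2.fderiv]; rfl

variable {Λ : Spc d →L[ℝ] Spc d} {u v : SF d} {U V : PE d}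

lemma IsPer.add (h : IsPer Λ u U) (h' : IsPer Λ v V) : IsPer Λ (u + v) (U + V) := fun x => by
  simp only [PS.add_apply, h x, h' x]

lemma IsPer.sub (h : IsPer Λ u U) (h' : IsPer Λ v V) : IsPer Λ (u - v) (U - V) := fun x => by
  simp only [PS.sub_apply, h x, h' x]

lemma IsPer.mul (h : IsPer Λ u U) (h' : IsPer Λ v V) : IsPer Λ (u * v) (U * V) := fun x => by
  simp only [PS.mul_apply, h x, h' x]

lemma IsPer.smul (h : IsPer Λ u U) (c : ℝ) : IsPer Λ (c • u) (c • U) := fun x => by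
  simp only [PS.smul_apply, h x]

lemma IsPer.sum {α : Type*} {s : Finset α} {u : α → SF d} {U : α → PE d}
    (h : ∀ a ∈ s, IsPer Λ (u a) (U a)) : IsPer Λ (∑ a ∈ s, u a) (∑ a ∈ s, U a) := fun x => by
  simp only [PS.sum_apply]
  exact Finset.sum_congr rfl fun a ha => h a ha x

lemma IsPer.unique (h : IsPer Λ u U) (h' : IsPer Λ u V) : U = V :=
  PS.ext fun x => by rw [h x, h' x]

lemma lintegral_sub_nearLat {Φ : Spc d → ℝ≥0∞} (h : ∀ x, 1 < ‖x‖ → Φ x = 0) :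
    ∫⁻ x, Φ (x - nearLat x) ∂(μT d) = ∫⁻ x, Φ x := by
  set z : Spc d := WithLp.toLp 2 fun _ => -Real.pi
  have hp := Real.pi_gt_three
  have hmem (x : Spc d) : x ∈ z +ᵥ cube d ↔ ∀ i, x i ∈ Ico (-Real.pi) Real.pi := by
    rw [mem_vadd_set_iff_neg_vadd_mem]
    refine forall_congr' fun i => ?_
    simp only [vadd_eq_add, PiLp.add_apply, PiLp.neg_apply, mem_Ico, z]
    constructor <;> rintro ⟨h1, h2⟩ <;> constructor <;> linarith
  rw [← lintegral_vadd_cube (f := fun x => Φ (x - nearLat x))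
    (fun x i => congrArg Φ (sub_nearLat_periodic x i)) z]
  have hm : MeasurableSet (z +ᵥ cube d) := measurableSet_cube.const_vadd z
  rw [setLIntegral_congr_fun (g := Φ) hm fun x hx => ?_]
  · rw [← lintegral_indicator hm]
    refine lintegral_congr fun x => ?_
    by_cases hx : x ∈ z +ᵥ cube d
    · rw [indicator_of_mem hx]
    · rw [indicator_of_notMem hx, h x]
      rw [hmem] at hx
      push Not at hx
      obtain ⟨i, hi⟩ := hx
      refine lt_of_lt_of_le ?_ (PiLp.norm_apply_le x i)
      rw [Real.norm_eq_abs]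
      by_contra! hc
      exact hi ⟨by linarith [abs_le.1 hc], by linarith [abs_le.1 hc]⟩
  · have : nearLat x = 0 := by
      ext i
      rw [nearLat_apply]
      have := (hmem x).1 hx i
      have hr : round (x i / (2 * Real.pi)) = 0 := by
        rw [round_eq_zero_iff]
        constructor
        · rw [le_div_iff₀ (by positivity)]; linarith [this.1]
        · rw [div_lt_iff₀ (by positivity)]; linarith [this.2]
      simp [hr]
    simp only [this, sub_zero]

end Periodization

section PeriodizationBounds

open scoped ContDiff

variable {d : ℕ}

/-- The indicator function of the support of the periodization by `Λ`. -/
def perInd (Λ : Spc d →L[ℝ] Spc d) (x : Spc d) : ℝ :=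
  {z : Spc d | ‖Λ z‖ ≤ 1}.indicator (fun _ => (1 : ℝ)) (x - nearLat x)

lemma perInd_nonneg (Λ : Spc d →L[ℝ] Spc d) (x : Spc d) : 0 ≤ perInd Λ x :=
  indicator_nonneg (fun _ _ => zero_le_one) _

lemma D_dir_SF (u : SF d) (e : Spc d) : PS.D e u = ∑ j, e j • PS.D (dirE d j) u := by
  conv_lhs => rw [← sum_dirE e]
  refine PS.ext fun x => ?_
  simp [PS.D_apply]

lemma IsBump.exists_bound {u : SF d} (hu : IsBump u) : ∃ K, 0 ≤ K ∧ ∀ x, |u x| ≤ K := by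
  obtain ⟨K, hK⟩ := (isCompact_closedBall (0 : Spc d) 1).exists_bound_of_continuousOn
    u.continuous.continuousOn
  refine ⟨|K|, abs_nonneg _, fun x => ?_⟩
  by_cases hx : ‖x‖ ≤ 1
  · exact (hK x (by simpa using hx)).trans (le_abs_self K)
  · rw [hu x (not_le.1 hx)]; simp

lemma exists_jet_isPer (k : ℕ) {u : SF d} (hu : IsBump u) : ∃ K, 0 ≤ K ∧
    ∀ (Λ : Spc d →L[ℝ] Spc d) (μ : ℝ) (U : PE d), 1 ≤ μ → (∀ z, ‖z‖ ≤ ‖Λ z‖) →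
    (∀ z, ‖Λ z‖ ≤ μ * ‖z‖) → IsPer Λ u U →
    ∀ x, PS.jet (dirE d) k U x ≤ K * μ ^ k * perInd Λ x := by
  obtain ⟨K₀, hK₀, h₀⟩ := hu.exists_bound
  have base : ∀ (Λ : Spc d →L[ℝ] Spc d) (U : PE d), IsPer Λ u U → ∀ x, |U x| ≤ K₀ * perInd Λ x := by
    intro Λ U h x
    rw [h x, perInd]
    by_cases hx : ‖Λ (x - nearLat x)‖ ≤ 1
    · rw [indicator_of_mem (by exact hx), mul_one]; exact h₀ _
    · rw [hu _ (not_le.1 hx), indicator_of_notMem (by exact hx)]; simp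
  induction k generalizing u K₀ with
  | zero => exact ⟨K₀, hK₀, fun Λ μ U _ _ _ h x => by simpa [PS.jet_zero] using base Λ U h x⟩
  | succ k ih =>
    choose K₁ hK₁ h₁ using fun j => (hu.D (dirE d j)).exists_bound
    have base' (j : Fin d) : ∀ (Λ : Spc d →L[ℝ] Spc d) (U : PE d),
        IsPer Λ (PS.D (dirE d j) u) U → ∀ x, |U x| ≤ K₁ j * perInd Λ x := by
      intro Λ U h x
      rw [h x, perInd]
      by_cases hx : ‖Λ (x - nearLat x)‖ ≤ 1
      · rw [indicator_of_mem (by exact hx), mul_one]; exact h₁ j _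
      · rw [hu.D _ _ (not_le.1 hx), indicator_of_notMem (by exact hx)]; simp
    choose K hK h using fun j => ih (hu.D (dirE d j)) (K₁ j) (hK₁ j) (h₁ j) (base' j)
    refine ⟨K₀ + ∑ _i : Fin d, ∑ j, K j, add_nonneg hK₀ (Finset.sum_nonneg fun i _ =>
      Finset.sum_nonneg fun j _ => hK j), fun Λ μ U hμ h1 h2 hU x => ?_⟩
    have hχ := perInd_nonneg Λ x
    choose V hV using fun j => exists_isPer (hu.D (dirE d j)) h1
    have hD (i : Fin d) : PS.D (dirE d i) U = ∑ j, (Λ (dirE d i)) j • V j := by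
      have h3 := hU.D hu h1 (dirE d i)
      rw [D_dir_SF] at h3
      exact h3.unique (IsPer.sum fun j _ => (hV j).smul _)
    have hΛi (i j : Fin d) : |(Λ (dirE d i)) j| ≤ μ := by
      refine ((PiLp.norm_apply_le (Λ (dirE d i)) j).trans (h2 _)).trans_eq ?_
      rw [dirE, PiLp.norm_single, norm_one, mul_one]
    have hj (i : Fin d) : PS.jet (dirE d) k (PS.D (dirE d i) U) x
        ≤ ∑ j, K j * μ ^ (k + 1) * perInd Λ x := by
      rw [hD]
      refine (PS.jet_sum_le _ _ _ _).trans (Finset.sum_le_sum fun j _ => ?_)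
      rw [PS.jet_smul]
      have h4 := h j Λ μ (V j) hμ h1 h2 (hV j) x
      calc _ ≤ μ * (K j * μ ^ k * perInd Λ x) :=
            mul_le_mul (hΛi i j) h4 (PS.jet_nonneg _ _ _) (by linarith)
        _ = _ := by ring
    rw [PS.jet_succ]
    calc _ ≤ K₀ * μ ^ (k + 1) * perInd Λ x + ∑ i : Fin d, ∑ j, K j * μ ^ (k + 1) * perInd Λ x := by
          refine add_le_add ((base Λ U hU x).trans ?_) (Finset.sum_le_sum fun i _ => hj i)
          exact mul_le_mul_of_nonneg_right
            (le_mul_of_one_le_right hK₀ (one_le_pow₀ hμ)) hχ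
      _ = _ := by simp only [add_mul, Finset.sum_mul]

lemma lintegral_comp_linear {Λ : Spc d →L[ℝ] Spc d} {M : ℝ} (hM : 0 < M)
    (hdet : LinearMap.det (Λ : Spc d →ₗ[ℝ] Spc d) = M) {Φ : Spc d → ℝ≥0∞} (hΦ : Measurable Φ) :
    ∫⁻ x, Φ (Λ x) = ENNReal.ofReal M⁻¹ * ∫⁻ x, Φ x := by
  have h := Measure.map_linearMap_addHaar_eq_smul_addHaar (volume : Measure (Spc d))
    (f := (Λ : Spc d →ₗ[ℝ] Spc d)) (by rw [hdet]; exact hM.ne')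
  rw [hdet, abs_of_pos (inv_pos.2 hM)] at h
  have h' : Measure.map (fun x => Λ x) (volume : Measure (Spc d)) =
    ENNReal.ofReal M⁻¹ • (volume : Measure (Spc d)) := h
  rw [← smul_eq_mul, ← lintegral_smul_measure, ← h', lintegral_map hΦ Λ.continuous.measurable]

lemma integral_isPer {Λ : Spc d →L[ℝ] Spc d} (hΛ : ∀ z, ‖z‖ ≤ ‖Λ z‖) {M : ℝ} (hM : 0 < M)
    (hdet : LinearMap.det (Λ : Spc d →ₗ[ℝ] Spc d) = M) {u : SF d} (hu : IsBump u)
    (h0 : ∀ x, 0 ≤ u x) {U : PE d} (hU : IsPer Λ u U) :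
    ∫ x, U x ∂(μT d) = M⁻¹ * ∫ x, u x := by
  have hU0 (x) : 0 ≤ U x := by rw [hU x]; exact h0 _
  rw [integral_eq_lintegral_of_nonneg_ae (Eventually.of_forall hU0)
    U.continuous.aestronglyMeasurable, integral_eq_lintegral_of_nonneg_ae (Eventually.of_forall h0)
    u.continuous.aestronglyMeasurable]
  have h1 : ∫⁻ x, ENNReal.ofReal (U x) ∂(μT d) = ∫⁻ x, ENNReal.ofReal (u (Λ x)) := by
    rw [← lintegral_sub_nearLat (Φ := fun x => ENNReal.ofReal (u (Λ x)))
      (fun x hx => by rw [hu _ (hx.trans_le (hΛ x)), ENNReal.ofReal_zero])]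
    exact lintegral_congr fun x => by rw [hU x]
  rw [h1, lintegral_comp_linear hM hdet (Φ := fun x => ENNReal.ofReal (u x))
    u.continuous.measurable.ennreal_ofReal, ENNReal.toReal_mul,
    ENNReal.toReal_ofReal (inv_pos.2 hM).le]

lemma lb_of_le_perInd {Λ : Spc d →L[ℝ] Spc d} (hΛ : ∀ z, ‖z‖ ≤ ‖Λ z‖) {M : ℝ} (hM : 0 < M)
    (hdet : LinearMap.det (Λ : Spc d →ₗ[ℝ] Spc d) = M) {h : Spc d → ℝ} (hc : Continuous h)
    {K : ℝ} (hK : 0 ≤ K) (hh : ∀ x, |h x| ≤ K * perInd Λ x) {p : ℝ} (hp : 1 ≤ p) :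
    LB (ENNReal.ofReal p) h
      (K * ((volume (Metric.closedBall (0 : Spc d) 1)).toReal ^ p⁻¹ * M ^ (-p⁻¹))) := by
  have hp0 : 0 < p := by linarith
  have hp1 : ENNReal.ofReal p ≠ 0 := by simpa using hp0
  set B := volume (Metric.closedBall (0 : Spc d) 1) with hB
  have hBf : B ≠ ⊤ := (isCompact_closedBall (0 : Spc d) 1).measure_lt_top.ne
  refine ⟨hc, by positivity, ?_⟩
  rw [eLpNorm_eq_lintegral_rpow_enorm_toReal hp1 ENNReal.ofReal_ne_top,
    ENNReal.toReal_ofReal hp0.le]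
  set Ψ : Spc d → ℝ≥0∞ := (Metric.closedBall (0 : Spc d) 1).indicator
    fun _ => ENNReal.ofReal K ^ p with hΨ
  have hΨm : Measurable Ψ := measurable_const.indicator measurableSet_closedBall
  have h1 (x : Spc d) : ‖h x‖ₑ ^ p ≤ Ψ (Λ (x - nearLat x)) := by
    have h2 := hh x
    rw [perInd] at h2
    rw [hΨ]
    by_cases hx : ‖Λ (x - nearLat x)‖ ≤ 1
    · rw [indicator_of_mem (by exact hx), mul_one] at h2
      rw [indicator_of_mem (by simpa using hx), Real.enorm_eq_ofReal_abs]
      gcongr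
    · rw [indicator_of_notMem (by exact hx), mul_zero] at h2
      rw [abs_nonpos_iff.1 h2, enorm_zero, ENNReal.zero_rpow_of_pos hp0]
      exact zero_le
  have h3 : ∫⁻ x, ‖h x‖ₑ ^ p ∂(μT d) ≤ ENNReal.ofReal M⁻¹ * (ENNReal.ofReal K ^ p * B) := by
    refine (lintegral_mono h1).trans_eq ?_
    rw [lintegral_sub_nearLat (Φ := fun x => Ψ (Λ x)) (fun x hx => indicator_of_notMem
      (by simpa using hx.trans_le (hΛ x)) _), lintegral_comp_linear hM hdet hΨm,
      lintegral_indicator measurableSet_closedBall, lintegral_const, Measure.restrict_apply_univ]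
  refine (ENNReal.rpow_le_rpow h3 (by positivity)).trans_eq ?_
  rw [one_div, ENNReal.mul_rpow_of_nonneg _ _ (by positivity),
    ENNReal.mul_rpow_of_nonneg _ _ (by positivity), ← ENNReal.rpow_mul, mul_inv_cancel₀ hp0.ne',
    ENNReal.rpow_one, ENNReal.ofReal_mul hK, ENNReal.ofReal_mul (by positivity),
    ← ENNReal.ofReal_rpow_of_nonneg ENNReal.toReal_nonneg (by positivity),
    ENNReal.ofReal_toReal hBf, Real.rpow_neg hM.le, ← Real.inv_rpow hM.le,
    ← ENNReal.ofReal_rpow_of_pos (inv_pos.2 hM)]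
  ring

end PeriodizationBounds

/-! ### Anisotropic concentration -/

section Anisotropic

open scoped ContDiff

variable {d : ℕ}

/-- The directional derivatives of non-periodic functions along the coordinate axes. -/
abbrev DS (d : ℕ) (i : Fin d) : Derivation ℝ (SF d) (SF d) := PS.D (dirE d i)

lemma exists_bump_profile (hd : 2 ≤ d) {ξ : Spc d} (hξ : ‖ξ‖ = 1) :
    ∃ u : SF d, IsBump u ∧ 0 < ∫ x, ((lapl (DS d) u - PS.D ξ (PS.D ξ u)) *
      (lapl (DS d) u - PS.D ξ (PS.D ξ u)) : SF d) x := by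
  obtain ⟨i, hi⟩ : ∃ i, ξ i ^ 2 < 1 := by
    by_contra! h
    have h1 : ∑ i, ξ i ^ 2 = 1 := by simp only [pow_two]; exact sum_coord_sq hξ
    have h2 : ∑ _i : Fin d, (1 : ℝ) ≤ ∑ i, ξ i ^ 2 := Finset.sum_le_sum fun i _ => h i
    rw [h1] at h2
    simp at h2
    omega
  let f : ContDiffBump (0 : Spc d) := ⟨1 / 2, 1, by norm_num, by norm_num⟩
  let φ : SF d := ⟨f, f.contDiff, fun _ i => i.elim⟩
  let c : SF d := ⟨fun x => x i, by fun_prop, fun _ i => i.elim⟩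
  have hφ : IsBump φ := fun x hx => f.zero_of_le_dist (by simpa using hx.le)
  have hφ0 : φ 0 = 1 := f.one_of_mem_closedBall (by simp [f])
  have hc0 : c 0 = 0 := rfl
  have hc (e : Spc d) : PS.D e c = algebraMap ℝ (SF d) (e i) := PS.ext fun x => by
    have : HasFDerivAt (fun x : Spc d => x i) (EuclideanSpace.proj i : Spc d →L[ℝ] ℝ) x :=
      (EuclideanSpace.proj i : Spc d →L[ℝ] ℝ).hasFDerivAt
    rw [PS.D_apply]
    exact (congrArg (fun L : Spc d →L[ℝ] ℝ => L e) this.fderiv).trans rfl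
  have hDD (e : Spc d) : PS.D e (PS.D e (φ * (c * c))) 0 = 2 * e i ^ 2 := by
    simp only [Derivation.leibniz, hc, smul_eq_mul, map_add, Derivation.map_algebraMap,
      PS.add_apply, PS.mul_apply, hc0, hφ0]
    have : (algebraMap ℝ (SF d) (e i)) 0 = e i := rfl
    rw [this]
    simp
    ring
  set u := φ * (c * c) with hu
  have hub : IsBump u := hφ.mul
  refine ⟨u, hub, ?_⟩
  set G := lapl (DS d) u - PS.D ξ (PS.D ξ u) with hG
  have hG0 : G 0 = 2 * (1 - ξ i ^ 2) := by
    rw [hG, PS.sub_apply, lapl, PS.sum_apply, hDD, Finset.sum_congr rfl fun k _ => hDD (dirE d k)]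
    simp [dirE, PiLp.single_apply]
    ring
  have hGb : IsBump (G * G) := IsBump.mul fun x hx => by
    rw [hG, PS.sub_apply, lapl, PS.sum_apply, (hub.D ξ).D ξ x hx, Finset.sum_eq_zero, sub_zero]
    exact fun k _ => (hub.D _).D _ x hx
  refine (G * G).continuous.integral_pos_of_hasCompactSupport_nonneg_nonzero
    (HasCompactSupport.intro (isCompact_closedBall (0 : Spc d) 1) fun x hx => hGb x
      (by simpa using hx)) (fun x => ?_) (x := 0) ?_
  · rw [PS.mul_apply]; exact mul_self_nonneg _
  · rw [PS.mul_apply, hG0]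
    have : 0 < 1 - ξ i ^ 2 := by linarith
    positivity

/-- Dilation by `ν` along `ξ` and by `μ` across. -/
def aniso (ξ : Spc d) (μ ν : ℝ) : Spc d →L[ℝ] Spc d :=
  μ • ContinuousLinearMap.id ℝ (Spc d) - (μ - ν) • (innerSL ℝ ξ).smulRight ξ

lemma aniso_apply (ξ : Spc d) (μ ν : ℝ) (x : Spc d) :
    aniso ξ μ ν x = μ • x - ((μ - ν) * inner ℝ ξ x) • ξ := by
  simp [aniso, smul_smul]

lemma aniso_self {ξ : Spc d} (hξ : ‖ξ‖ = 1) (μ ν : ℝ) : aniso ξ μ ν ξ = ν • ξ := by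
  rw [aniso_apply, real_inner_self_eq_norm_sq, hξ, ← sub_smul]; congr 1; ring

lemma norm_aniso_sq {ξ : Spc d} (hξ : ‖ξ‖ = 1) (μ ν : ℝ) (x : Spc d) :
    ‖aniso ξ μ ν x‖ ^ 2 = μ ^ 2 * ‖x‖ ^ 2 - (μ ^ 2 - ν ^ 2) * inner ℝ ξ x ^ 2 := by
  rw [aniso_apply, norm_sub_sq_real, norm_smul, norm_smul, hξ, inner_smul_left, inner_smul_right,
    real_inner_comm]
  simp only [Real.norm_eq_abs, mul_one, mul_pow, sq_abs, RCLike.conj_to_real]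
  ring

lemma le_norm_aniso {ξ : Spc d} (hξ : ‖ξ‖ = 1) {μ ν : ℝ} (hν : 1 ≤ ν) (hνμ : ν ≤ μ) (x : Spc d) :
    ‖x‖ ≤ ‖aniso ξ μ ν x‖ := by
  refine le_of_sq_le_sq ?_ (norm_nonneg _)
  rw [norm_aniso_sq hξ]
  have h := abs_real_inner_le_norm ξ x
  rw [hξ, one_mul] at h
  have h1 : inner ℝ ξ x ^ 2 ≤ ‖x‖ ^ 2 := sq_le_sq.2 (by rwa [abs_norm])
  have h2 : 0 ≤ μ ^ 2 - ν ^ 2 := by nlinarith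
  nlinarith [mul_le_mul_of_nonneg_left h1 h2, mul_nonneg (sq_nonneg ‖x‖) (by nlinarith : 0 ≤ ν ^ 2 - 1)]

lemma norm_aniso_le {ξ : Spc d} (hξ : ‖ξ‖ = 1) {μ ν : ℝ} (hν : 1 ≤ ν) (hνμ : ν ≤ μ) (x : Spc d) :
    ‖aniso ξ μ ν x‖ ≤ μ * ‖x‖ := by
  refine le_of_sq_le_sq ?_ (mul_nonneg (by linarith) (norm_nonneg _))
  rw [norm_aniso_sq hξ, mul_pow]
  have h2 : 0 ≤ μ ^ 2 - ν ^ 2 := by nlinarith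
  nlinarith [mul_nonneg h2 (sq_nonneg (inner ℝ ξ x))]

lemma det_aniso {ξ : Spc d} (hξ : ‖ξ‖ = 1) {μ : ℝ} (hμ : μ ≠ 0) (ν : ℝ) :
    LinearMap.det (aniso ξ μ ν : Spc d →ₗ[ℝ] Spc d) = μ ^ d * (ν / μ) := by
  have h : (aniso ξ μ ν : Spc d →ₗ[ℝ] Spc d) = μ • LinearMap.transvection
      ((-((μ - ν) / μ)) • (innerSL ℝ ξ : Spc d →ₗ[ℝ] ℝ)) ξ := by
    ext1 x
    simp only [ContinuousLinearMap.coe_coe, aniso_apply, LinearMap.smul_apply,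
      LinearMap.transvection.apply, smul_add, smul_smul, innerSL_apply_apply, smul_eq_mul]
    rw [sub_eq_add_neg, ← neg_smul]
    congr 2
    field_simp
  rw [h, LinearMap.det_smul, LinearMap.transvection.det]
  simp only [finrank_euclideanSpace, Fintype.card_fin, LinearMap.smul_apply,
    ContinuousLinearMap.coe_coe, innerSL_apply_apply, real_inner_self_eq_norm_sq, hξ, smul_eq_mul]
  congr 1
  field_simp
  ring

lemma orthLap_isPer {ξ : Spc d} (hξ : ‖ξ‖ = 1) {μ ν : ℝ} (hν : 1 ≤ ν) (hνμ : ν ≤ μ) {u : SF d}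
    (hu : IsBump u) {U : PE d} (hU : IsPer (aniso ξ μ ν) u U) :
    IsPer (aniso ξ μ ν) (ν • PS.D ξ u) (PS.D ξ U) ∧
    IsPer (aniso ξ μ ν) (μ ^ 2 • (lapl (DS d) u - PS.D ξ (PS.D ξ u)))
      (lapl (DE d) U - PS.D ξ (PS.D ξ U)) := by
  have hΛ := fun x => le_norm_aniso hξ hν hνμ x
  have h1 := hU.D hu hΛ ξ
  have h2 := h1.D (hu.D _) hΛ ξ
  have h3 := IsPer.sum (s := Finset.univ)
    fun k _ => (hU.D hu hΛ (dirE d k)).D (hu.D _) hΛ (dirE d k)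
  have h4 := h3.sub h2
  have hin (k : Fin d) : inner ℝ ξ (dirE d k) = ξ k := by
    rw [dirE, EuclideanSpace.inner_single_right]; simp
  have hDk (k : Fin d) (u : SF d) : PS.D (aniso ξ μ ν (dirE d k)) u
      = μ • PS.D (dirE d k) u - ((μ - ν) * ξ k) • PS.D ξ u := by
    rw [aniso_apply, hin, sub_eq_add_neg, ← neg_smul, PS.D_add_dir, PS.D_smul_dir, PS.D_smul_dir,
      neg_smul]
    exact (sub_eq_add_neg _ _).symm
  have hDξ (u : SF d) : PS.D (aniso ξ μ ν ξ) u = ν • PS.D ξ u := by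
    rw [aniso_self hξ, PS.D_smul_dir]
  rw [hDξ] at h1
  refine ⟨h1, ?_⟩
  change IsPer _ _ (∑ k, PS.D (dirE d k) (PS.D (dirE d k) U) - _)
  convert h4 using 1
  rw [hDξ, hDξ, Derivation.map_smul]
  have hsum (w : SF d) : ∑ k, ξ k • PS.D (dirE d k) w = PS.D ξ w := (D_dir_SF w ξ).symm
  have hsq : ∑ k, ξ k ^ 2 = 1 := by simp only [pow_two]; exact sum_coord_sq hξ
  have hk (k : Fin d) : PS.D (aniso ξ μ ν (dirE d k)) (PS.D (aniso ξ μ ν (dirE d k)) u)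
      = μ ^ 2 • PS.D (dirE d k) (PS.D (dirE d k) u)
        - (2 * μ * (μ - ν)) • (ξ k • PS.D (dirE d k) (PS.D ξ u))
        + ((μ - ν) ^ 2 * ξ k ^ 2) • PS.D ξ (PS.D ξ u) := by
    rw [hDk, hDk, map_sub, map_sub, Derivation.map_smul, Derivation.map_smul, Derivation.map_smul,
      Derivation.map_smul, PS.D_comm ξ (dirE d k) u]
    module
  rw [Finset.sum_congr rfl fun k _ => hk k, Finset.sum_add_distrib, Finset.sum_sub_distrib,
    ← Finset.smul_sum, ← Finset.smul_sum, ← Finset.sum_smul, ← Finset.mul_sum, hsum, hsq, lapl]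
  module

end Anisotropic

section Profile

open scoped ContDiff

variable {d : ℕ}

/-- Concentrated profiles: bounds for the potential `F` and for the square of
`G = Δ F - ∂_ξ² F`. -/
lemma exists_concentration (hd : 2 ≤ d) {ξ : Spc d} (hξ : ‖ξ‖ = 1) : ∃ K : ℝ, 0 ≤ K ∧
    ∀ μ ν M : ℝ, 1 ≤ ν → ν ≤ μ → M = μ ^ d * (ν / μ) → ∃ F G : PE d,
      G = lapl (DE d) F - PS.D ξ (PS.D ξ F) ∧ ∫ x, (G * G) x ∂(μT d) = (2 * Real.pi) ^ d ∧
      ∀ p : ℝ, 1 ≤ p →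
        (∀ k ≤ 3, LB (ENNReal.ofReal p) (PS.jet (dirE d) k F)
          (K * (μ ^ k / μ ^ 2 * (√M * M ^ (-p⁻¹))))) ∧
        LB (ENNReal.ofReal p) (PS.jet (dirE d) 1 (PS.D ξ F)) (K * (ν / μ * (√M * M ^ (-p⁻¹)))) ∧
        LB (ENNReal.ofReal p) G (K * (√M * M ^ (-p⁻¹))) ∧
        ∀ k ≤ 3, LB (ENNReal.ofReal p) (PS.jet (dirE d) k (G * G))
          (K * (μ ^ k * (M * M ^ (-p⁻¹)))) := by
  obtain ⟨u, hu, hI⟩ := exists_bump_profile hd hξ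
  set G₁ := lapl (DS d) u - PS.D ξ (PS.D ξ u) with hG₁
  set I := ∫ x, (G₁ * G₁) x with hIdef
  have hG₁b : IsBump G₁ := fun x hx => by
    rw [hG₁, PS.sub_apply, lapl, PS.sum_apply, (hu.D ξ).D ξ x hx, Finset.sum_eq_zero, sub_zero]
    exact fun k _ => (hu.D _).D _ x hx
  choose K₁ hK₁ hF using fun k => exists_jet_isPer k hu
  obtain ⟨K₂, hK₂, hξF⟩ := exists_jet_isPer 1 (hu.D ξ)
  obtain ⟨K₃, hK₃, hG⟩ := exists_jet_isPer 0 hG₁b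
  choose K₄ hK₄ hf using fun k => exists_jet_isPer k (hG₁b.mul (v := G₁))
  set A := √((2 * Real.pi) ^ d / I) with hA
  have hA0 : 0 ≤ A := Real.sqrt_nonneg _
  have hA2 : A ^ 2 * I = (2 * Real.pi) ^ d := by
    rw [hA, Real.sq_sqrt (by positivity)]; field_simp
  set b := (volume (Metric.closedBall (0 : Spc d) 1)).toReal + 1 with hb
  have hb1 : 1 ≤ b := le_add_of_nonneg_left ENNReal.toReal_nonneg
  have hbp (p : ℝ) (hp : 1 ≤ p) :
      (volume (Metric.closedBall (0 : Spc d) 1)).toReal ^ p⁻¹ ≤ b := by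
    have hp0 : 0 ≤ p⁻¹ := by positivity
    calc _ ≤ b ^ p⁻¹ := Real.rpow_le_rpow ENNReal.toReal_nonneg (by linarith) hp0
      _ ≤ b ^ (1 : ℝ) := Real.rpow_le_rpow_of_exponent_le hb1 (inv_le_one_of_one_le₀ hp)
      _ = b := Real.rpow_one b
  set K₁' := ∑ k ∈ Finset.range 4, K₁ k
  set K₄' := ∑ k ∈ Finset.range 4, K₄ k
  have hK₁' (k : ℕ) (hk : k ≤ 3) : K₁ k ≤ K₁' :=
    Finset.single_le_sum (fun i _ => hK₁ i) (Finset.mem_range.2 (by omega))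
  have hK₄' (k : ℕ) (hk : k ≤ 3) : K₄ k ≤ K₄' :=
    Finset.single_le_sum (fun i _ => hK₄ i) (Finset.mem_range.2 (by omega))
  have hK₁0 : 0 ≤ K₁' := Finset.sum_nonneg fun i _ => hK₁ i
  have hK₄0 : 0 ≤ K₄' := Finset.sum_nonneg fun i _ => hK₄ i
  set K := A * K₁' * b + A * K₂ * b + A * K₃ * b + A ^ 2 * K₄' * b with hK
  refine ⟨K, by positivity, fun μ ν M hν hνμ hM => ?_⟩
  have hμ : 1 ≤ μ := hν.trans hνμ
  have hν0 : 0 < ν := by linarith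
  have hμ0 : 0 < μ := by linarith
  have hM0 : 0 < M := by rw [hM]; positivity
  set Λ := aniso ξ μ ν with hΛ
  have hdet : LinearMap.det (Λ : Spc d →ₗ[ℝ] Spc d) = M := by rw [hM]; exact det_aniso hξ hμ0.ne' ν
  have h1 (z) : ‖z‖ ≤ ‖Λ z‖ := le_norm_aniso hξ hν hνμ z
  have h2 (z) : ‖Λ z‖ ≤ μ * ‖z‖ := norm_aniso_le hξ hν hνμ z
  obtain ⟨U, hU⟩ := exists_isPer hu h1
  obtain ⟨V, hV⟩ := exists_isPer hG₁b h1
  obtain ⟨W, hW⟩ := exists_isPer (hu.D ξ) h1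
  obtain ⟨hUξ, hUG⟩ := orthLap_isPer hξ hν hνμ hu hU
  have hWU : PS.D ξ U = ν • W := hUξ.unique (hW.smul ν)
  have hVU : lapl (DE d) U - PS.D ξ (PS.D ξ U) = μ ^ 2 • V := hUG.unique (hV.smul _)
  set c := A * √M / μ ^ 2 with hc
  have hc0 : 0 ≤ c := by positivity
  have hG' : (A * √M) • V = lapl (DE d) (c • U) - PS.D ξ (PS.D ξ (c • U)) := by
    rw [lapl_smul, Derivation.map_smul, Derivation.map_smul, ← smul_sub, hVU, smul_smul, hc]
    congr 1; field_simp
  have hGG : ((A * √M) • V) * ((A * √M) • V) = (A ^ 2 * M) • (V * V) := by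
    rw [smul_mul_smul_comm]; congr 1
    calc _ = A ^ 2 * (√M * √M) := by ring
      _ = _ := by rw [Real.mul_self_sqrt hM0.le]
  have lb (p : ℝ) (hp : 1 ≤ p) {h : Spc d → ℝ} (hc : Continuous h) {k k' : ℝ} (hk : 0 ≤ k)
      (hkk : k * b ≤ k') (hh : ∀ x, |h x| ≤ k * perInd Λ x) :
      LB (ENNReal.ofReal p) h (k' * M ^ (-p⁻¹)) := by
    refine (lb_of_le_perInd h1 hM0 hdet hc hk hh hp).weaken ?_
    rw [← mul_assoc]
    exact mul_le_mul_of_nonneg_right ((mul_le_mul_of_nonneg_left (hbp p hp) hk).trans hkk)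
      (Real.rpow_nonneg hM0.le _)
  have hA1 : 0 ≤ A * K₁' * b := by positivity
  have hA2' : 0 ≤ A * K₂ * b := by positivity
  have hA3 : 0 ≤ A * K₃ * b := by positivity
  have hA4 : 0 ≤ A ^ 2 * K₄' * b := by positivity
  refine ⟨c • U, (A * √M) • V, hG', ?_, fun p hp => ⟨fun k hk => ?_, ?_, ?_, fun k hk => ?_⟩⟩
  · have hVV : IsPer Λ (G₁ * G₁) (V * V) := hV.mul hV
    have := integral_isPer h1 hM0 hdet (hG₁b.mul (v := G₁))
      (fun x => by rw [PS.mul_apply]; exact mul_self_nonneg _) hVV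
    rw [hGG]
    simp only [PS.smul_apply]
    rw [integral_const_mul, this, ← hIdef, ← hA2]
    field_simp
  · rw [← mul_assoc, ← mul_assoc]
    refine lb p hp (PS.continuous_jet _ _) (k := c * (K₁' * μ ^ k)) (by positivity) ?_ fun x => ?_
    · calc _ = A * K₁' * b * (μ ^ k / μ ^ 2 * √M) := by rw [hc]; ring
        _ ≤ K * (μ ^ k / μ ^ 2 * √M) :=
          mul_le_mul_of_nonneg_right (by rw [hK]; linarith) (by positivity)
        _ = _ := by ring
    · rw [abs_of_nonneg (PS.jet_nonneg _ _ _), PS.jet_smul, abs_of_nonneg hc0, mul_assoc]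
      refine mul_le_mul_of_nonneg_left ((hF k Λ μ U hμ h1 h2 hU x).trans ?_) hc0
      have := perInd_nonneg Λ x
      have := hK₁' k hk
      gcongr
  · rw [← mul_assoc, ← mul_assoc]
    refine lb p hp (PS.continuous_jet _ _) (k := (c * ν) * (K₂ * μ)) (by positivity) ?_ fun x => ?_
    · calc _ = A * K₂ * b * (ν / μ * √M) := by rw [hc]; field_simp
        _ ≤ K * (ν / μ * √M) :=
          mul_le_mul_of_nonneg_right (by rw [hK]; linarith) (by positivity)
        _ = _ := by ring
    · rw [abs_of_nonneg (PS.jet_nonneg _ _ _), Derivation.map_smul, hWU, smul_smul, PS.jet_smul,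
        abs_of_nonneg (by positivity), mul_assoc (c * ν)]
      refine mul_le_mul_of_nonneg_left ((hξF Λ μ W hμ h1 h2 hW x).trans_eq ?_) (mul_nonneg hc0 hν0.le)
      rw [pow_one]
  · rw [← mul_assoc]
    refine lb p hp (PS.continuous _) (k := (A * √M) * K₃) (by positivity) ?_ fun x => ?_
    · calc _ = A * K₃ * b * √M := by ring
        _ ≤ K * √M := mul_le_mul_of_nonneg_right (by rw [hK]; linarith) (by positivity)
    · rw [PS.smul_apply, abs_mul, abs_of_nonneg (by positivity : 0 ≤ A * √M), mul_assoc (A * √M)]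
      refine mul_le_mul_of_nonneg_left ((hG Λ μ V hμ h1 h2 hV x).trans_eq ?_) (mul_nonneg hA0 (Real.sqrt_nonneg M))
      rw [pow_zero, mul_one]
  · rw [← mul_assoc, ← mul_assoc, hGG]
    refine lb p hp (PS.continuous_jet _ _) (k := (A ^ 2 * M) * (K₄' * μ ^ k)) (by positivity) ?_
      fun x => ?_
    · calc _ = A ^ 2 * K₄' * b * (μ ^ k * M) := by ring
        _ ≤ K * (μ ^ k * M) :=
          mul_le_mul_of_nonneg_right (by rw [hK]; linarith) (by positivity)
        _ = _ := by ring
    · rw [abs_of_nonneg (PS.jet_nonneg _ _ _), PS.jet_smul, abs_of_nonneg (by positivity),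
        mul_assoc (A ^ 2 * M)]
      refine mul_le_mul_of_nonneg_left ((hf k Λ μ _ hμ h1 h2 (hV.mul hV) x).trans ?_)
        (mul_nonneg (sq_nonneg A) hM0.le)
      have := perInd_nonneg Λ x
      have := hK₄' k hk
      gcongr

end Profile

section ProfileExistence

variable {d : ℕ}

set_option maxHeartbeats 1000000 in
lemma exists_hasProfile_aux (hd : 2 ≤ d) {ξ : Spc d} (hξ : ‖ξ‖ = 1) {r : ℝ} (hr : 1 ≤ r) :
    ∃ C₀ : ℝ, 0 ≤ C₀ ∧ ∀ S : ℝ, 1 ≤ S → ∃ K : ℝ, 0 ≤ K ∧ ∀ μ ν M τ : ℝ, 1 ≤ ν → ν ≤ μ →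
      M = μ ^ d * (ν / μ) → 0 < τ → τ ≤ 1 → ν / μ = τ ^ 2 → μ⁻¹ ≤ τ →
      μ * (√M * M ^ (-r⁻¹)) ≤ τ →
      HasProfile ξ (ENNReal.ofReal r) (C₀ * S⁻¹) K (K * (τ * (2 + Real.log μ))) := by
  obtain ⟨K₀, hK₀, hconc⟩ := exists_concentration hd hξ
  obtain ⟨Kg, hKg, hgav⟩ := exists_gav_bound d
  refine ⟨Kg * K₀, by positivity, fun S hS => ?_⟩
  obtain ⟨K₁, hK₁, hpot1⟩ := exists_jet_one_pot d S
  obtain ⟨K₂, hK₂, hpot2⟩ := exists_jet_two_pot d hS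
  refine ⟨4 * K₀ + K₁ * K₀ + K₂ * K₀ + d * (K₂ * K₀), by positivity,
    fun μ ν M τ hν hνμ hM hτ hτ1 hντ hμτ hστ => ?_⟩
  have hμ : 1 ≤ μ := hν.trans hνμ
  have hμ0 : 0 < μ := by linarith
  have hν0 : 0 < ν := by linarith
  have hM0 : 0 < M := by rw [hM]; positivity
  have hs0 : 0 < √M := Real.sqrt_pos.2 hM0
  have hss : √M * √M = M := Real.mul_self_sqrt hM0.le
  have hlog : 0 ≤ Real.log μ := Real.log_nonneg hμ
  set L := 2 + Real.log μ with hL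
  have hL1 : 1 ≤ L := by linarith
  have hτL : τ ≤ τ * L := le_mul_of_one_le_right hτ.le hL1
  obtain ⟨F, G, hGF, hintF, h⟩ := hconc μ ν M hν hνμ hM
  have hm1 : M ^ (-(1 : ℝ)⁻¹) = M⁻¹ := by rw [inv_one, Real.rpow_neg_one]
  have hm2 : M ^ (-(2 : ℝ)⁻¹) = (√M)⁻¹ := by
    rw [Real.rpow_neg hM0.le, Real.sqrt_eq_rpow]; norm_num
  have e2 : √M * (√M)⁻¹ = 1 := mul_inv_cancel₀ hs0.ne'
  have e2' : M * (√M)⁻¹ = √M := by rw [← div_eq_mul_inv, Real.div_sqrt]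
  have e1 : M * M⁻¹ = 1 := mul_inv_cancel₀ hM0.ne'
  have e1' : √M * M⁻¹ = (√M)⁻¹ := by rw [← hss, mul_inv, ← mul_assoc, hss, e2, one_mul]
  obtain ⟨hFr, -, -, hfr⟩ := h r hr
  obtain ⟨hF2, hξ2, hG2, hf2⟩ := h 2 one_le_two
  obtain ⟨-, hξ1, -, hf1⟩ := h 1 le_rfl
  rw [hm2, e2, mul_one] at hξ2 hG2
  simp only [hm2, e2, e2', mul_one] at hF2 hf2
  rw [hm1, e1'] at hξ1
  simp only [hm1, e1, mul_one] at hf1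
  rw [ENNReal.ofReal_one] at hξ1 hf1
  rw [ENNReal.ofReal_ofNat] at hξ2 hG2
  set m := M ^ (-r⁻¹) with hm
  have hm0 : 0 < m := Real.rpow_pos_of_pos hM0 _
  set σ := √M * m with hσ
  have hσ0 : 0 < σ := by positivity
  have hσ1 : σ ≤ μ * σ := le_mul_of_one_le_left hσ0.le hμ
  have hMm : M * m = √M * σ := by rw [hσ, ← mul_assoc, hss]
  rw [hMm] at hfr
  set f := G * G with hf
  have base {p : ℝ≥0∞} {c : ℝ} (h0 : LB p (PS.jet (dirE d) 0 f) c) : LB p f c :=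
    h0.mono f.continuous fun x => le_rfl
  have hl0 : 0 < μ⁻¹ := by positivity
  have hl1 : μ⁻¹ ≤ 1 := hμτ.trans hτ1
  have hr' : 1 ≤ ENNReal.ofReal r := by simpa using hr
  have hω : (√M / τ)⁻¹ = τ / √M := inv_div _ _
  have hω0 : 0 ≤ τ / √M := by positivity
  have hsplit : (4 * K₀ + K₁ * K₀ + K₂ * K₀ + d * (K₂ * K₀)) * (τ * L)
      = 4 * (K₀ * (τ * L)) + K₁ * K₀ * (τ * L) + K₂ * K₀ * (τ * L) + d * (K₂ * K₀) * (τ * L) := by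
    ring
  have c1 : 0 ≤ K₁ * K₀ := by positivity
  have c2 : 0 ≤ K₂ * K₀ := by positivity
  have c3 : 0 ≤ d * (K₂ * K₀) := by positivity
  have p1 : 0 ≤ K₀ * (τ * L) := by positivity
  have p2 : 0 ≤ K₁ * K₀ * (τ * L) := by positivity
  have p3 : 0 ≤ K₂ * K₀ * (τ * L) := by positivity
  have p4 : 0 ≤ d * (K₂ * K₀) * (τ * L) := by positivity
  refine ⟨√M / τ, F, -pot S f, G, gav S f - 1, by positivity, hGF, ?_, ?_, ?_, ?_, ?_, ?_, ?_⟩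
  · have h1 : lapl (DE d) (-pot S f) = -(gav S f - f) := by
      rw [← lapl_pot (by linarith) f, ← neg_one_smul ℝ, lapl_smul, neg_one_smul]
    rw [h1]; ring
  · have h1 := hgav S (by linarith) f _ (base (hf1 0 (by norm_num)))
    rw [hintF, inv_mul_cancel₀ (by positivity), pow_zero, mul_one] at h1
    refine (h1.weaken (le_of_eq (by ring))).abs.mono (PS.continuous _) fun x => le_of_eq ?_
    rw [PS.sub_apply]; rfl
  · have h1 := hpot1 1 le_rfl f K₀ (by simpa using base (hf1 0 (by norm_num)))
    rw [ENNReal.ofReal_one] at h1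
    refine (h1.mono (PS.continuous_jet _ _) fun x => ?_).weaken ?_
    · rw [abs_of_nonneg (PS.jet_nonneg _ _ _), PS.jet_neg]
    · linarith
  · refine hG2.weaken ?_
    linarith
  · rw [hω]
    have h0 := hpot1 r hr f _ (base (hfr 0 (by norm_num)))
    have h2 (i : Fin d) : LB (ENNReal.ofReal r) (PS.jet (dirE d) 2 (PS.D (dirE d i) (pot S f)))
        (K₂ * K₀ * (√M * (μ * σ * L))) := by
      rw [D_pot]
      refine (hpot2 r hr (PS.D (dirE d i) f) _ _ μ⁻¹ hl0 hl1
        ((hfr 1 (by norm_num)).mono (PS.continuous _) fun x => ?_)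
        ((hfr 3 (by norm_num)).mono (PS.continuous_jet _ _) fun x => ?_)).weaken (le_of_eq ?_)
      · exact PS.jet_D_le 0 f x i
      · rw [abs_of_nonneg (PS.jet_nonneg _ _ _)]
        exact PS.jet_D_le 2 f x i
      · rw [inv_inv, hL]; field_simp; ring
    have h3 := (h0.add hr' (LB.sum hr' Finset.univ fun i _ => h2 i)).const_mul' hω0
    have h4 := (hFr 3 le_rfl).add hr' h3
    refine (h4.mono ?_ fun x => ?_).weaken ?_
    · exact (PS.continuous_jet _ _).add (continuous_const.mul (PS.continuous_jet _ _))
    · rw [abs_of_nonneg (add_nonneg (PS.jet_nonneg _ _ _)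
        (mul_nonneg hω0 (PS.jet_nonneg _ _ _))), PS.jet_neg, PS.jet_succ 2 (pot S f)]
      gcongr
      exact PS.abs_le_jet (e := dirE d) 1 _ x
    · rw [Finset.sum_const, Finset.card_univ, Fintype.card_fin, nsmul_eq_mul, hsplit]
      have q1 : K₀ * (μ ^ 3 / μ ^ 2 * σ) ≤ K₀ * (τ * L) := by
        refine mul_le_mul_of_nonneg_left (le_trans (le_of_eq ?_) (hστ.trans hτL)) hK₀
        field_simp
      have q2 : τ / √M * (K₁ * (K₀ * (μ ^ 0 * (√M * σ)))) ≤ K₁ * K₀ * (τ * L) := by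
        calc _ = K₁ * K₀ * (τ * σ) := by field_simp
          _ ≤ _ := by
            have : σ ≤ L := by linarith
            gcongr
      have q3 : τ / √M * (d * (K₂ * K₀ * (√M * (μ * σ * L)))) ≤ d * (K₂ * K₀) * (τ * L) := by
        calc _ = d * (K₂ * K₀) * (τ * (μ * σ * L)) := by field_simp
          _ ≤ _ := by
            have : μ * σ * L ≤ L := mul_le_of_le_one_left (by linarith) (hστ.trans hτ1)
            gcongr
      rw [mul_add]
      linarith
  · rw [hω]
    have h2 := hpot2 2 one_le_two f _ _ μ⁻¹ hl0 hl1 (base (hf2 0 (by norm_num))) (hf2 2 (by norm_num))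
    have hF1 := hF2 1 (by norm_num)
    rw [ENNReal.ofReal_ofNat] at h2 hF1
    refine (((hξ2.add one_le_two hF1).add one_le_two (h2.const_mul' hω0)).mono ?_ fun x => ?_).weaken ?_
    · exact ((continuous_finsetSum _ fun j _ => (PS.continuous _).abs).add
        (PS.continuous_jet _ _)).add (continuous_const.mul (PS.continuous_jet _ _))
    · rw [abs_of_nonneg (add_nonneg (add_nonneg (Finset.sum_nonneg fun _ _ => abs_nonneg _)
        (PS.jet_nonneg _ _ _)) (mul_nonneg hω0 (PS.jet_nonneg _ _ _))), PS.jet_neg]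
      gcongr
      rw [PS.jet_succ]
      exact le_add_of_nonneg_left (abs_nonneg _)
    · rw [hsplit]
      have q1 : K₀ * (ν / μ) ≤ K₀ * (τ * L) := by
        refine mul_le_mul_of_nonneg_left ?_ hK₀
        rw [hντ]; nlinarith
      have q2 : K₀ * (μ ^ 1 / μ ^ 2) ≤ K₀ * (τ * L) := by
        refine mul_le_mul_of_nonneg_left (le_trans (le_of_eq ?_) (hμτ.trans hτL)) hK₀
        field_simp
      have q3 : τ / √M * (K₂ * (μ⁻¹ ^ 2 * (K₀ * (μ ^ 2 * √M)) +
          (1 + Real.log μ⁻¹⁻¹) * (K₀ * (μ ^ 0 * √M)))) ≤ K₂ * K₀ * (τ * L) := by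
        rw [inv_inv, hL]
        exact le_of_eq (by field_simp; ring)
      linarith
  · have h2 := hξ1.const_mul' (by positivity : 0 ≤ √M / τ)
    refine h2.weaken ?_
    rw [hsplit, hντ]
    have q1 : √M / τ * (K₀ * (τ ^ 2 * (√M)⁻¹)) ≤ K₀ * (τ * L) := by
      calc _ = K₀ * τ := by field_simp
        _ ≤ _ := mul_le_mul_of_nonneg_left hτL hK₀
    linarith

lemma HasProfile.weaken {ξ : Spc d} {r : ℝ≥0∞} {ε ε' C η η' : ℝ} (h : HasProfile ξ r ε C η)
    (hε : ε ≤ ε') (hη : η ≤ η') : HasProfile ξ r ε' C η' := by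
  obtain ⟨ω, F, H, G, g, h0, h1, h2, h3, h4, h5, h6, h7, h8⟩ := h
  exact ⟨ω, F, H, G, g, h0, h1, h2, h3.weaken hε, h4, h5, h6.weaken hη, h7.weaken hη, h8.weaken hη⟩

theorem exists_hasProfile (hd : 2 ≤ d) {ξ : Spc d} (hξ : ‖ξ‖ = 1) {r : ℝ} (hr : 1 ≤ r)
    (hr' : 1 < d * (r⁻¹ - 2⁻¹)) {ε : ℝ} (hε : 0 < ε) :
    ∃ C, ∀ η > 0, HasProfile ξ (ENNReal.ofReal r) ε C η := by
  obtain ⟨C₀, hC₀, h⟩ := exists_hasProfile_aux hd hξ hr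
  obtain ⟨K, hK, hprof⟩ := h (max 1 (C₀ / ε)) (le_max_left _ _)
  refine ⟨K, fun η hη => ?_⟩
  set β : ℝ := min 1 (d * (r⁻¹ - 2⁻¹) - 1) with hβ
  have hβ0 : 0 < β := lt_min one_pos (by linarith)
  have hβ1 : β ≤ 1 := min_le_left _ _
  have hβ2 : β ≤ d * (r⁻¹ - 2⁻¹) - 1 := min_le_right _ _
  have hlim : Tendsto (fun μ : ℝ => K * (μ ^ (-(β / 2)) * (2 + Real.log μ))) atTop (𝓝 0) := by
    have h1 := (tendsto_rpow_neg_atTop (half_pos hβ0)).const_mul 2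
    have h2 := (isLittleO_log_rpow_atTop (half_pos hβ0)).tendsto_div_nhds_zero
    have h3 := (h1.add h2).const_mul K
    simp only [mul_zero, add_zero] at h3
    refine h3.congr' ?_
    filter_upwards [eventually_gt_atTop 0] with μ hμ
    rw [Real.rpow_neg hμ.le]
    field_simp
  obtain ⟨μ, hμη, hμ1⟩ := ((hlim.eventually_le_const hη).and (eventually_ge_atTop 1)).exists
  have hμ0 : 0 < μ := by linarith
  have hνμ : μ ^ (1 - β) / μ = μ ^ (-β) := by
    rw [← Real.rpow_sub_one hμ0.ne']; congr 1; ring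
  have hM : μ ^ (d - β) = μ ^ d * (μ ^ (1 - β) / μ) := by
    rw [hνμ, ← Real.rpow_natCast μ d, ← Real.rpow_add hμ0]; rfl
  have h1a (a : ℝ) : μ * μ ^ a = μ ^ (1 + a) := by rw [Real.rpow_add hμ0, Real.rpow_one]
  have key := hprof μ (μ ^ (1 - β)) (μ ^ (d - β)) (μ ^ (-(β / 2)))
    (Real.one_le_rpow hμ1 (by linarith))
    ((Real.rpow_le_rpow_of_exponent_le hμ1 (by linarith)).trans_eq (Real.rpow_one μ))
    hM (Real.rpow_pos_of_pos hμ0 _)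
    (Real.rpow_le_one_of_one_le_of_nonpos hμ1 (by linarith))
    (by rw [hνμ, ← Real.rpow_natCast (μ ^ _) 2, ← Real.rpow_mul hμ0.le]; congr 1; push_cast; ring)
    (by rw [← Real.rpow_neg_one]; exact Real.rpow_le_rpow_of_exponent_le hμ1 (by linarith))
    (by
      rw [Real.sqrt_eq_rpow, ← Real.rpow_mul hμ0.le, ← Real.rpow_mul hμ0.le,
        ← Real.rpow_add hμ0, h1a]
      refine Real.rpow_le_rpow_of_exponent_le hμ1 ?_
      have : r⁻¹ ≤ 1 := inv_le_one_of_one_le₀ hr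
      nlinarith)
  refine key.weaken ?_ hμη
  rw [← div_eq_mul_inv, div_le_iff₀ (by positivity)]
  calc C₀ = ε * (C₀ / ε) := by field_simp
    _ ≤ _ := mul_le_mul_of_nonneg_left (le_max_right _ _) hε.le

end ProfileExistence

/-! ### Cancelling a finite sum of simple stresses -/

section Iteration

variable {d : ℕ} {α : Type*}

lemma integral_slice_add (u v : PX d) (t : ℝ) : ∫ x, (u + v : PX d) (t, x) ∂(μT d)
    = ∫ x, u (t, x) ∂(μT d) + ∫ x, v (t, x) ∂(μT d) :=
  integral_add (integrable_slice u t) (integrable_slice v t)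

lemma integral_slice_sum (s : Finset α) (u : α → PX d) (t : ℝ) :
    ∫ x, (∑ k ∈ s, u k : PX d) (t, x) ∂(μT d) = ∑ k ∈ s, ∫ x, u k (t, x) ∂(μT d) := by
  simp only [PS.sum_apply]
  exact integral_finsetSum _ fun k _ => integrable_slice _ t

/-- The conclusion of the perturbation step for the stress `∑ a_k² ξ_k ⊗ ξ_k`. -/
def Perturbs (v : Fin d → PX d) (s : Finset α) (ξ : α → Spc d) (a : α → PX d) (r : ℝ≥0∞)
    (T ε : ℝ) (w : Fin d → PX d) (q : PX d) (E : Fin d → Fin d → PX d) : Prop :=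
  (∀ i j, E i j = E j i) ∧ (∑ i, PS.D (dirX d i) (w i) = 0) ∧
  (∀ i, Dt d (w i) + ∑ j, PS.D (dirX d j) (v i * w j + w i * v j + w i * w j)
    + PS.D (dirX d i) q = ∑ j, PS.D (dirX d j) (PS.D (dirX d j) (w i))
    + ∑ j, PS.D (dirX d j) (E i j + ∑ k ∈ s, (ξ k i * ξ k j) • (a k * a k))) ∧
  ∀ t ∈ Icc 0 T, (∀ i, LB r (fun x => w i (t, x)) ε) ∧
    (∀ i j, LB r (fun x => PS.D (dirX d j) (w i) (t, x)) ε) ∧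
    (∀ i j, LB 1 (fun x => E i j (t, x)) ε) ∧
    |∫ x, ((∑ i, w i * w i) - ∑ k ∈ s, a k * a k : PX d) (t, x) ∂(μT d)| ≤ ε

lemma exists_perturbs (hd : 2 ≤ d) {r : ℝ} (hr : 1 ≤ r) (hr' : 1 < d * (r⁻¹ - 2⁻¹))
    (v : Fin d → PX d) (T : ℝ) (s : Finset α) (ξ : α → Spc d) (hξ : ∀ k ∈ s, ‖ξ k‖ = 1)
    (a : α → PX d) {ε : ℝ} (hε : 0 < ε) :
    ∃ w q E, Perturbs v s ξ a (ENNReal.ofReal r) T ε w q E := by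
  have hr1 : 1 ≤ ENNReal.ofReal r := by simpa using hr
  induction s using Finset.cons_induction generalizing ε with
  | empty =>
    refine ⟨0, 0, 0, fun _ _ => rfl, by simp, fun i => by simp, fun t _ => ⟨fun i => ?_,
      fun i j => ?_, fun i j => ?_, ?_⟩⟩
    · exact (LB.zero _).weaken hε.le
    · simp only [Pi.zero_apply, map_zero]
      exact (LB.zero _).weaken hε.le
    · exact (LB.zero _).weaken hε.le
    · simp [hε.le]
  | cons b s hb ih =>
    obtain ⟨W, Q, F, hF, hW, hWeq, hWb⟩ :=
      ih (fun k hk => hξ k (Finset.mem_cons_of_mem hk)) (half_pos hε)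
    choose K hK using fun i => exists_jet_bound 0 (W i) T
    set B := ∑ i, |K i| * LB.incl d 1 (ENNReal.ofReal r) with hB
    have hB0 : 0 ≤ B := Finset.sum_nonneg fun i _ =>
      mul_nonneg (abs_nonneg _) (LB.incl_pos _ _ _).le
    set η := ε / (2 * (1 + 2 * B)) with hη
    have hη0 : 0 < η := by positivity
    have hηε : η + 2 * B * η = ε / 2 := by rw [hη]; field_simp
    have hη2 : η ≤ ε / 2 := by nlinarith
    have hξb := hξ b (Finset.mem_cons_self _ _)
    obtain ⟨w, q, E, hE, hw, hweq, hwb⟩ := exists_step hξb hr1 ENNReal.ofReal_ne_top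
      (fun ε hε => exists_hasProfile hd hξb hr hr' hε) (v + W) (a b) T hη0
    refine ⟨W + w, Q + q, F + E, fun i j => ?_, ?_, fun i => ?_, fun t ht => ⟨fun i => ?_,
      fun i j => ?_, fun i j => ?_, ?_⟩⟩
    · simp only [Pi.add_apply, hF i j, hE i j]
    · simp only [Pi.add_apply, map_add, Finset.sum_add_distrib, hW, hw, add_zero]
    · have h1 := hWeq i
      have h2 := hweq i
      simp only [Pi.add_apply, map_add, Finset.sum_add_distrib, Finset.sum_cons, add_mul, mul_add]
        at h1 h2 ⊢
      linear_combination h1 + h2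
    · have h := ((hWb t ht).1 i).add hr1 (((hwb t ht).1 i).weaken hη2)
      rw [add_halves] at h
      exact h
    · have h := ((hWb t ht).2.1 i j).add hr1 (((hwb t ht).2.1 i j).weaken hη2)
      rw [add_halves] at h
      simp only [Pi.add_apply, map_add]
      exact h
    · have h := ((hWb t ht).2.2.1 i j).add le_rfl (((hwb t ht).2.2.1 i j).weaken hη2)
      rw [add_halves] at h
      exact h
    · have hcross (i : Fin d) : |∫ x, (W i * w i) (t, x) ∂(μT d)|
          ≤ |K i| * LB.incl d 1 (ENNReal.ofReal r) * η := by
        have h1 := (((hwb t ht).1 i).of_le hr1).abs.const_mul' (abs_nonneg (K i))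
        have h2 : LB 1 (fun x => (W i * w i) (t, x)) _ := h1.mono (slice t (W i * w i)).continuous
          fun x => by
            rw [PS.mul_apply, abs_mul]
            exact mul_le_mul_of_nonneg_right ((hK i t ht x).trans (le_abs_self _)) (abs_nonneg _)
        exact h2.abs_integral_le.trans_eq (by ring)
      have hsum : |∑ i, ∫ x, (W i * w i) (t, x) ∂(μT d)| ≤ B * η := by
        refine (Finset.abs_sum_le_sum_abs _ _).trans ?_
        rw [hB, Finset.sum_mul]
        exact Finset.sum_le_sum fun i _ => hcross i
      have e1 : ((∑ i, (W + w) i * (W + w) i) - ∑ k ∈ Finset.cons b s hb, a k * a k : PX d)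
          = ((∑ i, W i * W i) - ∑ k ∈ s, a k * a k) + ((∑ i, w i * w i) - a b * a b)
            + (∑ i, W i * w i + ∑ i, W i * w i) := by
        simp only [Pi.add_apply, Finset.sum_cons]
        have (i : Fin d) : (W i + w i) * (W i + w i) = W i * W i + w i * w i + (W i * w i + W i * w i) := by
          ring
        simp only [this, Finset.sum_add_distrib]
        ring
      rw [e1, integral_slice_add, integral_slice_add, integral_slice_add, integral_slice_sum]
      have h1 := (hWb t ht).2.2.2
      have h2 := (hwb t ht).2.2.2
      rw [abs_le] at h1 h2 hsum ⊢
      constructor <;> linarith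

end Iteration

/-! ### Decomposition of positive definite matrices -/

section Decomposition

open scoped ContDiff

variable {d : ℕ}

/-- Symmetric matrices bounded below by `l`. -/
def symGE (d : ℕ) (l : ℝ) : Set (Fin d → Fin d → ℝ) :=
  {M | (∀ i j, M i j = M j i) ∧ ∀ y : Fin d → ℝ, l * ∑ i, y i ^ 2 ≤ ∑ i, ∑ j, M i j * (y i * y j)}

lemma exists_unit_decomp (hd : 0 < d) (η : Fin d → ℝ) : ∃ (ξ : Spc d) (b : ℝ), ‖ξ‖ = 1 ∧
    ∀ i j, η i * η j = b ^ 2 * (ξ i * ξ j) := by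
  set y : Spc d := WithLp.toLp 2 η with hy
  by_cases h : y = 0
  · refine ⟨dirE d ⟨0, hd⟩, 0, by rw [dirE, PiLp.norm_single, norm_one], fun i j => ?_⟩
    have : η i = 0 := congrArg (fun z : Spc d => z i) h
    rw [this]; ring
  · have h0 : ‖y‖ ≠ 0 := norm_ne_zero_iff.2 h
    refine ⟨‖y‖⁻¹ • y, ‖y‖, by rw [norm_smul, norm_inv, norm_norm, inv_mul_cancel₀ h0],
      fun i j => ?_⟩
    have hc (m : Fin d) : (‖y‖⁻¹ • y) m = ‖y‖⁻¹ * η m := rfl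
    rw [hc, hc]
    field_simp

lemma exists_sq_decomp {N : Fin d → Fin d → ℝ} (hN : N ∈ symGE d 0) :
    ∃ (m : ℕ) (B : Fin m → Fin d → ℝ), ∀ i j, N i j = ∑ k, B k i * B k j := by
  have h : (Matrix.of N).PosSemidef := by
    refine Matrix.PosSemidef.of_dotProduct_mulVec_nonneg ?_ fun y => ?_
    · ext i j
      simp [Matrix.conjTranspose_apply, hN.1 j i]
    · have := hN.2 y
      rw [zero_mul] at this
      refine this.trans_eq ?_
      simp only [dotProduct, Matrix.mulVec, Matrix.of_apply, Finset.mul_sum, star_trivial]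
      exact Finset.sum_congr rfl fun i _ => Finset.sum_congr rfl fun j _ => by ring
  obtain ⟨m, B, hB⟩ := Matrix.posSemidef_iff_eq_sum_vecMulVec.1 h
  refine ⟨m, B, fun i j => ?_⟩
  have := congrFun (congrFun hB i) j
  simpa [Matrix.sum_apply, Matrix.vecMulVec_apply] using this

lemma polarization {X : Fin d → Fin d → ℝ} (hX : ∀ i j, X i j = X j i) (i j : Fin d) :
    ∑ p : Fin d × Fin d, X p.1 p.2 *
      (((if i = p.1 then 1 else 0) + (if i = p.2 then 1 else 0)) *
        ((if j = p.1 then 1 else 0) + (if j = p.2 then 1 else 0)))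
      = 2 * (X i j + ∑ k, (∑ l, X k l) * ((if i = k then 1 else 0) * (if j = k then 1 else 0))) := by
  simp only [Fintype.sum_prod_type, mul_add, mul_ite, mul_one, mul_zero,
    Finset.sum_add_distrib, Finset.sum_ite_eq, Finset.mem_univ, if_true,
    Finset.sum_ite_irrel, Finset.sum_const_zero]
  have h : ∑ l, X l i = ∑ l, X i l := Finset.sum_congr rfl fun l _ => hX l i
  by_cases hij : i = j
  · subst hij
    simp [h]; ring
  · simp [hij, hX j i]; ring

lemma quad_sq_sum {α : Type*} [Fintype α] (b : α → Fin d → ℝ) (y : Fin d → ℝ) :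
    ∑ i, ∑ j, (∑ p, b p i * b p j) * (y i * y j) = ∑ p, (∑ i, b p i * y i) ^ 2 := by
  simp only [Finset.sum_mul, sq, Finset.mul_sum]
  rw [Finset.sum_congr rfl fun i _ => Finset.sum_comm, Finset.sum_comm]
  refine Finset.sum_congr rfl fun p _ => ?_
  rw [Finset.sum_comm]
  exact Finset.sum_congr rfl fun i _ => Finset.sum_congr rfl fun j _ => by ring

lemma exists_local_decomp (hd : 0 < d) {l : ℝ} (hl : 0 < l) : ∃ δ > 0, ∀ M₀ ∈ symGE d l,
    ∃ (m : ℕ) (ξ : Fin m ⊕ (Fin d × Fin d) ⊕ Fin d → Spc d)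
      (c : Fin m ⊕ (Fin d × Fin d) ⊕ Fin d → (Fin d → Fin d → ℝ) → ℝ), (∀ k, ‖ξ k‖ = 1) ∧
      (∀ k, ContDiffOn ℝ ∞ (c k) (Metric.ball M₀ δ)) ∧
      ∀ M ∈ Metric.ball M₀ δ, (∀ i j, M i j = M j i) →
        ∀ i j, M i j = ∑ k, c k M ^ 2 * (ξ k i * ξ k j) := by
  set ε := l / (4 * d + 1) with hε
  have hε0 : 0 < ε := by positivity
  refine ⟨ε / (d + 1), by positivity, fun M₀ hM₀ => ?_⟩
  set e : Fin d → Fin d → ℝ := fun i j => if j = i then 1 else 0 with he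
  set N : Fin d → Fin d → ℝ := fun i j => M₀ i j
    - ε * (∑ p : Fin d × Fin d, (e p.1 i + e p.2 i) * (e p.1 j + e p.2 j) + ∑ p, e p i * e p j)
    with hN
  have hNmem : N ∈ symGE d 0 := by
    refine ⟨fun i j => ?_, fun y => ?_⟩
    · simp only [hN, hM₀.1 i j, mul_comm]
    · have h0 : ∑ i, ∑ j, N i j * (y i * y j) = ∑ i, ∑ j, M₀ i j * (y i * y j)
          - ε * (∑ p : Fin d × Fin d, (∑ i, (e p.1 i + e p.2 i) * y i) ^ 2
            + ∑ p, (∑ i, e p i * y i) ^ 2) := by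
        rw [← quad_sq_sum (fun (p : Fin d × Fin d) i => e p.1 i + e p.2 i), ← quad_sq_sum e]
        simp only [Finset.mul_sum, ← Finset.sum_add_distrib, ← Finset.sum_sub_distrib, hN]
        refine Finset.sum_congr rfl fun i _ => Finset.sum_congr rfl fun j _ => ?_
        ring
      have h1 (p : Fin d) : ∑ i, e p i * y i = y p := by simp [he]
      have h2 : ∑ p : Fin d × Fin d, (∑ i, (e p.1 i + e p.2 i) * y i) ^ 2
          ≤ 4 * d * ∑ i, y i ^ 2 := by
        calc _ = ∑ p : Fin d × Fin d, (y p.1 + y p.2) ^ 2 := by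
              refine Finset.sum_congr rfl fun p _ => ?_
              rw [← h1 p.1, ← h1 p.2, ← Finset.sum_add_distrib]
              congr 1
              exact Finset.sum_congr rfl fun i _ => add_mul _ _ _
          _ ≤ ∑ p : Fin d × Fin d, (2 * y p.1 ^ 2 + 2 * y p.2 ^ 2) :=
              Finset.sum_le_sum fun p _ => by nlinarith [sq_nonneg (y p.1 - y p.2)]
          _ = _ := by
              simp [Fintype.sum_prod_type, Finset.sum_add_distrib, ← Finset.mul_sum]; ring
      have h3 := hM₀.2 y
      simp only [h1] at h0
      have h4 : ε * (4 * d + 1) = l := by rw [hε]; field_simp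
      rw [zero_mul, h0, sub_nonneg]
      refine le_trans ?_ h3
      rw [← h4, mul_assoc]
      refine mul_le_mul_of_nonneg_left ?_ hε0.le
      linarith
  obtain ⟨m, B, hB⟩ := exists_sq_decomp hNmem
  choose ξ₁ b₁ hξ₁ hb₁ using fun k => exists_unit_decomp hd (B k)
  choose ξ₂ b₂ hξ₂ hb₂ using fun p : Fin d × Fin d =>
    exists_unit_decomp hd (fun i => e p.1 i + e p.2 i)
  choose ξ₃ b₃ hξ₃ hb₃ using fun k => exists_unit_decomp hd (e k)
  have hX (M : Fin d → Fin d → ℝ) (hM : M ∈ Metric.ball M₀ (ε / (d + 1))) (i j : Fin d) :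
      |M i j - M₀ i j| < ε / (d + 1) := by
    rw [Metric.mem_ball, dist_eq_norm] at hM
    exact ((norm_le_pi_norm ((M - M₀) i) j).trans (norm_le_pi_norm (M - M₀) i)).trans_lt hM
  have hdε : ε / (d + 1) * (d + 1) = ε := by field_simp
  have hd1 : ε / (d + 1) ≤ ε := div_le_self hε0.le (by linarith [Nat.cast_nonneg (α := ℝ) d])
  have pos₂ (M) (hM : M ∈ Metric.ball M₀ (ε / (d + 1))) (p : Fin d × Fin d) :
      0 < ε + 2⁻¹ * (M p.1 p.2 - M₀ p.1 p.2) := by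
    have := (abs_lt.1 (hX M hM p.1 p.2)).1
    linarith
  have pos₃ (M) (hM : M ∈ Metric.ball M₀ (ε / (d + 1))) (k : Fin d) :
      0 < ε - ∑ j, (M k j - M₀ k j) := by
    have h1 : ∑ j, (M k j - M₀ k j) ≤ ∑ _j : Fin d, ε / (d + 1) :=
      Finset.sum_le_sum fun j _ => (abs_lt.1 (hX M hM k j)).2.le
    rw [Finset.sum_const, Finset.card_univ, Fintype.card_fin, nsmul_eq_mul] at h1
    have : 0 < ε / (d + 1) := by positivity
    linarith
  refine ⟨m, Sum.elim ξ₁ (Sum.elim ξ₂ ξ₃), Sum.elim (fun k _ => b₁ k)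
    (Sum.elim (fun p M => b₂ p * √(ε + 2⁻¹ * (M p.1 p.2 - M₀ p.1 p.2)))
      (fun k M => b₃ k * √(ε - ∑ j, (M k j - M₀ k j)))), ?_, ?_, ?_⟩
  · rintro (k | k | k)
    exacts [hξ₁ k, hξ₂ k, hξ₃ k]
  · rintro (k | p | k)
    · exact contDiffOn_const
    · refine contDiffOn_const.mul (ContDiffOn.sqrt ?_ fun M hM => (pos₂ M hM p).ne')
      exact ContDiff.contDiffOn (by fun_prop)
    · refine contDiffOn_const.mul (ContDiffOn.sqrt ?_ fun M hM => (pos₃ M hM k).ne')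
      exact ContDiff.contDiffOn (by fun_prop)
  · intro M hM hsym i j
    simp only [Fintype.sum_sum_type, Sum.elim_inl, Sum.elim_inr, mul_pow]
    have h2 (p : Fin d × Fin d) : b₂ p ^ 2 * √(ε + 2⁻¹ * (M p.1 p.2 - M₀ p.1 p.2)) ^ 2
        * (ξ₂ p i * ξ₂ p j) = (ε + 2⁻¹ * (M p.1 p.2 - M₀ p.1 p.2)) *
          ((e p.1 i + e p.2 i) * (e p.1 j + e p.2 j)) := by
      rw [Real.sq_sqrt (pos₂ M hM p).le, hb₂]; ring
    have h3 (k : Fin d) : b₃ k ^ 2 * √(ε - ∑ j, (M k j - M₀ k j)) ^ 2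
        * (ξ₃ k i * ξ₃ k j) = (ε - ∑ j, (M k j - M₀ k j)) * (e k i * e k j) := by
      rw [Real.sq_sqrt (pos₃ M hM k).le, hb₃]; ring
    simp only [h2, h3, ← hb₁, ← hB]
    have hp := polarization (X := fun i j => M i j - M₀ i j)
      (fun i j => by simp only [hsym i j, hM₀.1 i j]) i j
    have hs : ∑ p : Fin d × Fin d, (ε + 2⁻¹ * (M p.1 p.2 - M₀ p.1 p.2)) *
          ((e p.1 i + e p.2 i) * (e p.1 j + e p.2 j))
        = ε * (∑ p : Fin d × Fin d, (e p.1 i + e p.2 i) * (e p.1 j + e p.2 j))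
          + 2⁻¹ * ∑ p : Fin d × Fin d, (M p.1 p.2 - M₀ p.1 p.2) *
            ((e p.1 i + e p.2 i) * (e p.1 j + e p.2 j)) := by
      rw [Finset.mul_sum, Finset.mul_sum, ← Finset.sum_add_distrib]
      exact Finset.sum_congr rfl fun p _ => by ring
    have ht : ∑ k, (ε - ∑ l, (M k l - M₀ k l)) * (e k i * e k j)
        = ε * (∑ k, e k i * e k j) - ∑ k, (∑ l, (M k l - M₀ k l)) * (e k i * e k j) := by
      rw [Finset.mul_sum, ← Finset.sum_sub_distrib]
      exact Finset.sum_congr rfl fun p _ => by ring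
    rw [hs, ht, hp]
    simp only [hN]
    ring

end Decomposition

section GlobalDecomposition

open scoped ContDiff

variable {d : ℕ}

lemma contDiff_mul_of_tsupport_subset {E : Type*} [NormedAddCommGroup E] [NormedSpace ℝ E]
    {f c : E → ℝ} {U : Set E} (hU : IsOpen U) (hf : ContDiff ℝ ∞ f) (hc : ContDiffOn ℝ ∞ c U)
    (h : tsupport f ⊆ U) : ContDiff ℝ ∞ fun x => f x * c x := by
  refine contDiff_iff_contDiffAt.2 fun x => ?_
  by_cases hx : x ∈ U
  · exact hf.contDiffAt.mul (hc.contDiffAt (hU.mem_nhds hx))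
  · have h0 : f =ᶠ[𝓝 x] 0 := notMem_tsupport_iff_eventuallyEq.1 fun h' => hx (h h')
    refine (contDiffAt_const (c := (0 : ℝ))).congr_of_eventuallyEq ?_
    filter_upwards [h0] with y hy
    rw [hy, Pi.zero_apply, zero_mul]

/-- A smooth positive replacement of `t ↦ t` on the half-line, equal to it for `1 ≤ t`. -/
def regPos (t : ℝ) : ℝ := t + (1 - Real.smoothTransition t)

lemma regPos_pos {t : ℝ} (ht : 0 ≤ t) : 0 < regPos t := by
  rw [regPos]
  rcases ht.eq_or_lt with rfl | h
  · rw [Real.smoothTransition.zero_of_nonpos le_rfl]; norm_num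
  · linarith [Real.smoothTransition.le_one t]

lemma regPos_eq {t : ℝ} (ht : 1 ≤ t) : regPos t = t := by
  rw [regPos, Real.smoothTransition.one_of_one_le ht]; ring

/-- Smooth decomposition of positive definite matrices into squares. -/
theorem exists_decomp (hd : 0 < d) {l : ℝ} (hl : 0 < l) (B : ℝ) :
    ∃ (α : Type) (_ : Fintype α) (ξ : α → Spc d) (Γ : α → (Fin d → Fin d → ℝ) → ℝ),
      (∀ k, ‖ξ k‖ = 1) ∧ (∀ k, ContDiff ℝ ∞ (Γ k)) ∧
      ∀ M ∈ symGE d l, ‖M‖ ≤ B → ∀ i j, M i j = ∑ k, Γ k M ^ 2 * (ξ k i * ξ k j) := by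
  obtain ⟨δ, hδ, H⟩ := exists_local_decomp hd hl
  set K := symGE d l ∩ Metric.closedBall (0 : Fin d → Fin d → ℝ) B with hK
  have hKt : TotallyBounded K :=
    (isCompact_closedBall (0 : Fin d → Fin d → ℝ) B).totallyBounded.subset inter_subset_right
  obtain ⟨t, htK, htf, hcov⟩ := Metric.finite_approx_of_totallyBounded hKt (δ / 2) (by positivity)
  have := htf.fintype
  choose m ξ c hξ hc hdec using fun x : t => H x.1 (htK x.2).1
  set f : ∀ x : t, ContDiffBump (x : Fin d → Fin d → ℝ) := fun x =>
    ⟨δ / 2, 3 * δ / 4, by positivity, by linarith⟩ with hf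
  have hfs (x : t) : ContDiff ℝ ∞ (f x) := (f x).contDiff
  set h : (Fin d → Fin d → ℝ) → ℝ := fun M => ∑ x, f x M ^ 2 with hh
  have h0 (M) : 0 ≤ h M := Finset.sum_nonneg fun x _ => sq_nonneg _
  have hs : ContDiff ℝ ∞ h := ContDiff.sum fun x _ => (hfs x).pow 2
  have hps : ContDiff ℝ ∞ fun M => regPos (h M) :=
    hs.add (contDiff_const.sub ((Real.smoothTransition.contDiff ).comp hs))
  have hsub (x : t) : tsupport (f x) ⊆ Metric.ball x δ := by
    rw [(f x).tsupport_eq]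
    exact Metric.closedBall_subset_ball (show 3 * δ / 4 < δ by linarith)
  refine ⟨Σ x : t, Fin (m x) ⊕ (Fin d × Fin d) ⊕ Fin d, inferInstance, fun k => ξ k.1 k.2,
    fun k M => f k.1 M * c k.1 k.2 M * (√(regPos (h M)))⁻¹, fun k => hξ k.1 k.2, fun k => ?_,
    fun M hM hMB i j => ?_⟩
  · refine (contDiff_mul_of_tsupport_subset Metric.isOpen_ball (hfs k.1) (hc k.1 k.2)
      (hsub k.1)).mul (ContDiff.inv (hps.sqrt fun M => (regPos_pos (h0 M)).ne') fun M => ?_)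
    exact (Real.sqrt_pos.2 (regPos_pos (h0 M))).ne'
  · have hMK : M ∈ K := ⟨hM, by simpa using hMB⟩
    have h1 : 1 ≤ h M := by
      obtain ⟨x, hx, hMx⟩ := mem_iUnion₂.1 (hcov hMK)
      have h2 : f ⟨x, hx⟩ M = 1 :=
        (f ⟨x, hx⟩).one_of_mem_closedBall (Metric.ball_subset_closedBall hMx)
      refine le_trans ?_ (Finset.single_le_sum (f := fun x => f x M ^ 2) (fun x _ => sq_nonneg _)
        (Finset.mem_univ ⟨x, hx⟩))
      simp [h2]
    have h3 (x : t) : ∑ k, f x M ^ 2 * (c x k M ^ 2 * (ξ x k i * ξ x k j)) = f x M ^ 2 * M i j := by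
      by_cases hx : f x M = 0
      · simp [hx]
      · rw [← Finset.mul_sum, ← hdec x M (hsub x (subset_tsupport _ hx)) hM.1]
    have h4 : (√(regPos (h M)))⁻¹ ^ 2 = (h M)⁻¹ := by
      rw [inv_pow, Real.sq_sqrt (regPos_pos (h0 M)).le, regPos_eq h1]
    rw [Fintype.sum_sigma]
    calc M i j = (h M)⁻¹ * ∑ x, f x M ^ 2 * M i j := by
          rw [← Finset.sum_mul, ← mul_assoc, inv_mul_cancel₀ (by linarith), one_mul]
      _ = _ := by
          simp only [← h3, Finset.mul_sum, mul_pow, h4]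
          exact Finset.sum_congr rfl fun x _ => Finset.sum_congr rfl fun k _ => by ring

end GlobalDecomposition

/-! ### The perturbation step for a general Reynolds stress -/

section StressStep

open scoped ContDiff

variable {d : ℕ}

/-- The function `2 √(|R|² + ε²) + γ(t)`. -/
def rhoFn (R : Fin d → Fin d → PX d) (γ : ℝ → ℝ) (hγ : ContDiff ℝ (⊤ : ℕ∞) γ) {ε : ℝ}
    (hε : 0 < ε) : PX d :=
  ⟨fun q => 2 * √((∑ i, ∑ j, R i j q ^ 2) + ε ^ 2) + γ q.1, by
    refine (contDiff_const.mul (ContDiff.sqrt ((ContDiff.sum fun i _ => ContDiff.sum fun j _ =>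
      (R i j).contDiff.pow 2).add contDiff_const) fun q => ?_)).add (hγ.comp contDiff_fst)
    have : 0 ≤ ∑ i, ∑ j, R i j q ^ 2 :=
      Finset.sum_nonneg fun i _ => Finset.sum_nonneg fun j _ => sq_nonneg _
    positivity, fun q m => by
    have h (i j) : R i j (q + perX d m) = R i j q := (R i j).periodic q m
    simp only [h]
    simp [perX]⟩

lemma rhoFn_apply (R : Fin d → Fin d → PX d) (γ : ℝ → ℝ) (hγ : ContDiff ℝ (⊤ : ℕ∞) γ) {ε : ℝ}
    (hε : 0 < ε) (q : ℝ × Spc d) :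
    rhoFn R γ hγ hε q = 2 * √((∑ i, ∑ j, R i j q ^ 2) + ε ^ 2) + γ q.1 := rfl

lemma abs_quad_le (M : Fin d → Fin d → ℝ) (y : Fin d → ℝ) :
    |∑ i, ∑ j, M i j * (y i * y j)| ≤ √(∑ i, ∑ j, M i j ^ 2) * ∑ i, y i ^ 2 := by
  have h0 : 0 ≤ ∑ i, y i ^ 2 := Finset.sum_nonneg fun i _ => sq_nonneg _
  have h := Finset.sum_mul_sq_le_sq_mul_sq Finset.univ (fun p : Fin d × Fin d => M p.1 p.2)
    (fun p => y p.1 * y p.2)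
  have h2 : ∑ i, ∑ j, (y i * y j) ^ 2 = (∑ i, y i ^ 2) ^ 2 := by
    rw [sq (∑ i, y i ^ 2), Finset.sum_mul_sum]
    simp only [mul_pow]
  simp only [Fintype.sum_prod_type] at h
  rw [h2] at h
  rw [← Real.sqrt_sq_eq_abs, ← Real.sqrt_sq h0, ← Real.sqrt_mul
    (Finset.sum_nonneg fun i _ => Finset.sum_nonneg fun j _ => sq_nonneg _)]
  exact Real.sqrt_le_sqrt h

theorem exists_stress_decomp (hd : 0 < d) (R : Fin d → Fin d → PX d) (hR : ∀ i j, R i j = R j i)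
    {γ : ℝ → ℝ} (hγ : ContDiff ℝ (⊤ : ℕ∞) γ) {T : ℝ} (hγ0 : ∀ t ∈ Icc 0 T, 0 < γ t) {ε : ℝ}
    (hε : 0 < ε) : ∃ (α : Type) (_ : Fintype α) (ξ : α → Spc d) (a : α → PX d),
      (∀ k, ‖ξ k‖ = 1) ∧ ∀ t ∈ Icc 0 T, ∀ i j,
        slice t ((if i = j then rhoFn R γ hγ hε else 0) - R i j)
          = slice t (∑ k, (ξ k i * ξ k j) • (a k * a k)) := by
  set P : Fin d → Fin d → PX d := fun i j => (if i = j then rhoFn R γ hγ hε else 0) - R i j with hP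
  choose K hK using fun i j => exists_jet_bound 0 (P i j) T
  obtain ⟨α, hα, ξ, Γ, hξ, hΓ, hdec⟩ := exists_decomp hd hε (∑ i, ∑ j, |K i j|)
  have hPc : ContDiff ℝ ∞ fun q i j => P i j q :=
    contDiff_pi.2 fun i => contDiff_pi.2 fun j => (P i j).contDiff
  refine ⟨α, hα, ξ, fun k => ⟨fun q => Γ k fun i j => P i j q, (hΓ k).comp hPc, fun q m => ?_⟩,
    hξ, fun t ht i j => PS.ext fun x => ?_⟩
  · have h (i j) : P i j (q + perX d m) = P i j q := (P i j).periodic q m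
    simp only [h]
  · have hPa (i j) : P i j (t, x) = (if i = j then rhoFn R γ hγ hε (t, x) else 0) - R i j (t, x) := by
      by_cases h : i = j <;> simp [hP, h]
    have hmem : (fun i j => P i j (t, x)) ∈ symGE d ε := by
      refine ⟨fun i j => ?_, fun y => ?_⟩
      · simp only [hPa, hR i j, eq_comm (a := i)]
      · have h1 : ∑ i, ∑ j, P i j (t, x) * (y i * y j) = rhoFn R γ hγ hε (t, x) * ∑ i, y i ^ 2
            - ∑ i, ∑ j, R i j (t, x) * (y i * y j) := by
          simp only [hPa, sub_mul, Finset.sum_sub_distrib, ite_mul, zero_mul, Finset.sum_ite_eq,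
            Finset.mem_univ, if_true, Finset.mul_sum, sq]
        have h2 := (abs_le.1 (abs_quad_le (fun i j => R i j (t, x)) y)).2
        have h3 : 0 ≤ ∑ i, y i ^ 2 := Finset.sum_nonneg fun i _ => sq_nonneg _
        set S := ∑ i, ∑ j, R i j (t, x) ^ 2
        have hS : 0 ≤ S := Finset.sum_nonneg fun i _ => Finset.sum_nonneg fun j _ => sq_nonneg _
        have h4 : √S ≤ √(S + ε ^ 2) := Real.sqrt_le_sqrt (by nlinarith)
        have h5 : ε ≤ √(S + ε ^ 2) := Real.le_sqrt_of_sq_le (by linarith)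
        have h6 : ε + √S ≤ rhoFn R γ hγ hε (t, x) := by
          rw [rhoFn_apply]; linarith [hγ0 t ht]
        have h7 := mul_le_mul_of_nonneg_right h6 h3
        rw [h1]
        linarith
    have hbd : ‖fun i j => P i j (t, x)‖ ≤ ∑ i, ∑ j, |K i j| := by
      have h0 (i) : 0 ≤ ∑ j, |K i j| := Finset.sum_nonneg fun j _ => abs_nonneg _
      refine (pi_norm_le_iff_of_nonneg (Finset.sum_nonneg fun i _ => h0 i)).2 fun i =>
        (pi_norm_le_iff_of_nonneg (Finset.sum_nonneg fun i _ => h0 i)).2 fun j => ?_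
      calc |P i j (t, x)| ≤ |K i j| := (hK i j t ht x).trans (le_abs_self _)
        _ ≤ ∑ j, |K i j| := Finset.single_le_sum (f := fun j => |K i j|) (fun j _ => abs_nonneg _)
          (Finset.mem_univ j)
        _ ≤ _ := Finset.single_le_sum (f := fun i => ∑ j, |K i j|) (fun i _ => h0 i)
          (Finset.mem_univ i)
    refine (hdec _ hmem hbd i j).trans ?_
    rw [slice_apply, PS.sum_apply]
    refine Finset.sum_congr rfl fun k _ => ?_
    exact (mul_comm _ _).trans (congrArg (fun z : ℝ => ξ k i * ξ k j * z) (sq _))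

end StressStep

section StressStepConclusion

variable {d : ℕ}

lemma D_congr_slice {t : ℝ} {u v : PX d} (h : slice t u = slice t v) (j : Fin d) (x : Spc d) :
    PS.D (dirX d j) u (t, x) = PS.D (dirX d j) v (t, x) := by
  have h1 := D_slice t (dirE d j) u
  rw [h, D_slice] at h1
  exact (congrArg (fun z : PE d => z x) h1).symm

lemma abs_sqrt_add_sq_sub_le {s ε : ℝ} (hs : 0 ≤ s) (hε : 0 ≤ ε) : |√(s + ε ^ 2) - √s| ≤ ε := by
  have h1 : √s ≤ √(s + ε ^ 2) := Real.sqrt_le_sqrt (by nlinarith)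
  have h2 : √(s + ε ^ 2) ≤ √s + ε := Real.sqrt_le_iff.2
    ⟨by positivity, by nlinarith [Real.sq_sqrt hs, Real.sqrt_nonneg s]⟩
  rw [abs_of_nonneg (by linarith)]
  linarith

lemma abs_integral_rho_sub_le (R : Fin d → Fin d → PX d) {γ : ℝ → ℝ}
    (hγ : ContDiff ℝ (⊤ : ℕ∞) γ) {ε : ℝ} (hε : 0 < ε) (t : ℝ) :
    |∫ x, rhoFn R γ hγ hε (t, x) ∂(μT d) - 2 * ∫ x, √(∑ i, ∑ j, R i j (t, x) ^ 2) ∂(μT d)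
      - (2 * Real.pi) ^ d * γ t| ≤ 2 * ε * (2 * Real.pi) ^ d := by
  have hS : Integrable (fun x => √(∑ i, ∑ j, R i j (t, x) ^ 2)) (μT d) := by
    obtain ⟨K, hK⟩ := exists_bound_of_continuous
      (f := fun q : ℝ × Spc d => √(∑ i, ∑ j, R i j (t, q.2) ^ 2)) (by
        refine Real.continuous_sqrt.comp (continuous_finsetSum _ fun i _ =>
          continuous_finsetSum _ fun j _ => ((R i j).continuous.comp ?_).pow 2)
        fun_prop) (fun _ x m => by
        have h (i j) : R i j (t, x + (2 * Real.pi) • EuclideanSpace.single m 1) = R i j (t, x) :=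
          (R i j).spacePeriodic_slice t x m
        simp only [h]) 0
    refine Integrable.of_bound (Continuous.aestronglyMeasurable ?_) K
      (Eventually.of_forall fun x => hK 0 (by simp) x)
    refine Real.continuous_sqrt.comp (continuous_finsetSum _ fun i _ =>
      continuous_finsetSum _ fun j _ => ((R i j).continuous.comp ?_).pow 2)
    fun_prop
  have hγt : (2 * Real.pi) ^ d * γ t = ∫ _x : Spc d, γ t ∂(μT d) := by
    rw [integral_const, μT_real_univ, smul_eq_mul]
  have hI : Integrable (fun x => rhoFn R γ hγ hε (t, x) - 2 * √(∑ i, ∑ j, R i j (t, x) ^ 2))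
      (μT d) := (integrable_slice _ t).sub (hS.const_mul 2)
  rw [hγt, ← integral_const_mul, ← integral_sub (integrable_slice _ t) (hS.const_mul 2),
    ← integral_sub hI (integrable_const _),
    ← Real.norm_eq_abs]
  refine (norm_integral_le_of_norm_le_const (C := 2 * ε) (Eventually.of_forall fun x => ?_)).trans_eq
    (by rw [μT_real_univ])
  have h0 : 0 ≤ ∑ i, ∑ j, R i j (t, x) ^ 2 :=
    Finset.sum_nonneg fun i _ => Finset.sum_nonneg fun j _ => sq_nonneg _
  have h1 := abs_sqrt_add_sq_sub_le h0 hε.le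
  have h2 : rhoFn R γ hγ hε (t, x) - 2 * √(∑ i, ∑ j, R i j (t, x) ^ 2) - γ t
      = 2 * (√((∑ i, ∑ j, R i j (t, x) ^ 2) + ε ^ 2) - √(∑ i, ∑ j, R i j (t, x) ^ 2)) := by
    rw [rhoFn_apply]; ring
  rw [Real.norm_eq_abs, h2, abs_mul, abs_of_pos two_pos]
  linarith

/-- The perturbation step in components. -/
theorem exists_stress_step (hd : 2 ≤ d) {r : ℝ} (hr : 1 ≤ r) (hr' : 1 < d * (r⁻¹ - 2⁻¹))
    (v : Fin d → PX d) (R : Fin d → Fin d → PX d) (hR : ∀ i j, R i j = R j i)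
    (htr : ∑ i, R i i = 0) {γ : ℝ → ℝ} (hγ : ContDiff ℝ (⊤ : ℕ∞) γ) {T : ℝ}
    (hγ0 : ∀ t ∈ Icc 0 T, 0 < γ t) {ε : ℝ} (hε : 0 < ε) :
    ∃ (w : Fin d → PX d) (q : PX d) (S : Fin d → Fin d → PX d),
      (∀ i j, S i j = S j i) ∧ (∑ i, S i i = 0) ∧ (∑ i, PS.D (dirX d i) (w i) = 0) ∧
      ∀ t ∈ Icc 0 T,
        (∀ x i, (Dt d (w i) + ∑ j, PS.D (dirX d j) (v i * w j + w i * v j + w i * w j)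
            + PS.D (dirX d i) q : PX d) (t, x)
          = (∑ j, PS.D (dirX d j) (PS.D (dirX d j) (w i))
            + ∑ j, PS.D (dirX d j) (S i j - R i j) : PX d) (t, x)) ∧
        (∀ i, LB (ENNReal.ofReal r) (fun x => w i (t, x)) ε) ∧
        (∀ i j, LB (ENNReal.ofReal r) (fun x => PS.D (dirX d j) (w i) (t, x)) ε) ∧
        (∀ i j, LB 1 (fun x => S i j (t, x)) (2 * ε)) ∧
        |∫ x, ∑ i, w i (t, x) ^ 2 ∂(μT d) - 2 * d * ∫ x, √(∑ i, ∑ j, R i j (t, x) ^ 2) ∂(μT d)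
          - (2 * Real.pi) ^ d * d * γ t| ≤ ε * (1 + 2 * d * (2 * Real.pi) ^ d) := by
  have hd0 : (0 : ℝ) < d := by exact_mod_cast (by omega : 0 < d)
  obtain ⟨α, hα, ξ, a, hξ, hdec⟩ := exists_stress_decomp (by omega) R hR hγ hγ0 hε
  obtain ⟨w, q, E, hE, hdiv, heq, hest⟩ :=
    exists_perturbs hd hr hr' v T Finset.univ ξ (fun k _ => hξ k) a hε
  set ρ := rhoFn R γ hγ hε with hρ
  set m : PX d := (d : ℝ)⁻¹ • ∑ k, E k k with hm
  refine ⟨w, q - ρ - m, fun i j => E i j - if i = j then m else 0, fun i j => ?_, ?_, hdiv,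
    fun t ht => ⟨fun x i => ?_, (hest t ht).1, (hest t ht).2.1, fun i j => ?_, ?_⟩⟩
  · simp only [hE i j, eq_comm (a := i)]
  · simp only [if_true, Finset.sum_sub_distrib, Finset.sum_const, Finset.card_univ,
      Fintype.card_fin, hm]
    rw [← Nat.cast_smul_eq_nsmul ℝ, smul_smul, mul_inv_cancel₀ hd0.ne', one_smul, sub_self]
  · have h1 := congrArg (fun z : PX d => z (t, x)) (heq i)
    have h2 (j : Fin d) : PS.D (dirX d j) (∑ k, (ξ k i * ξ k j) • (a k * a k)) (t, x)
        = PS.D (dirX d j) ((if i = j then ρ else 0) - R i j) (t, x) :=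
      D_congr_slice (hdec t ht i j).symm j x
    have h3 (u : PX d) : ∑ j, PS.D (dirX d j) (if i = j then u else 0) (t, x)
        = PS.D (dirX d i) u (t, x) := by
      rw [Finset.sum_eq_single i, if_pos rfl]
      · intro j _ hj
        rw [if_neg hj.symm, map_zero]; rfl
      · simp
    simp only [PS.add_apply, PS.sum_apply, map_add, map_sub, PS.sub_apply, h2,
      Finset.sum_add_distrib, Finset.sum_sub_distrib, h3] at h1 ⊢
    linarith
  · obtain ⟨-, -, hEt, -⟩ := hest t ht
    have h1 := (hEt i j).abs.add le_rfl (LB.const_mul' (inv_nonneg.2 hd0.le)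
      (LB.sum le_rfl (s := Finset.univ) fun k _ => (hEt k k).abs))
    refine (h1.mono ?_ fun x => ?_).weaken ?_
    · exact (slice t (E i j - if i = j then m else 0)).continuous
    · have hmx : |m (t, x)| ≤ (d : ℝ)⁻¹ * ∑ k, |E k k (t, x)| := by
        rw [hm, PS.smul_apply, PS.sum_apply, abs_mul, abs_of_pos (inv_pos.2 hd0)]
        exact mul_le_mul_of_nonneg_left (Finset.abs_sum_le_sum_abs _ _) (inv_nonneg.2 hd0.le)
      rw [PS.sub_apply]
      refine (abs_sub _ _).trans (add_le_add le_rfl ?_)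
      split_ifs
      · exact hmx
      · rw [PS.zero_apply, abs_zero]
        exact (abs_nonneg _).trans hmx
    · rw [Finset.sum_const, Finset.card_univ, Fintype.card_fin, nsmul_eq_mul,
        inv_mul_cancel_left₀ hd0.ne']
      linarith
  · obtain ⟨-, -, -, hen⟩ := hest t ht
    have htr' (x) : (∑ k, a k * a k : PX d) (t, x) = d * ρ (t, x) := by
      have h1 (i : Fin d) : ρ (t, x) - R i i (t, x) = ∑ k, ξ k i * ξ k i * (a k (t, x) * a k (t, x)) := by
        have := congrArg (fun z : PE d => z x) (hdec t ht i i)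
        simp only [if_true, slice_apply, PS.sub_apply, PS.sum_apply] at this
        exact this
      have h2 : ∑ i, (ρ (t, x) - R i i (t, x)) = d * ρ (t, x) := by
        have := congrArg (fun z : PX d => z (t, x)) htr
        simp only [PS.sum_apply, PS.zero_apply] at this
        rw [Finset.sum_sub_distrib, this, sub_zero]
        simp
      rw [← h2, Finset.sum_congr rfl fun i _ => h1 i, Finset.sum_comm, PS.sum_apply]
      refine Finset.sum_congr rfl fun k _ => ?_
      rw [← Finset.sum_mul, sum_coord_sq (hξ k), one_mul]
      rfl
    have hw : ∫ x, ((∑ i, w i * w i) - ∑ k, a k * a k : PX d) (t, x) ∂(μT d)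
        = ∫ x, ∑ i, w i (t, x) ^ 2 ∂(μT d) - d * ∫ x, ρ (t, x) ∂(μT d) := by
      rw [← integral_const_mul]
      simp only [← htr']
      rw [← integral_sub]
      · refine integral_congr_ae (Eventually.of_forall fun x => ?_)
        simp only [PS.sub_apply, PS.sum_apply, PS.mul_apply, sq]
      · exact integrable_finsetSum _ fun i _ => integrable_slice (w i ^ 2) t
      · exact integrable_slice _ t
    rw [hw] at hen
    have h3 := abs_integral_rho_sub_le R hγ hε t
    rw [← hρ] at h3
    have h4 := mul_le_mul_of_nonneg_left h3 hd0.le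
    rw [← abs_of_pos hd0, ← abs_mul, abs_of_pos hd0] at h4
    refine (le_of_eq ?_).trans ((abs_add_le _ _).trans ((add_le_add hen h4).trans_eq ?_))
    · congr 1; ring
    · ring

end StressStepConclusion

/-! ### Vector fields with smooth periodic components -/

section Fields

variable {d : ℕ} {ι : Type*} [Fintype ι]

/-- The vector-valued field with the given components. -/
def field (u : ι → PX d) (t : ℝ) (x : Spc d) : EuclideanSpace ℝ ι := WithLp.toLp 2 fun i => u i (t, x)

lemma field_apply (u : ι → PX d) (t : ℝ) (x : Spc d) (i : ι) : field u t x i = u i (t, x) := rfl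

lemma smoothField_field (u : ι → PX d) : SmoothField (field u) := by
  refine ⟨(contDiff_piLp 2).2 fun i => (u i).contDiff, fun t x i => ?_⟩
  ext j
  exact (u j).spacePeriodic_slice t x i

lemma smoothField_scalar (u : PX d) : SmoothField fun t x => u (t, x) :=
  ⟨u.contDiff, fun t => u.spacePeriodic_slice t⟩

lemma SmoothField.exists_scalar {p : ℝ → Spc d → ℝ} (h : SmoothField p) :
    ∃ u : PX d, p = fun t x => u (t, x) := by
  refine ⟨⟨fun q => p q.1 q.2, h.1, fun q i => ?_⟩, rfl⟩
  have := h.2 q.1 q.2 i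
  simpa [perX, perE] using this

lemma SmoothField.exists_field {v : ℝ → Spc d → EuclideanSpace ℝ ι} (h : SmoothField v) :
    ∃ u : ι → PX d, v = field u := by
  refine ⟨fun i => ⟨fun q => v q.1 q.2 i, (contDiff_piLp 2).1 h.1 i, fun q j => ?_⟩, rfl⟩
  have := congrArg (fun z : EuclideanSpace ℝ ι => z i) (h.2 q.1 q.2 j)
  simpa [perX, perE] using this

lemma norm_euclidean_le (z : EuclideanSpace ℝ ι) : ‖z‖ ≤ ∑ i, |z i| := by
  rw [EuclideanSpace.norm_eq]
  refine Real.sqrt_le_iff.2 ⟨Finset.sum_nonneg fun i _ => abs_nonneg _, ?_⟩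
  simp only [Real.norm_eq_abs]
  exact Finset.sum_sq_le_sq_sum_of_nonneg fun i _ => abs_nonneg _

lemma differentiable_field (u : ι → PX d) (t : ℝ) : Differentiable ℝ (field u t) :=
  ((contDiff_piLp 2).2 fun i => (slice t (u i)).contDiff).differentiable (n := (⊤ : ℕ∞)) (by simp)

lemma continuous_field (u : ι → PX d) (t : ℝ) : Continuous (field u t) :=
  (differentiable_field u t).continuous

lemma deriv_PX (u : PX d) (t : ℝ) (x : Spc d) : deriv (fun s => u (s, x)) t = Dt d u (t, x) := by
  have h : HasFDerivAt (fun s => u (s, x))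
      ((fderiv ℝ (u : ℝ × Spc d → ℝ) (t, x)).comp (ContinuousLinearMap.inl ℝ ℝ (Spc d))) t :=
    HasFDerivAt.comp t u.differentiable.differentiableAt.hasFDerivAt (hasFDerivAt_prodMk_left t x)
  exact h.hasDerivAt.deriv

lemma fderiv_PX_single (u : PX d) (t : ℝ) (x : Spc d) (j : Fin d) :
    fderiv ℝ (fun y => u (t, y)) x (EuclideanSpace.single j 1) = PS.D (dirX d j) u (t, x) :=
  congrArg (fun z : PE d => z x) (D_slice t (dirE d j) u)

lemma fderiv_PX (u : PX d) (t : ℝ) (x ξ : Spc d) :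
    fderiv ℝ (fun y => u (t, y)) x ξ = ∑ j, ξ j * PS.D (dirX d j) u (t, x) := by
  conv_lhs => rw [← sum_dirE ξ, map_sum]
  refine Finset.sum_congr rfl fun j _ => ?_
  rw [map_smul, smul_eq_mul]
  exact congrArg _ (fderiv_PX_single u t x j)

lemma fderiv_field_apply (u : ι → PX d) (t : ℝ) (x e : Spc d) (i : ι) :
    fderiv ℝ (field u t) x e i = fderiv ℝ (fun y => u i (t, y)) x e := by
  have h : HasFDerivAt (fun y => u i (t, y)) _ x :=
    (PiLp.proj 2 (fun _ : ι => ℝ) i : _ →L[ℝ] ℝ).hasFDerivAt.comp x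
      (differentiable_field u t x).hasFDerivAt
  exact (congrArg (fun L : Spc d →L[ℝ] ℝ => L e) h.fderiv).symm

lemma norm_fderiv_field_le (u : Fin d → PX d) (t : ℝ) (x : Spc d) :
    ‖fderiv ℝ (field u t) x‖ ≤ ∑ j, ∑ i, |PS.D (dirX d j) (u i) (t, x)| := by
  refine ContinuousLinearMap.opNorm_le_bound _
    (Finset.sum_nonneg fun j _ => Finset.sum_nonneg fun i _ => abs_nonneg _) fun y => ?_
  conv_lhs => rw [← sum_dirE y, map_sum]
  rw [Finset.sum_mul]
  refine (norm_sum_le _ _).trans (Finset.sum_le_sum fun j _ => ?_)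
  rw [map_smul, norm_smul, mul_comm]
  refine mul_le_mul ((norm_euclidean_le _).trans_eq ?_) (PiLp.norm_apply_le y j) (norm_nonneg _)
    (Finset.sum_nonneg fun i _ => abs_nonneg _)
  refine Finset.sum_congr rfl fun i _ => congrArg _ ?_
  rw [fderiv_field_apply]
  exact fderiv_PX_single _ _ _ _

/-- The Navier–Stokes–Reynolds system in components. -/
lemma nsr_iff (T : ℝ) (V : Fin d → PX d) (p : PX d) (R : Fin d × Fin d → PX d) :
    NSR d T (field V) (fun t x => p (t, x)) (field R) ↔
      (∀ t ∈ Icc 0 T, ∀ x, ∀ i, Dt d (V i) (t, x) + ∑ j, V j (t, x) * PS.D (dirX d j) (V i) (t, x)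
          + PS.D (dirX d i) p (t, x) = ∑ j, PS.D (dirX d j) (PS.D (dirX d j) (V i)) (t, x)
          + ∑ j, PS.D (dirX d j) (R (i, j)) (t, x)) ∧
      ∀ t ∈ Icc 0 T, ∀ x, ∑ i, PS.D (dirX d i) (V i) (t, x) = 0 := by
  unfold NSR divg
  simp only [fderiv_field_apply, field_apply, deriv_PX, fderiv_PX_single, fderiv_PX _ _ _ (field _ _ _)]

end Fields

section Norms

variable {d : ℕ} {ι : Type*} [Fintype ι]

lemma integrable_norm_field (u : ι → PX d) (t : ℝ) :
    Integrable (fun x => ‖field u t x‖ ^ 2) (μT d) := by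
  simp only [EuclideanSpace.real_norm_sq_eq]
  exact integrable_finsetSum _ fun i _ => integrable_slice (u i ^ 2) t

lemma eLpNorm_two_field (u : ι → PX d) (t : ℝ) :
    (eLpNorm (field u t) 2 (μT d)).toReal ^ 2 = ∫ x, ∑ i, u i (t, x) ^ 2 ∂(μT d) := by
  have hm : MemLp (field u t) 2 (μT d) := (memLp_two_iff_integrable_sq_norm
    (continuous_field u t).aestronglyMeasurable).2 (integrable_norm_field u t)
  have h0 : 0 ≤ ∫ x, ‖field u t x‖ ^ 2 ∂(μT d) := integral_nonneg fun x => sq_nonneg _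
  have h := hm.eLpNorm_eq_integral_rpow_norm (by simp) (by simp)
  simp only [ENNReal.toReal_ofNat, Real.rpow_ofNat] at h
  rw [h, ENNReal.toReal_ofReal (by positivity), ← Real.rpow_natCast, ← Real.rpow_mul h0]
  norm_num
  exact integral_congr_ae (Eventually.of_forall fun x => EuclideanSpace.real_norm_sq_eq _)

lemma eLpNorm_one_field (u : ι → PX d) (t : ℝ) :
    (eLpNorm (field u t) 1 (μT d)).toReal = ∫ x, √(∑ i, u i (t, x) ^ 2) ∂(μT d) := by
  rw [eLpNorm_one_eq_lintegral_enorm,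
    ← integral_norm_eq_lintegral_enorm (continuous_field u t).aestronglyMeasurable]
  refine integral_congr_ae (Eventually.of_forall fun x => ?_)
  simp only [EuclideanSpace.norm_eq, Real.norm_eq_abs, sq_abs, field_apply]

lemma eLpNorm_field_le (u : ι → PX d) {t c : ℝ} {p : ℝ≥0∞} (hp : 1 ≤ p)
    (h : ∀ i, LB p (fun x => u i (t, x)) c) :
    LB p (fun x => ‖field u t x‖) (Fintype.card ι * c) := by
  refine ((LB.sum hp (s := Finset.univ) fun i _ => (h i).abs).mono
    (continuous_field u t).norm fun x => ?_).weaken (by simp)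
  rw [abs_norm]
  exact norm_euclidean_le _

lemma eLpNorm_fderiv_field_le (u : Fin d → PX d) {t c : ℝ} {p : ℝ≥0∞} (hp : 1 ≤ p)
    (h : ∀ i j, LB p (fun x => PS.D (dirX d j) (u i) (t, x)) c) :
    LB p (fun x => ‖fderiv ℝ (field u t) x‖) (d * (d * c)) := by
  have hc : Continuous (fderiv ℝ (field u t)) :=
    ((contDiff_piLp 2).2 fun i => (slice t (u i)).contDiff).continuous_fderiv
      (n := (⊤ : ℕ∞)) (by simp)
  refine ((LB.sum hp (s := Finset.univ) fun j _ => LB.sum hp (s := Finset.univ)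
    fun i _ => (h i j).abs).mono hc.norm fun x => ?_).weaken (by simp)
  rw [abs_norm]
  exact norm_fderiv_field_le u t x

end Norms

section Assembly

variable {d : ℕ}

/-- Adding a perturbation to a solution of the system. -/
lemma nsr_add {T : ℝ} {V W : Fin d → PX d} {p q : PX d} {R : Fin d × Fin d → PX d}
    {S : Fin d → Fin d → PX d} (h : NSR d T (field V) (fun t x => p (t, x)) (field R))
    (hW : ∑ i, PS.D (dirX d i) (W i) = 0)
    (heq : ∀ t ∈ Icc 0 T, ∀ x i,
      (Dt d (W i) + ∑ j, PS.D (dirX d j) (V i * W j + W i * V j + W i * W j)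
        + PS.D (dirX d i) q : PX d) (t, x)
      = (∑ j, PS.D (dirX d j) (PS.D (dirX d j) (W i))
        + ∑ j, PS.D (dirX d j) (S i j - R (i, j)) : PX d) (t, x)) :
    NSR d T (field fun i => V i + W i) (fun t x => (p + q) (t, x))
      (field fun k : Fin d × Fin d => S k.1 k.2) := by
  rw [nsr_iff] at h ⊢
  have hW' (t x) : ∑ i, PS.D (dirX d i) (W i) (t, x) = 0 := by
    have := congrArg (fun z : PX d => z (t, x)) hW
    simpa only [PS.sum_apply, PS.zero_apply] using this
  refine ⟨fun t ht x i => ?_, fun t ht x => ?_⟩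
  · have h1 := h.1 t ht x i
    have h2 := heq t ht x i
    have hV' := h.2 t ht x
    have hmul (u w : PX d) (j : Fin d) : PS.D (dirX d j) (u * w) (t, x)
        = u (t, x) * PS.D (dirX d j) w (t, x) + w (t, x) * PS.D (dirX d j) u (t, x) := by
      rw [Derivation.leibniz]; rfl
    have hconv : ∑ j, PS.D (dirX d j) (V i * W j + W i * V j + W i * W j) (t, x)
        = (∑ j, (V j + W j) (t, x) * PS.D (dirX d j) (V i + W i) (t, x)
            - ∑ j, V j (t, x) * PS.D (dirX d j) (V i) (t, x))
          + V i (t, x) * ∑ j, PS.D (dirX d j) (W j) (t, x)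
          + W i (t, x) * ∑ j, PS.D (dirX d j) (V j) (t, x)
          + W i (t, x) * ∑ j, PS.D (dirX d j) (W j) (t, x) := by
      rw [Finset.mul_sum, Finset.mul_sum, Finset.mul_sum, ← Finset.sum_sub_distrib,
        ← Finset.sum_add_distrib, ← Finset.sum_add_distrib, ← Finset.sum_add_distrib]
      refine Finset.sum_congr rfl fun j _ => ?_
      simp only [map_add, PS.add_apply, hmul]
      ring
    simp only [hW', hV', mul_zero, add_zero] at hconv
    rw [PS.add_apply, PS.add_apply, PS.sum_apply, hconv, PS.add_apply, PS.sum_apply,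
      PS.sum_apply] at h2
    simp only [map_add, map_sub, PS.add_apply, PS.sub_apply, Finset.sum_add_distrib,
      Finset.sum_sub_distrib] at h2 ⊢
    linarith
  · simp only [map_add, PS.add_apply, Finset.sum_add_distrib, hW', h.2 t ht x, add_zero]

lemma scaling_of_lt {r : ℝ} (hd : 3 ≤ d) (hr : r < 2 * (d : ℝ) / ((d : ℝ) + 2)) :
    1 < d * ((max 1 r)⁻¹ - 2⁻¹) := by
  have hd' : (3 : ℝ) ≤ d := by exact_mod_cast hd
  have h1 : max 1 r < 2 * (d : ℝ) / ((d : ℝ) + 2) :=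
    max_lt ((one_lt_div (by positivity)).2 (by linarith)) hr
  have h0 : 0 < max 1 r := lt_max_of_lt_left one_pos
  rw [lt_div_iff₀ (by positivity)] at h1
  have h2 : d * ((max 1 r)⁻¹ - 2⁻¹) = (2 * d - d * max 1 r) / (2 * max 1 r) := by
    field_simp
  rw [h2, lt_div_iff₀ (by positivity)]
  linarith

lemma eLpNorm_le_of_LB {F : Type*} [NormedAddCommGroup F] {f : Spc d → F} {p q : ℝ≥0∞} {c : ℝ}
    (h : LB p (fun x => ‖f x‖) c) (hq : q ≤ p) :
    eLpNorm f q (μT d) ≤ ENNReal.ofReal (c * LB.incl d q p) := by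
  rw [← eLpNorm_norm]
  exact (h.of_le hq).le

end Assembly

/-- Main convex integration proposition for the Navier-Stokes
equations (after Burczak-Modena-Székelyhidi): for `d ≥ 3`, a smooth strictly
positive `γ₀`, `δ > 0` and `r < 2d/(d+2)`, every smooth solution `(v,p,R̊)` of
the Navier-Stokes-Reynolds system admits another smooth solution `(v₁,p₁,R̊₁)`
with `‖(v₁−v)(t)‖_{W^{1,r}} + ‖R̊₁(t)‖_{L¹} < δ` and
`| ‖(v₁−v)(t)‖_{L²}² − 2d‖R̊(t)‖_{L¹} − (2π)^d d γ₀(t) | < δ` for all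
`t ∈ [0,T]`. -/
theorem main_convex_integration_ns
    (d : ℕ) (hd : 3 ≤ d) (T : ℝ) (hT : 0 < T)
    (γ₀ : ℝ → ℝ) (hγs : ContDiff ℝ (⊤ : ℕ∞) γ₀) (hγpos : ∀ t ∈ Icc (0:ℝ) T, 0 < γ₀ t)
    (δ : ℝ) (hδ : 0 < δ)
    (r : ℝ) (hr : r < 2*(d:ℝ)/((d:ℝ)+2))
    (v : ℝ → Spc d → Spc d) (pr : ℝ → Spc d → ℝ) (R : ℝ → Spc d → Mat d)
    (hv : SmoothField v) (hpr : SmoothField pr) (hR : SmoothField R)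
    (hRsym : TracelessSym R) (hNSR : NSR d T v pr R) :
    ∃ (v₁ : ℝ → Spc d → Spc d) (pr₁ : ℝ → Spc d → ℝ) (R₁ : ℝ → Spc d → Mat d),
      SmoothField v₁ ∧ SmoothField pr₁ ∧ SmoothField R₁
      ∧ TracelessSym R₁ ∧ NSR d T v₁ pr₁ R₁
      ∧ ∀ t ∈ Icc (0:ℝ) T,
          (eLpNorm (fun x => v₁ t x - v t x) (ENNReal.ofReal r) (μT d)
            + eLpNorm (fun x => fderiv ℝ (v₁ t) x - fderiv ℝ (v t) x)
                (ENNReal.ofReal r) (μT d)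
            + eLpNorm (R₁ t) 1 (μT d) < ENNReal.ofReal δ)
          ∧ |(eLpNorm (fun x => v₁ t x - v t x) 2 (μT d)).toReal ^ 2
              - 2 * (d:ℝ) * (eLpNorm (R t) 1 (μT d)).toReal
              - (2*Real.pi)^d * (d:ℝ) * γ₀ t| < δ := by
  obtain ⟨V, rfl⟩ := hv.exists_field
  obtain ⟨p, rfl⟩ := hpr.exists_scalar
  obtain ⟨P, rfl⟩ := hR.exists_field
  have hP (i j : Fin d) : P (i, j) = P (j, i) := PS.ext fun x => (hRsym x.1 x.2).1 i j
  have hPtr : ∑ i, P (i, i) = 0 := PS.ext fun x => by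
    rw [PS.sum_apply]
    exact (hRsym x.1 x.2).2
  set s := max 1 r with hs
  have hs1 : 1 ≤ ENNReal.ofReal s := by
    rw [← ENNReal.ofReal_one]
    exact ENNReal.ofReal_le_ofReal (le_max_left _ _)
  have hrs : ENNReal.ofReal r ≤ ENNReal.ofReal s := ENNReal.ofReal_le_ofReal (le_max_right _ _)
  set I := LB.incl d (ENNReal.ofReal r) (ENNReal.ofReal s)
  have hI : 0 < I := LB.incl_pos _ _ _
  set I' := LB.incl d 1 1
  have hI' : 0 < I' := LB.incl_pos _ _ _
  set C := (1 + 2 * d * (2 * Real.pi) ^ d) + (d * I + d * d * I + 2 * (d * d) * I')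
  have hC : 0 < C := by positivity
  set ε := δ / (C + 1) with hε
  have hε0 : 0 < ε := by positivity
  have hεC : ε * C < δ := by
    have : ε * (C + 1) = δ := by rw [hε]; field_simp
    linarith
  have hC1 : ε * (1 + 2 * d * (2 * Real.pi) ^ d) ≤ ε * C :=
    mul_le_mul_of_nonneg_left (le_add_of_nonneg_right (by positivity)) hε0.le
  have hC2 : ε * (d * I + d * d * I + 2 * (d * d) * I') ≤ ε * C :=
    mul_le_mul_of_nonneg_left (le_add_of_nonneg_left (by positivity)) hε0.le
  obtain ⟨W, q, S, hS, hStr, hW, hstep⟩ := exists_stress_step (by omega) (le_max_left 1 r)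
    (scaling_of_lt hd hr) V (fun i j => P (i, j)) hP hPtr hγs hγpos hε0
  have hsub (t : ℝ) (x : Spc d) : field (fun i => V i + W i) t x - field V t x = field W t x := by
    ext i
    exact add_sub_cancel_left (V i (t, x)) (W i (t, x))
  have hfsub (t : ℝ) (x : Spc d) : fderiv ℝ (field (fun i => V i + W i) t) x
      - fderiv ℝ (field V t) x = fderiv ℝ (field W t) x := by
    rw [← fderiv_fun_sub (differentiable_field _ t x) (differentiable_field _ t x)]
    simp only [hsub]
  refine ⟨field fun i => V i + W i, fun t x => (p + q) (t, x),
    field fun k : Fin d × Fin d => S k.1 k.2, smoothField_field _, smoothField_scalar _,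
    smoothField_field _, fun t x => ⟨fun i j => ?_, ?_⟩,
    nsr_add hNSR hW fun t ht => (hstep t ht).1, fun t ht => ⟨?_, ?_⟩⟩
  · exact congrArg (fun z : PX d => z (t, x)) (hS i j)
  · have := congrArg (fun z : PX d => z (t, x)) hStr
    rwa [PS.sum_apply] at this
  · obtain ⟨-, h1, h2, h3, -⟩ := hstep t ht
    have e1 := eLpNorm_le_of_LB (eLpNorm_field_le W hs1 h1) hrs
    have e2 := eLpNorm_le_of_LB (eLpNorm_fderiv_field_le W hs1 h2) hrs
    have e3 := eLpNorm_le_of_LB (eLpNorm_field_le (fun k : Fin d × Fin d => S k.1 k.2) le_rfl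
      fun k => h3 k.1 k.2) (le_refl 1)
    simp only [hsub, hfsub]
    refine (add_le_add (add_le_add e1 e2) e3).trans_lt ?_
    rw [Fintype.card_fin, Fintype.card_prod, Fintype.card_fin,
      ← ENNReal.ofReal_add (by positivity) (by positivity),
      ← ENNReal.ofReal_add (by positivity) (by positivity)]
    refine (ENNReal.ofReal_lt_ofReal_iff hδ).2 (lt_of_le_of_lt ?_ hεC)
    refine le_trans (le_of_eq ?_) hC2
    push_cast
    ring
  · obtain ⟨-, -, -, -, h4⟩ := hstep t ht
    simp only [hsub]
    have e1 := eLpNorm_two_field W t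
    have e2 := eLpNorm_one_field P t
    simp only [Fintype.sum_prod_type] at e2
    rw [show (eLpNorm (fun x => field W t x) 2 (μT d)).toReal ^ 2 = _ from e1, e2]
    exact h4.trans_lt (hC1.trans_lt hεC)
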